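/- arXiv:2205.13906 — 2 statements merged into one kernel-verified Lean document; each statement's English description precedes it below -/
import Mathlib

section
/- Let R be a Noetherian integral domain, G ⊆ GL_n(R) a finite subgroup, and S = R[x_1,…,x_n]. Assume that S^G is a Cohen-Macaulay ring and that f_1,…,f_n is a homogeneous system of parameters in S^G. Then S^G is generated as an R-algebra by homogeneous elements of degree at most max(deg(f_1), …, deg(f_n), ∑_{i=1}^n (deg(f_i) − 1)); that is, β_R(G) ≤ max(deg(f_1), …, deg(f_n), ∑_{i=1}^n (deg(f_i) − 1)). -/
open MvPolynomial TensorProduct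

set_option synthInstance.maxHeartbeats 1000000
set_option maxHeartbeats 1000000

/-- The action of `σ ∈ GLₙ(R)` on the polynomial ring `R[x₁,…,xₙ]`,
given by `σ(f) = f(σ⁻¹ (x₁,…,xₙ))`. -/
noncomputable def glAct {R : Type*} [CommRing R] {n : ℕ}
    (σ : Matrix.GeneralLinearGroup (Fin n) R) :
    MvPolynomial (Fin n) R →ₐ[R] MvPolynomial (Fin n) R :=
  MvPolynomial.aeval fun i =>
    ∑ j, ((σ⁻¹ : Matrix.GeneralLinearGroup (Fin n) R) : Matrix (Fin n) (Fin n) R) i j •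
      MvPolynomial.X j

/-- The ring of invariants `R[x₁,…,xₙ]^G` of a subgroup `G ⊆ GLₙ(R)`,
as a subalgebra of `R[x₁,…,xₙ]`. -/
noncomputable def invariants {R : Type*} [CommRing R] {n : ℕ}
    (G : Subgroup (Matrix.GeneralLinearGroup (Fin n) R)) :
    Subalgebra R (MvPolynomial (Fin n) R) :=
  ⨅ σ ∈ G, AlgHom.equalizer (glAct σ) (AlgHom.id R _)

/-- The map `GLₙ(R) → GLₙ(R')` induced by a ring homomorphism `R → R'`. -/
noncomputable def glMap {R R' : Type*} [CommRing R] [CommRing R'] {n : ℕ} (f : R →+* R') :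
    Matrix.GeneralLinearGroup (Fin n) R →* Matrix.GeneralLinearGroup (Fin n) R' :=
  Units.map (RingHom.toMonoidHom (RingHom.mapMatrix f))

/-- `R[x₁,…,xₙ]^G` is generated as an `R`-algebra by its homogeneous elements of
degree at most `d`. -/
def genByDeg {n : ℕ} (R : Type*) [CommRing R]
    (G : Subgroup (Matrix.GeneralLinearGroup (Fin n) R)) (d : ℕ) : Prop :=
  Algebra.adjoin R {f : MvPolynomial (Fin n) R |
    f ∈ invariants G ∧ ∃ i ≤ d, MvPolynomial.IsHomogeneous f i} = invariants G

/-- `f₁, …, fₘ` is a homogeneous system of parameters for `R[x₁,…,xₙ]^G`: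
the `fᵢ` are invariant, homogeneous of positive degree, algebraically independent over `R`,
and `R[x₁,…,xₙ]^G` is a finitely generated module over `R[f₁,…,fₘ]`. -/
def IsHSOPInv {n m : ℕ} {R : Type*} [CommRing R]
    (G : Subgroup (Matrix.GeneralLinearGroup (Fin n) R))
    (f : Fin m → MvPolynomial (Fin n) R) : Prop :=
  (∀ i, f i ∈ invariants G) ∧
  (∀ i, ∃ d : ℕ, 0 < d ∧ (f i).IsHomogeneous d) ∧
  AlgebraicIndependent R f ∧
  ∃ s : Finset (MvPolynomial (Fin n) R),
    ↑s ⊆ (invariants G : Set (MvPolynomial (Fin n) R)) ∧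
    (invariants G : Set (MvPolynomial (Fin n) R)) ⊆
      (Submodule.span (Algebra.adjoin R (Set.range f)) (s : Set (MvPolynomial (Fin n) R)) :
        Submodule (Algebra.adjoin R (Set.range f)) (MvPolynomial (Fin n) R))

/-- A commutative ring `T` is Cohen-Macaulay if for every maximal ideal `P` of `T`,
the localization `T_P` contains a regular sequence lying in its maximal ideal whose
length equals the Krull dimension of `T_P` (i.e. `depth T_P = dim T_P`). -/
def IsCohenMacaulayRing (T : Type*) [CommRing T] : Prop :=
  ∀ (P : Ideal T) (hP : P.IsMaximal),
    haveI : P.IsPrime := hP.isPrime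
    ∃ rs : List (Localization.AtPrime P),
      (∀ r ∈ rs, r ∈ IsLocalRing.maximalIdeal (Localization.AtPrime P)) ∧
      RingTheory.Sequence.IsRegular (Localization.AtPrime P) rs ∧
      (rs.length : WithBot ℕ∞) = ringKrullDim (Localization.AtPrime P)


section File1
open RingTheory.Sequence IsLocalRing Module Pointwise

section LocalCM
variable {B : Type*} [CommRing B] [IsLocalRing B] [IsNoetherianRing B]

/-- `M` has a weakly regular sequence of length `d` in the maximal ideal. -/
def HasRegSeq (B : Type*) [CommRing B] [IsLocalRing B] (M : Type*) [AddCommGroup M] [Module B M]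
    (d : ℕ) : Prop :=
  ∃ rs : List B, rs.length = d ∧ (∀ r ∈ rs, r ∈ maximalIdeal B) ∧ IsWeaklyRegular M rs

lemma hasRegSeq_succ {M : Type*} [AddCommGroup M] [Module B M] {d : ℕ} :
    HasRegSeq B M (d + 1) ↔ ∃ x ∈ maximalIdeal B, IsSMulRegular M x ∧
      HasRegSeq B (QuotSMulTop x M) d := by
  constructor
  · rintro ⟨rs, hl, hm, hr⟩
    match rs, hl with
    | x :: rs, hl =>
      rw [isWeaklyRegular_cons_iff] at hr
      exact ⟨x, hm x (by simp), hr.1, rs, by simpa using hl,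
        fun r h => hm r (by simp [h]), hr.2⟩
  · rintro ⟨x, hx, hr, rs, hl, hm, hr'⟩
    refine ⟨x :: rs, by simp [hl], ?_, ?_⟩
    · intro r h
      rcases List.mem_cons.1 h with rfl | h
      · exact hx
      · exact hm r h
    · rw [isWeaklyRegular_cons_iff]; exact ⟨hr, hr'⟩

lemma hasRegSeq_congr {M N : Type*} [AddCommGroup M] [Module B M] [AddCommGroup N] [Module B N]
    (e : M ≃ₗ[B] N) {d : ℕ} : HasRegSeq B M d ↔ HasRegSeq B N d := by
  simp only [HasRegSeq, e.isWeaklyRegular_congr]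

/-- swapping the two quotients -/
noncomputable def quotSwap (M : Type*) [AddCommGroup M] [Module B M] (x y : B) :
    QuotSMulTop x (QuotSMulTop y M) ≃ₗ[B] QuotSMulTop y (QuotSMulTop x M) :=
  (QuotSMulTop.congr x ((Submodule.quotEquivOfEq _ _ (by simp [Ideal.ofList_singleton, Submodule.ideal_span_singleton_smul])) : QuotSMulTop y M ≃ₗ[B] (M ⧸ (Ideal.ofList [y] • ⊤ : Submodule B M)))) ≪≫ₗ
  (Submodule.quotOfListConsSMulTopEquivQuotSMulTopOuter M x [y]).symm ≪≫ₗ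
  (Submodule.quotOfListConsSMulTopEquivQuotSMulTopInner M x [y]) ≪≫ₗ
  (Submodule.quotEquivOfEq _ _ (by simp [Ideal.ofList_singleton, Submodule.ideal_span_singleton_smul]))

lemma regular_swap {M : Type*} [AddCommGroup M] [Module B M] [Module.Finite B M] {x y : B}
    (hx : x ∈ maximalIdeal B) (hy : y ∈ maximalIdeal B)
    (h1 : IsSMulRegular M x) (h2 : IsSMulRegular (QuotSMulTop x M) y) :
    IsSMulRegular M y ∧ IsSMulRegular (QuotSMulTop y M) x := by
  have h : IsWeaklyRegular M [x, y] := by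
    rw [isWeaklyRegular_cons_iff, isWeaklyRegular_cons_iff]; exact ⟨h1, h2, .nil _ _⟩
  have := IsLocalRing.isWeaklyRegular_of_perm_of_subset_maximalIdeal h (List.Perm.swap y x [])
    (by
      intro r hr
      simp only [List.mem_cons, List.not_mem_nil, or_false] at hr
      rcases hr with rfl | rfl
      · exact hx
      · exact hy)
  rw [isWeaklyRegular_cons_iff, isWeaklyRegular_cons_iff] at this
  exact ⟨this.1, this.2.1⟩

lemma quot_mk_eq_zero {M : Type*} [AddCommGroup M] [Module B M] {x : B} {m : M} :
    (Submodule.Quotient.mk m : QuotSMulTop x M) = 0 ↔ ∃ m', m = x • m' := by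
  rw [Submodule.Quotient.mk_eq_zero, Submodule.mem_smul_pointwise_iff_exists]
  simp [eq_comm]

lemma not_assoc_max {M : Type*} [AddCommGroup M] [Module B M] {x y z: B}
    (hx : x ∈ maximalIdeal B) (hz : z ∈ maximalIdeal B)
    (h1 : IsSMulRegular M x) (h2 : IsSMulRegular (QuotSMulTop x M) z) (hy : IsSMulRegular M y) :
    maximalIdeal B ∉ associatedPrimes B (QuotSMulTop y M) := by
  intro h
  rw [AssociatedPrimes.mem_iff, isAssociatedPrime_iff] at h
  obtain ⟨hp, n, hn⟩ := h
  obtain ⟨n, rfl⟩ := Submodule.Quotient.mk_surjective _ n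
  have key : ∀ b ∈ maximalIdeal B, ∃ m, b • n = y • m := by
    intro b hb
    rw [hn, Submodule.mem_colon_singleton] at hb
    exact quot_mk_eq_zero.1 hb
  have hn0 : ¬ ∃ m, n = y • m := by
    intro hh
    apply hp.ne_top
    rw [hn, quot_mk_eq_zero.2 hh]
    simp
  obtain ⟨m', hm'⟩ := key x hx
  obtain ⟨mz, hmz⟩ := key z hz
  have e1 : z • m' = x • mz := by
    apply hy
    simp only
    rw [smul_comm, ← hm', smul_comm, hmz, smul_comm]
  have e2 : (Submodule.Quotient.mk m' : QuotSMulTop x M) = 0 := by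
    apply h2
    simp only [smul_zero]
    rw [← Submodule.Quotient.mk_smul]
    exact quot_mk_eq_zero.2 ⟨_, e1⟩
  obtain ⟨m'', rfl⟩ := quot_mk_eq_zero.1 e2
  apply hn0
  refine ⟨m'', h1 ?_⟩
  simp only
  rw [hm', smul_comm]

lemma exists_reg3 {M₁ M₂ M₃ : Type*} [AddCommGroup M₁] [Module B M₁] [Module.Finite B M₁]
    [AddCommGroup M₂] [Module B M₂] [Module.Finite B M₂]
    [AddCommGroup M₃] [Module B M₃] [Module.Finite B M₃]
    (h1 : maximalIdeal B ∉ associatedPrimes B M₁) (h2 : maximalIdeal B ∉ associatedPrimes B M₂)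
    (h3 : maximalIdeal B ∉ associatedPrimes B M₃) :
    ∃ z ∈ maximalIdeal B, IsSMulRegular M₁ z ∧ IsSMulRegular M₂ z ∧ IsSMulRegular M₃ z := by
  by_contra! hc
  have hfin := ((associatedPrimes.finite B M₁).union (associatedPrimes.finite B M₂)).union
    (associatedPrimes.finite B M₃)
  have hpr : ∀ p ∈ (associatedPrimes B M₁ ∪ associatedPrimes B M₂) ∪ associatedPrimes B M₃,
      p.IsPrime := by
    rintro p ((h | h) | h) <;> exact h.isPrime
  have := ((maximalIdeal B).subset_union_prime_finite hfin (f := id) 0 0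
    fun p h _ _ ↦ hpr p h).1 ?_
  · obtain ⟨p, hp, hle⟩ := this
    have : maximalIdeal B = p := (maximalIdeal.isMaximal B).eq_of_le (hpr p hp).ne_top hle
    subst this
    rcases hp with (h | h) | h <;> contradiction
  · intro z hz
    have e1 := biUnion_associatedPrimes_eq_compl_regular B M₁
    have e2 := biUnion_associatedPrimes_eq_compl_regular B M₂
    have e3 := biUnion_associatedPrimes_eq_compl_regular B M₃
    rw [Set.biUnion_union, Set.biUnion_union]
    simp only [id]
    rw [e1, e2, e3]
    have := hc z hz
    simp only [Set.mem_union, Set.mem_compl_iff, Set.mem_ofPred_eq]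
    tauto

lemma not_assoc_of_reg {M : Type*} [AddCommGroup M] [Module B M] {x : B}
    (hx : x ∈ maximalIdeal B) (h1 : IsSMulRegular M x) :
    maximalIdeal B ∉ associatedPrimes B M := by
  intro h
  have e1 := biUnion_associatedPrimes_eq_compl_regular B M
  have : x ∈ {r : B | IsSMulRegular M r}ᶜ := by
    rw [← e1]
    exact Set.mem_biUnion h hx
  exact this h1

lemma hasRegSeq_quot.{v} {d : ℕ} : ∀ {M : Type v} [AddCommGroup M] [Module B M] [Module.Finite B M]
    {y : B}, y ∈ maximalIdeal B → IsSMulRegular M y → HasRegSeq B M (d + 1) →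
      HasRegSeq B (QuotSMulTop y M) d := by
  induction d with
  | zero => intro M _ _ _ y _ _ _; exact ⟨[], by simp, by simp, .nil _ _⟩
  | succ d ih =>
    intro M _ _ _ y hy hyr h
    obtain ⟨x, hx, hxr, h'⟩ := hasRegSeq_succ.1 h
    obtain ⟨w, hw, hwr, -⟩ := hasRegSeq_succ.1 h'
    obtain ⟨z, hz, hz1, hz2, hz3⟩ := exists_reg3 (not_assoc_of_reg hx hxr)
      (not_assoc_max hx hw hxr hwr hyr) (not_assoc_of_reg hw hwr)
    have s1 := regular_swap hx hz hxr hz3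
    have a1 : HasRegSeq B (QuotSMulTop z M) (d + 1) :=
      hasRegSeq_succ.2 ⟨x, hx, s1.2, (hasRegSeq_congr (quotSwap M z x)).1 (ih hz hz3 h')⟩
    have s2 := regular_swap hy hz hyr hz2
    exact hasRegSeq_succ.2 ⟨z, hz, hz2, (hasRegSeq_congr (quotSwap M y z)).1 (ih hy s2.2 a1)⟩

lemma assoc_dim.{v} {d : ℕ} : ∀ {M : Type v} [AddCommGroup M] [Module B M] [Module.Finite B M]
    {p : Ideal B}, p ∈ associatedPrimes B M → HasRegSeq B M d →
      (d : WithBot ℕ∞) ≤ supportDim B (B ⧸ p) := by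
  induction d with
  | zero =>
    intro M _ _ _ p hp _
    have := hp.isPrime
    rw [supportDim_quotient_eq_ringKrullDim]
    have : Nontrivial (B ⧸ p) := Ideal.Quotient.nontrivial_iff.2 this.ne_top
    simpa using ringKrullDim_nonneg_of_nontrivial
  | succ d ih =>
    intro M _ _ _ p hp h
    obtain ⟨x, hx, hxr, h'⟩ := hasRegSeq_succ.1 h
    have hpp := hp.isPrime
    have hxp : x ∉ p := by
      intro hxp
      have : x ∈ {r : B | IsSMulRegular M r}ᶜ := by
        rw [← biUnion_associatedPrimes_eq_compl_regular B M]
        exact Set.mem_biUnion hp hxp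
      exact this hxr
    -- an element killed by p, not in xM
    obtain ⟨n, hn, hnx⟩ : ∃ n : M, (∀ b ∈ p, b • n = 0) ∧ ¬ ∃ m, n = x • m := by
      by_contra! hc
      rw [AssociatedPrimes.mem_iff, isAssociatedPrime_iff] at hp
      obtain ⟨_, n, hn⟩ := hp
      let N : Submodule B M := ⨅ b ∈ p, LinearMap.ker (LinearMap.lsmul B M b)
      have hN : ∀ m, m ∈ N ↔ ∀ b ∈ p, b • m = 0 := by
        intro m; simp [N, Submodule.mem_iInf]
      have : N = ⊥ := by
        apply Submodule.eq_bot_of_le_smul_of_le_jacobson_bot (Ideal.span {x}) N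
          (IsNoetherian.noetherian N)
        · intro m hm
          obtain ⟨m', rfl⟩ := hc m ((hN m).1 hm)
          apply Submodule.smul_mem_smul (Ideal.mem_span_singleton_self x)
          rw [hN] at hm ⊢
          intro b hb
          apply hxr
          simp only [smul_zero]
          rw [smul_comm]; exact hm b hb
        · rw [Ideal.span_singleton_le_iff_mem]
          exact maximalIdeal_le_jacobson _ hx
      have hnN : n ∈ N := by
        rw [hN]; intro b hb
        rw [hn, Submodule.mem_colon_singleton] at hb
        simpa using hb
      rw [this, Submodule.mem_bot] at hnN
      apply hpp.ne_top
      rw [hn, hnN]; simp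
    obtain ⟨q, hq, hle⟩ := exists_le_isAssociatedPrime_of_isNoetherianRing B
      (Submodule.Quotient.mk n : QuotSMulTop x M) (fun h0 => hnx (quot_mk_eq_zero.1 h0))
    have hpq : p ≤ q := by
      intro b hb
      apply hle
      rw [Submodule.mem_colon_singleton, ← Submodule.Quotient.mk_smul, hn b hb]
      simp
    have hxq : x ∈ q := by
      apply hle
      rw [Submodule.mem_colon_singleton, Submodule.mem_bot, ← Submodule.Quotient.mk_smul]
      exact quot_mk_eq_zero.2 ⟨n, rfl⟩
    have i1 := ih hq h'
    have hreg : IsSMulRegular (B ⧸ p) x := by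
      rw [isSMulRegular_iff_right_eq_zero_of_smul]
      intro b hb
      obtain ⟨b, rfl⟩ := Ideal.Quotient.mk_surjective b
      rw [Algebra.smul_def, Ideal.Quotient.algebraMap_eq, ← map_mul, Ideal.Quotient.eq_zero_iff_mem] at hb
      rw [Ideal.Quotient.eq_zero_iff_mem]
      exact (hpp.mem_or_mem hb).resolve_left hxp
    rw [← supportDim_quotSMulTop_succ_eq_supportDim hreg hx]
    push_cast
    gcongr
    refine i1.trans ?_
    let g : B ⧸ p →ₗ[B] B ⧸ q := (Ideal.Quotient.factorₐ B hpq).toLinearMap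
    have hg : Function.Surjective g := Ideal.Quotient.factor_surjective hpq
    refine supportDim_le_of_surjective (M := QuotSMulTop x (B ⧸ p)) (Submodule.liftQ _ g ?_) ?_
    · intro b hb
      rw [Submodule.mem_smul_pointwise_iff_exists] at hb
      obtain ⟨b, -, rfl⟩ := hb
      rw [LinearMap.mem_ker, map_smul]
      obtain ⟨c, hc⟩ := Ideal.Quotient.mk_surjective (g b)
      rw [← hc, Algebra.smul_def, Ideal.Quotient.algebraMap_eq, ← map_mul,
        Ideal.Quotient.eq_zero_iff_mem]
      exact q.mul_mem_right _ hxq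
    · intro c
      obtain ⟨b, rfl⟩ := hg c
      exact ⟨Submodule.Quotient.mk b, by simp⟩

lemma reg_of_dim {M : Type*} [AddCommGroup M] [Module B M] [Module.Finite B M] {d : ℕ}
    (h : HasRegSeq B M d) {y : B}
    (hd : supportDim B (QuotSMulTop y M) < d) : IsSMulRegular M y := by
  by_contra hc
  have : y ∈ {r : B | IsSMulRegular M r}ᶜ := hc
  rw [← biUnion_associatedPrimes_eq_compl_regular B M] at this
  simp only [Set.mem_iUnion] at this
  obtain ⟨p, hp, hyp⟩ := this
  have h1 := assoc_dim hp h
  have h2 : supportDim B (B ⧸ p) ≤ supportDim B (QuotSMulTop y M) := by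
    have hsub : support B (B ⧸ p) ⊆ support B (QuotSMulTop y M) := by
      rw [support_quotSMulTop]
      intro q hq
      have hpq : p ≤ q.asIdeal := by
        rw [mem_support_iff_of_finite, Ideal.annihilator_quotient] at hq
        exact hq
      refine ⟨?_, ?_⟩
      · rw [mem_support_iff_of_finite]
        have := hp.annihilator_le
        rw [Submodule.annihilator_top] at this
        exact this.trans hpq
      · simpa using hpq hyp
    exact Order.krullDim_le_of_strictMono (fun q => ⟨q.1, hsub q.2⟩) (fun a b h => h)
  exact absurd (h1.trans h2) (not_le.2 hd)

lemma supportDim_le_list.{v} : ∀ (ys : List B) {N : Type v} [AddCommGroup N] [Module B N]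
    [Module.Finite B N], (∀ y ∈ ys, y ∈ maximalIdeal B) →
    supportDim B N ≤ supportDim B (N ⧸ (Ideal.ofList ys • ⊤ : Submodule B N)) + ys.length := by
  intro ys
  induction ys with
  | nil =>
    intro N _ _ _ _
    have e : (N ⧸ (Ideal.ofList ([] : List B) • ⊤ : Submodule B N)) ≃ₗ[B] N :=
      Submodule.quotEquivOfEqBot _ (by simp)
    rw [supportDim_eq_of_equiv e]; simp
  | cons y ys ih =>
    intro N _ _ _ hys
    rw [supportDim_eq_of_equiv (Submodule.quotOfListConsSMulTopEquivQuotSMulTopInner N y ys)]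
    refine (supportDim_le_supportDim_quotSMulTop_succ (hys y (by simp))).trans ?_
    have := ih (N := QuotSMulTop y N) (fun z hz => hys z (by simp [hz]))
    simp only [List.length_cons]
    push_cast
    rw [← add_assoc]
    gcongr

lemma weaklyReg_of_dim.{v} : ∀ (ys : List B) {M : Type v} [AddCommGroup M] [Module B M]
    [Module.Finite B M] [Nontrivial M] {d : ℕ}, HasRegSeq B M d → (∀ y ∈ ys, y ∈ maximalIdeal B) →
    supportDim B (M ⧸ (Ideal.ofList ys • ⊤ : Submodule B M)) + ys.length ≤ d →
    IsWeaklyRegular M ys := by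
  intro ys
  induction ys with
  | nil => intros; exact .nil _ _
  | cons y ys ih =>
    intro M _ _ _ _ d h hys hd
    have hy := hys y (by simp)
    have hys' : ∀ z ∈ ys, z ∈ maximalIdeal B := fun z hz => hys z (by simp [hz])
    have : Nontrivial (QuotSMulTop y M) := nontrivial_quotSMulTop_of_mem_maximalIdeal M hy
    rw [supportDim_eq_of_equiv (Submodule.quotOfListConsSMulTopEquivQuotSMulTopInner M y ys)] at hd
    have hnt : Nontrivial (QuotSMulTop y M ⧸ (Ideal.ofList ys • ⊤ : Submodule B (QuotSMulTop y M))) := by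
      apply Submodule.Quotient.nontrivial_iff.2
      exact (Submodule.top_ne_ideal_smul_of_le_jacobson_annihilator
        ((Ideal.span_le.mpr hys').trans (maximalIdeal_le_jacobson _))).symm
    have hdim : supportDim B (QuotSMulTop y M) ≤
       supportDim B (QuotSMulTop y M ⧸ (Ideal.ofList ys • ⊤ : Submodule B (QuotSMulTop y M))) + ys.length := supportDim_le_list ys hys'
    have hne := supportDim_ne_bot_of_nontrivial B (QuotSMulTop y M ⧸ (Ideal.ofList ys • ⊤ : Submodule B (QuotSMulTop y M)))
    generalize hD : supportDim B (QuotSMulTop y M ⧸ (Ideal.ofList ys • ⊤ : Submodule B (QuotSMulTop y M))) = D at *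
    obtain ⟨k, rfl⟩ : ∃ k : ℕ, D = k := by
      induction D with
      | bot => exact absurd rfl hne
      | coe D =>
        induction D with
        | top =>
          exfalso
          have h2 : ((⊤ : ℕ∞) : WithBot ℕ∞) ≤ ((d : ℕ∞) : WithBot ℕ∞) := by
            refine le_trans ?_ hd
            rw [show ((List.length (y :: ys) : ℕ) : WithBot ℕ∞) = (((y :: ys).length : ℕ∞) : WithBot ℕ∞) from rfl,
              ← WithBot.coe_add, top_add]
          rw [WithBot.coe_le_coe] at h2
          simp at h2
        | coe k => exact ⟨k, rfl⟩
    have hk : k + (ys.length + 1) ≤ d := by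
      simp only [List.length_cons] at hd
      exact_mod_cast hd
    obtain ⟨d, rfl⟩ : ∃ d', d = d' + 1 := ⟨d - 1, by omega⟩
    have hyr : IsSMulRegular M y := by
      apply reg_of_dim h
      refine hdim.trans_lt ?_
      have : k + ys.length < d + 1 := by omega
      exact_mod_cast this
    rw [isWeaklyRegular_cons_iff]
    refine ⟨hyr, ih (hasRegSeq_quot hy hyr h) hys' ?_⟩
    rw [hD]
    have : k + ys.length ≤ d := by omega
    exact_mod_cast this
end LocalCM

end File1

section File2
open RingTheory.Sequence IsLocalRing Module Pointwise

section Dim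
variable {R T : Type*} [CommRing R] [CommRing T] [Algebra R T]

/-- the strictly monotone map on spectra. -/
lemma specMap_strictMono (P : Ideal T) [P.IsPrime] (J : Ideal T)
    (hJ : Algebra.IsIntegral R (T ⧸ J)) :
    ∃ φ : PrimeSpectrum (Localization.AtPrime P ⧸ J.map (algebraMap T (Localization.AtPrime P))) →
      PrimeSpectrum R, StrictMono φ ∧ ∀ q, (φ q).asIdeal ≤ P.comap (algebraMap R T) ∧
      (J.comap (algebraMap R T) ≤ (φ q).asIdeal) := by
  set B := Localization.AtPrime P
  set J' := J.map (algebraMap T B)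
  let ψ : PrimeSpectrum (B ⧸ J') → PrimeSpectrum T :=
    fun q => PrimeSpectrum.comap (algebraMap T B) (PrimeSpectrum.comap (Ideal.Quotient.mk J') q)
  have hψ : StrictMono ψ := by
    have h1 : StrictMono (PrimeSpectrum.comap (Ideal.Quotient.mk J')) := by
      apply Monotone.strictMono_of_injective
      · intro a b h; exact Ideal.comap_mono h
      · exact PrimeSpectrum.comap_injective_of_surjective _ Ideal.Quotient.mk_surjective
    have h2 : StrictMono (PrimeSpectrum.comap (algebraMap T B)) := by
      apply Monotone.strictMono_of_injective
      · intro a b h; exact Ideal.comap_mono h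
      · exact PrimeSpectrum.localization_comap_injective B P.primeCompl
    exact h2.comp h1
  have hJψ : ∀ q, J ≤ (ψ q).asIdeal := by
    intro q t ht
    change Ideal.Quotient.mk J' (algebraMap T B t) ∈ q.asIdeal
    rw [Ideal.Quotient.eq_zero_iff_mem.2 (Ideal.mem_map_of_mem _ ht)]
    exact zero_mem _
  have hPψ : ∀ q, (ψ q).asIdeal ≤ P := by
    intro q t ht
    by_contra hc
    have hu : IsUnit (algebraMap T B t) := IsLocalization.map_units (M := P.primeCompl) B ⟨t, hc⟩
    exact q.2.ne_top (Ideal.eq_top_of_isUnit_mem _ ht (hu.map _))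
  refine ⟨fun q => PrimeSpectrum.comap (algebraMap R T) (ψ q), ?_, ?_⟩
  · intro a b hab
    have h := hψ hab
    obtain ⟨x, hxb, hxa⟩ := Set.exists_of_ssubset (show ((ψ a).asIdeal : Set T) ⊂ (ψ b).asIdeal from h)
    obtain ⟨p, hpm, hp⟩ := hJ.isIntegral (Ideal.Quotient.mk J x)
    have hp' : Polynomial.eval₂ (algebraMap R T) x p ∈ (ψ a).asIdeal := by
      apply hJψ a
      rw [← Ideal.Quotient.eq_zero_iff_mem, Polynomial.hom_eval₂]
      exact hp
    refine Ideal.comap_lt_comap_of_root_mem_sdiff (f := algebraMap R T) h.le ⟨hxb, hxa⟩ (p := p) ?_ hp'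
    have : Nontrivial (R ⧸ (ψ a).asIdeal.comap (algebraMap R T)) :=
      Ideal.Quotient.nontrivial_iff.2 (Ideal.IsPrime.ne_top inferInstance)
    exact (hpm.map _).ne_zero
  · intro q
    exact ⟨Ideal.comap_mono (hPψ q), Ideal.comap_mono (hJψ q)⟩

lemma dim_quot_le (P : Ideal T) [P.IsPrime] (J : Ideal T) (p : Ideal R) [p.IsPrime]
    (hp : P.comap (algebraMap R T) = p)
    (hJ : Algebra.IsIntegral R (T ⧸ J)) :
    ringKrullDim (Localization.AtPrime P ⧸ J.map (algebraMap T (Localization.AtPrime P))) ≤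
      p.height := by
  obtain ⟨φ, hφ, h⟩ := specMap_strictMono P J hJ
  have : (p.height : WithBot ℕ∞) = Order.krullDim (Set.Iic (⟨p, inferInstance⟩ : PrimeSpectrum R)) := by
    rw [← Order.height_eq_krullDim_Iic, ← PrimeSpectrum.height_eq_orderHeight]
  rw [this]
  exact Order.krullDim_le_of_strictMono (fun q => ⟨φ q, hp ▸ (h q).1⟩) (fun a b hab => hφ hab)

lemma dim_quot_le' [IsDomain R] (P : Ideal T) [P.IsPrime] (J : Ideal T) (p : Ideal R) [p.IsPrime]
    (hp : P.comap (algebraMap R T) = p) (r : R) (hr : r ≠ 0) (hrJ : algebraMap R T r ∈ J)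
    (hJ : Algebra.IsIntegral R (T ⧸ J)) :
    ringKrullDim (Localization.AtPrime P ⧸ J.map (algebraMap T (Localization.AtPrime P))) + 1 ≤
      p.height := by
  obtain ⟨φ, hφ, h⟩ := specMap_strictMono P J hJ
  have : (p.height : WithBot ℕ∞) = Order.krullDim (Set.Iic (⟨p, inferInstance⟩ : PrimeSpectrum R)) := by
    rw [← Order.height_eq_krullDim_Iic, ← PrimeSpectrum.height_eq_orderHeight]
  rw [this]
  rcases isEmpty_or_nonempty (PrimeSpectrum (Localization.AtPrime P ⧸ J.map (algebraMap T (Localization.AtPrime P)))) with he | he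
  · rw [ringKrullDim, Order.krullDim_eq_bot_iff.2 he]; simp
  rw [ringKrullDim, ← Order.krullDim_withBot]
  refine Order.krullDim_le_of_strictMono (fun q => WithBot.recBotCoe ⟨⟨⊥, Ideal.isPrime_bot⟩, (fun _ h => by rw [Ideal.mem_bot.1 h]; exact zero_mem _)⟩
    (fun q => ⟨φ q, hp ▸ (h q).1⟩) q) ?_
  rw [WithBot.strictMono_iff]
  refine ⟨fun a b hab => hφ hab, fun a => ?_⟩
  refine lt_of_le_of_ne ((fun _ h => by rw [Ideal.mem_bot.1 h]; exact zero_mem _)) ?_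
  intro hc
  have h1 : (φ a).asIdeal = ⊥ := by
    have := congrArg (fun x => x.1.asIdeal) hc
    exact this.symm
  have := (h a).2 (show r ∈ _ from hrJ)
  rw [h1] at this
  exact hr this
end Dim

section Dim2
variable {R : Type*} [CommRing R] {n : ℕ}
open MvPolynomial

/-- set the first `i` variables to zero -/
noncomputable def zeroOut (R : Type*) [CommRing R] (n : ℕ) (i : ℕ) :
    MvPolynomial (Fin n) R →ₐ[R] MvPolynomial (Fin n) R :=
  aeval fun j => if j.1 < i then 0 else X j

lemma zeroOut_comp (i : ℕ) : (zeroOut R n (i+1)).comp (zeroOut R n i) = zeroOut R n (i+1) := by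
  apply MvPolynomial.algHom_ext
  intro j
  simp only [zeroOut, AlgHom.comp_apply, aeval_X]
  split_ifs <;> simp <;> omega

lemma zeroOut_n (g : MvPolynomial (Fin n) R) : zeroOut R n n g = C (constantCoeff g) := by
  have : zeroOut R n n = (Algebra.ofId R _).comp (aeval (fun _ => 0)) := by
    apply MvPolynomial.algHom_ext
    intro j
    simp [zeroOut]
  rw [this]
  simp [Algebra.ofId_apply]

lemma height_zeroOut [IsDomain R] (i : ℕ) (hi : i ≤ n) :
    (i : ℕ∞) ≤ (RingHom.ker (zeroOut R n i)).height := by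
  induction i with
  | zero => simp
  | succ i ih =>
    have h1 := RingHom.ker_isPrime (zeroOut R n i)
    have h2 := RingHom.ker_isPrime (zeroOut R n (i+1))
    have hlt : RingHom.ker (zeroOut R n i) < RingHom.ker (zeroOut R n (i+1)) := by
      rw [SetLike.lt_iff_le_and_exists]
      refine ⟨fun g hg => ?_, X ⟨i, hi⟩, ?_, ?_⟩
      · rw [RingHom.mem_ker] at hg ⊢
        rw [← zeroOut_comp, AlgHom.comp_apply, hg, map_zero]
      · simp [RingHom.mem_ker, zeroOut]
      · simp [RingHom.mem_ker, zeroOut]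
    refine le_trans ?_ (Ideal.height_add_one_le_of_lt_of_isPrime hlt)
    push_cast
    gcongr
    exact ih (by omega)

lemma height_comap_constantCoeff [IsDomain R] [IsNoetherianRing R] (p : Ideal R) [p.IsPrime] :
    (n : ℕ∞) + p.height ≤ (p.comap (constantCoeff (σ := Fin n))).height := by
  obtain ⟨l, hl, hlen⟩ := Ideal.exists_ltSeries_length_eq_height p
  have key : ∀ k (hk : k < l.length + 1), (n : ℕ∞) + k ≤
      ((l ⟨k, hk⟩).asIdeal.comap (constantCoeff (σ := Fin n))).height := by
    intro k
    induction k with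
    | zero =>
      intro hk
      simp only [Nat.cast_zero, add_zero]
      refine (height_zeroOut (R := R) n le_rfl).trans (Ideal.height_mono ?_)
      intro g hg
      rw [RingHom.mem_ker, zeroOut_n, C_eq_zero] at hg
      rw [Ideal.mem_comap, hg]
      exact zero_mem _
    | succ k ih =>
      intro hk
      have h := ih (by omega)
      have hlt : (l ⟨k, by omega⟩) < (l ⟨k+1, hk⟩) := l.strictMono (by simp [Fin.lt_def])
      have : (l ⟨k, by omega⟩).asIdeal.comap (constantCoeff (σ := Fin n)) <
        (l ⟨k+1, hk⟩).asIdeal.comap (constantCoeff (σ := Fin n)) := by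
        rw [SetLike.lt_iff_le_and_exists]
        obtain ⟨x, hxb, hxa⟩ := Set.exists_of_ssubset
          (show ((l ⟨k, by omega⟩).asIdeal : Set R) ⊂ (l ⟨k+1, hk⟩).asIdeal from hlt)
        refine ⟨Ideal.comap_mono hlt.le, C x, by simpa using hxb, by simpa using hxa⟩
      refine le_trans ?_ (Ideal.height_add_one_le_of_lt_of_isPrime this)
      push_cast
      rw [← add_assoc]
      gcongr
  have := key l.length (by omega)
  have e : (l ⟨l.length, by omega⟩).asIdeal = p := by
    have : l ⟨l.length, by omega⟩ = l.last := rfl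
    rw [this, hl]
  rw [e, hlen] at this
  exact this

variable {T : Type*} [CommRing T]

lemma height_comap_integral {S : Type*} [CommRing S] [Algebra T S] [Algebra.IsIntegral T S]
    (Q : Ideal S) [Q.IsPrime] : Q.height ≤ (Q.comap (algebraMap T S)).height := by
  have := Order.height_le_height_apply_of_strictMono (PrimeSpectrum.comap (algebraMap T S))
    (fun a b h => Ideal.IsIntegral.comap_lt_comap h) ⟨Q, inferInstance⟩
  rw [← PrimeSpectrum.height_eq_orderHeight, ← PrimeSpectrum.height_eq_orderHeight] at this
  exact this

variable [Algebra R T] [Algebra T (MvPolynomial (Fin n) R)]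
  [IsScalarTower R T (MvPolynomial (Fin n) R)]

/-- the ideal above `p`. -/
noncomputable def bigP (T : Type*) [CommRing T] [Algebra T (MvPolynomial (Fin n) R)] (p : Ideal R) : Ideal T :=
  p.comap ((constantCoeff (σ := Fin n)).comp (algebraMap T (MvPolynomial (Fin n) R)))

instance (p : Ideal R) [p.IsPrime] : (bigP (n := n) T p).IsPrime :=
  Ideal.comap_isPrime _ _

lemma bigP_comap (p : Ideal R) : (bigP (n := n) T p).comap (algebraMap R T) = p := by
  ext r
  simp only [bigP, Ideal.mem_comap, RingHom.comp_apply]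
  rw [← IsScalarTower.algebraMap_apply, MvPolynomial.algebraMap_eq, constantCoeff_C]

lemma bigP_maximal (p : Ideal R) [p.IsMaximal] : (bigP (n := n) T p).IsMaximal := by
  apply Ideal.comap_isMaximal_of_surjective
  intro r
  refine ⟨algebraMap R T r, ?_⟩
  rw [RingHom.comp_apply, ← IsScalarTower.algebraMap_apply, MvPolynomial.algebraMap_eq, constantCoeff_C]

lemma dim_lower [IsDomain R] [IsNoetherianRing R] [Algebra.IsIntegral T (MvPolynomial (Fin n) R)]
    (p : Ideal R) [p.IsPrime] :
    (n : WithBot ℕ∞) + p.height ≤ ringKrullDim (Localization.AtPrime (bigP (n := n) T p)) := by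
  rw [IsLocalization.AtPrime.ringKrullDim_eq_height (bigP (n := n) T p)]
  have := (height_comap_constantCoeff (n := n) p).trans (height_comap_integral (T := T) _)
  exact_mod_cast this

/-- Cohen-Macaulay condition (weak form). -/
def CMat (P : Ideal T) [P.IsPrime] : Prop :=
  ∃ d : ℕ, HasRegSeq (Localization.AtPrime P) (Localization.AtPrime P) d ∧
    ringKrullDim (Localization.AtPrime P) ≤ d

lemma local_reg_aux [IsNoetherianRing T] (P : Ideal T) [P.IsPrime] (hCM : CMat P) (ys : List T)
    (hys : ∀ y ∈ ys, y ∈ P)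
    (hdim : ringKrullDim (Localization.AtPrime P ⧸
      (Ideal.ofList ys).map (algebraMap T (Localization.AtPrime P))) + ys.length ≤
      ringKrullDim (Localization.AtPrime P)) (l₁ : List T) (y : T) (l₂ : List T)
    (hl : ys = l₁ ++ y :: l₂) (g : T) (hg : y * g ∈ Ideal.ofList l₁) :
    ∃ s ∉ P, s * g ∈ Ideal.ofList l₁ := by
  obtain ⟨d, hd, hdd⟩ := hCM
  set B := Localization.AtPrime P
  have hw : IsWeaklyRegular B (ys.map (algebraMap T B)) := by
    refine weaklyReg_of_dim _ hd ?_ ?_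
    · intro b hb
      obtain ⟨y, hy, rfl⟩ := List.mem_map.1 hb
      exact (IsLocalization.AtPrime.to_map_mem_maximal_iff B P y).2 (hys y hy)
    · refine le_trans ?_ hdd
      refine le_trans (le_of_eq ?_) hdim
      rw [List.length_map, ← Ideal.map_ofList, ← supportDim_quotient_eq_ringKrullDim]
      congr 1
      apply supportDim_eq_of_equiv
      exact Submodule.quotEquivOfEq _ _ (by rw [smul_eq_mul, Ideal.mul_top])
  subst hl
  rw [List.map_append, isWeaklyRegular_append_iff, List.map_cons, isWeaklyRegular_cons_iff] at hw
  have h1 := hw.2.1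
  refine (IsLocalization.algebraMap_mem_map_algebraMap_iff P.primeCompl B (Ideal.ofList l₁) g).1 ?_
  have h2 : algebraMap T B y * algebraMap T B g ∈ (Ideal.ofList l₁).map (algebraMap T B) := by
    rw [← map_mul]; exact Ideal.mem_map_of_mem _ hg
  rw [Ideal.map_ofList] at h2 ⊢
  have h3 : (Submodule.Quotient.mk (algebraMap T B g) :
    B ⧸ (Ideal.ofList (l₁.map (algebraMap T B)) • ⊤ : Submodule B B)) = 0 := by
    apply h1
    simp only [smul_zero]
    rw [← Submodule.Quotient.mk_smul, Submodule.Quotient.mk_eq_zero]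
    simpa using h2
  rw [Submodule.Quotient.mk_eq_zero] at h3
  simpa using h3

lemma local_reg [IsDomain R] [IsNoetherianRing R] [IsNoetherianRing T]
    [Algebra.IsIntegral T (MvPolynomial (Fin n) R)]
    (p : Ideal R) [p.IsPrime] (hCM : CMat (bigP (n := n) T p)) (ys : List T) (hn : ys.length = n)
    (hys : ∀ y ∈ ys, constantCoeff (algebraMap T (MvPolynomial (Fin n) R) y) = 0)
    (hint : Algebra.IsIntegral R (T ⧸ Ideal.ofList ys))
    (l₁ : List T) (y : T) (l₂ : List T)
    (hl : ys = l₁ ++ y :: l₂) (g : T) (hg : y * g ∈ Ideal.ofList l₁) :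
    ∃ s ∉ bigP (n := n) T p, s * g ∈ Ideal.ofList l₁ := by
  refine local_reg_aux _ hCM ys ?_ ?_ l₁ y l₂ hl g hg
  · intro y hy
    rw [bigP, Ideal.mem_comap, RingHom.comp_apply, hys y hy]
    exact zero_mem _
  · refine le_trans ?_ (dim_lower p)
    rw [add_comm, hn]
    gcongr
    exact dim_quot_le _ _ p (bigP_comap p) hint

lemma local_reg' [IsDomain R] [IsNoetherianRing R] [IsNoetherianRing T]
    [Algebra.IsIntegral T (MvPolynomial (Fin n) R)]
    (p : Ideal R) [p.IsPrime] (hCM : CMat (bigP (n := n) T p)) (ys : List T) (hn : ys.length = n)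
    (hys : ∀ y ∈ ys, constantCoeff (algebraMap T (MvPolynomial (Fin n) R) y) = 0)
    (hint : Algebra.IsIntegral R (T ⧸ Ideal.ofList ys)) (r : R) (hr : r ≠ 0)
    (g : T) (hg : algebraMap R T r * g ∈ Ideal.ofList ys) :
    ∃ s ∉ bigP (n := n) T p, s * g ∈ Ideal.ofList ys := by
  by_cases hrp : r ∈ p
  swap
  · refine ⟨algebraMap R T r, ?_, hg⟩
    rw [← bigP_comap (n := n) (T := T) p] at hrp
    exact hrp
  refine local_reg_aux _ hCM (ys ++ [algebraMap R T r]) ?_ ?_ ys _ [] rfl g hg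
  · intro y hy
    rcases List.mem_append.1 hy with hy | hy
    · rw [bigP, Ideal.mem_comap, RingHom.comp_apply, hys y hy]
      exact zero_mem _
    · rw [List.mem_singleton.1 hy]
      rw [← bigP_comap (n := n) (T := T) p] at hrp
      exact hrp
  · refine le_trans ?_ (dim_lower p)
    rw [List.length_append, hn]
    have hle : Ideal.ofList ys ≤ Ideal.ofList (ys ++ [algebraMap R T r]) := by
      rw [Ideal.ofList_append]; exact le_sup_left
    have hint' : Algebra.IsIntegral R (T ⧸ Ideal.ofList (ys ++ [algebraMap R T r])) :=
      Algebra.IsIntegral.of_surjective (Ideal.Quotient.factorₐ R hle) (Ideal.Quotient.factor_surjective hle)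
    have := dim_quot_le' (bigP (n := n) T p) _ p (bigP_comap p) r hr
      (by rw [Ideal.ofList_append]; exact Ideal.mem_sup_right (by simp)) hint'
    rw [add_comm (n : WithBot ℕ∞)]
    simp only [List.length_singleton, Nat.cast_add, Nat.cast_one]
    rw [add_comm (n : WithBot ℕ∞), ← add_assoc]
    gcongr
end Dim2

end File2

section File3
open RingTheory.Sequence IsLocalRing Module Pointwise

section Graded
variable {R T : Type*} [CommRing R] [CommRing T] [Algebra R T] (𝒯 : ℕ → Submodule R T)
  [GradedAlgebra 𝒯]

/-- elementary form of weak regularity -/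
def GReg (ys : List T) : Prop :=
  ∀ l₁ y l₂, ys = l₁ ++ y :: l₂ → ∀ g, y * g ∈ Ideal.ofList l₁ → g ∈ Ideal.ofList l₁

/-- augmentation -/
structure IsAug (ε : T →+* R) : Prop where
  alg : ∀ r, ε (algebraMap R T r) = r
  pos : ∀ e, 0 < e → ∀ t ∈ 𝒯 e, ε t = 0
  zero : ∀ t ∈ 𝒯 0, t = algebraMap R T (ε t)

variable {𝒯}

lemma decomp_induction {p : T → Prop} (h0 : p 0) (hadd : ∀ a b, p a → p b → p (a + b)) (t : T)
    (h : ∀ e, p (DirectSum.decompose 𝒯 t e)) : p t := by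
  classical
  rw [← DirectSum.sum_support_decompose 𝒯 t]
  exact Finset.sum_induction _ p hadd h0 (fun e _ => h e)

lemma IsAug.decompose_zero {ε : T →+* R} (hε : IsAug 𝒯 ε) (t : T) :
    (DirectSum.decompose 𝒯 t 0 : T) = algebraMap R T (ε t) := by
  classical
  rw [hε.zero _ (DirectSum.decompose 𝒯 t 0).2]
  congr 1
  conv_rhs => rw [← DirectSum.sum_support_decompose 𝒯 t]
  rw [map_sum]
  by_cases h0 : 0 ∈ (DirectSum.decompose 𝒯 t).support
  · rw [Finset.sum_eq_single_of_mem 0 h0]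
    intro b _ hb
    exact hε.pos b (Nat.pos_of_ne_zero hb) _ (DirectSum.decompose 𝒯 t b).2
  · rw [Finset.sum_eq_zero]
    · rw [DFinsupp.notMem_support_iff] at h0
      rw [h0]; simp
    · intro b hb
      exact hε.pos b (Nat.pos_of_ne_zero (fun h => h0 (h ▸ hb))) _ (DirectSum.decompose 𝒯 t b).2

lemma homog_ofList {ys : List T} (hys : ∀ y ∈ ys, ∃ e, y ∈ 𝒯 e) :
    (Ideal.ofList ys).IsHomogeneous 𝒯 :=
  Ideal.homogeneous_span 𝒯 _ (fun y hy => hys y hy)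

lemma glob {ε : T →+* R} (hε : IsAug 𝒯 ε) {I : Ideal T} (hI : I.IsHomogeneous 𝒯) {y : T} {d : ℕ}
    (hy : y ∈ 𝒯 d)
    (h : ∀ p : Ideal R, p.IsMaximal → ∀ g, y * g ∈ I → ∃ s, ε s ∉ p ∧ s * g ∈ I) (g : T)
    (hg : y * g ∈ I) : g ∈ I := by
  refine decomp_induction (𝒯 := 𝒯) (p := fun t => t ∈ I) (zero_mem _) (fun _ _ => add_mem) g
    fun e => ?_
  have h1 : y * (DirectSum.decompose 𝒯 g e : T) ∈ I := by
    have := hI (d + e) hg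
    rwa [DirectSum.coe_decompose_mul_of_left_mem_of_le 𝒯 hy (by omega), Nat.add_sub_cancel_left] at this
  set g' := (DirectSum.decompose 𝒯 g e : T) with hg'
  have hge : g' ∈ 𝒯 e := (DirectSum.decompose 𝒯 g e).2
  let c : Ideal R := (Submodule.colon I {g'}).comap (algebraMap R T)
  have hc : c = ⊤ := by
    by_contra hc
    obtain ⟨p, hp, hle⟩ := Ideal.exists_le_maximal c hc
    obtain ⟨s, hs, hsg⟩ := h p hp g' h1
    apply hs
    apply hle
    rw [Ideal.mem_comap, Submodule.mem_colon_singleton, smul_eq_mul, ← hε.decompose_zero]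
    have := hI e hsg
    rwa [DirectSum.coe_decompose_mul_of_right_mem_of_le 𝒯 hge le_rfl, Nat.sub_self] at this
  have : (1 : R) ∈ c := hc ▸ Submodule.mem_top
  rw [Ideal.mem_comap, Submodule.mem_colon_singleton, map_one, one_smul] at this
  exact this
end Graded

section Sub
open MvPolynomial
variable {R : Type*} [CommRing R] {n : ℕ} {T : Type*} [CommRing T]
  [Algebra R T] [Algebra T (MvPolynomial (Fin n) R)]
  [IsScalarTower R T (MvPolynomial (Fin n) R)]

/-- the induced grading -/
noncomputable def grT (R : Type*) [CommRing R] (n : ℕ) (T : Type*) [CommRing T]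
  [Algebra R T] [Algebra T (MvPolynomial (Fin n) R)]
  [IsScalarTower R T (MvPolynomial (Fin n) R)] (e : ℕ) : Submodule R T :=
  (homogeneousSubmodule (Fin n) R e).comap (IsScalarTower.toAlgHom R T (MvPolynomial (Fin n) R)).toLinearMap

lemma mem_grT {t : T} {e : ℕ} : t ∈ grT R n T e ↔ (algebraMap T (MvPolynomial (Fin n) R) t).IsHomogeneous e := by
  rfl

lemma grT_internal (hinj : Function.Injective (algebraMap T (MvPolynomial (Fin n) R)))
    (hcomp : ∀ (t : T) (e : ℕ), ∃ t', algebraMap T (MvPolynomial (Fin n) R) t' =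
      homogeneousComponent e (algebraMap T (MvPolynomial (Fin n) R) t)) :
    DirectSum.IsInternal (grT R n T) := by
  classical
  constructor
  · rw [injective_iff_map_eq_zero]
    intro x hx
    ext j
    rw [DirectSum.coeAddMonoidHom_eq_dfinsuppSum, DFinsupp.sum] at hx
    have h1 := congrArg (fun t => homogeneousComponent j (algebraMap T (MvPolynomial (Fin n) R) t)) hx
    simp only [map_sum, map_zero] at h1
    apply hinj
    rw [DirectSum.zero_apply, ZeroMemClass.coe_zero, map_zero, ← h1]
    have h2 : ∀ i, homogeneousComponent j (algebraMap T (MvPolynomial (Fin n) R) (x i)) =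
      if i = j then algebraMap T (MvPolynomial (Fin n) R) (x j) else 0 := by
      intro i
      rw [homogeneousComponent_of_mem (n := i) (mem_grT.1 (x i).2)]
      by_cases h : i = j
      · subst h; simp
      · rw [if_neg h, if_neg (fun h' => h h'.symm)]
    simp only [h2]
    rw [Finset.sum_ite_eq']
    split_ifs with h
    · rfl
    · rw [DFinsupp.notMem_support_iff] at h
      rw [h]; simp
  · intro t
    choose c hc using hcomp t
    have hmem : ∀ e, c e ∈ grT R n T e := fun e => by
      rw [mem_grT, hc]; exact homogeneousComponent_isHomogeneous _ _
    refine ⟨∑ e ∈ Finset.range ((algebraMap T (MvPolynomial (Fin n) R) t).totalDegree + 1),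
      DirectSum.of (fun e => grT R n T e) e ⟨c e, hmem e⟩, ?_⟩
    rw [map_sum]
    simp only [DirectSum.coeAddMonoidHom_of]
    apply hinj
    rw [map_sum]
    simp only [hc]
    exact sum_homogeneousComponent _

/-- graded algebra structure -/
noncomputable def grT_gradedAlgebra (hinj : Function.Injective (algebraMap T (MvPolynomial (Fin n) R)))
    (hcomp : ∀ (t : T) (e : ℕ), ∃ t', algebraMap T (MvPolynomial (Fin n) R) t' =
      homogeneousComponent e (algebraMap T (MvPolynomial (Fin n) R) t)) :
    GradedAlgebra (grT R n T) :=
  { (grT_internal hinj hcomp).chooseDecomposition with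
    one_mem := by rw [mem_grT, map_one]; exact isHomogeneous_one _ _
    mul_mem := by
      intro i j a b ha hb
      rw [mem_grT] at *
      rw [map_mul]; exact ha.mul hb }

lemma grT_isAug (hinj : Function.Injective (algebraMap T (MvPolynomial (Fin n) R))) :
    IsAug (grT R n T) ((constantCoeff (σ := Fin n)).comp (algebraMap T (MvPolynomial (Fin n) R))) where
  alg r := by
    rw [RingHom.comp_apply, ← IsScalarTower.algebraMap_apply, MvPolynomial.algebraMap_eq, constantCoeff_C]
  pos e he t ht := by
    rw [mem_grT] at ht
    rw [RingHom.comp_apply, constantCoeff_eq]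
    exact ht.coeff_eq_zero (by simpa using he.ne)
  zero t ht := by
    rw [mem_grT] at ht
    apply hinj
    rw [← IsScalarTower.algebraMap_apply, MvPolynomial.algebraMap_eq, RingHom.comp_apply]
    have := (totalDegree_zero_iff_isHomogeneous _).2 ht
    rw [totalDegree_eq_zero_iff_eq_C] at this
    exact this

theorem greg_of_CM [IsDomain R] [IsNoetherianRing R] [IsNoetherianRing T]
    [Algebra.IsIntegral T (MvPolynomial (Fin n) R)] [GradedAlgebra (grT R n T)]
    (hinj : Function.Injective (algebraMap T (MvPolynomial (Fin n) R)))
    (hCM : ∀ (p : Ideal R) [p.IsMaximal], CMat (bigP (n := n) T p)) (ys : List T) (hn : ys.length = n)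
    (hys : ∀ y ∈ ys, ∃ e, 0 < e ∧ y ∈ grT R n T e)
    (hint : Algebra.IsIntegral R (T ⧸ Ideal.ofList ys)) :
    GReg ys ∧ ∀ r : R, r ≠ 0 → ∀ g, algebraMap R T r * g ∈ Ideal.ofList ys → g ∈ Ideal.ofList ys := by
  have hε := grT_isAug (n := n) (R := R) hinj
  have hy0 : ∀ y ∈ ys, constantCoeff (algebraMap T (MvPolynomial (Fin n) R) y) = 0 := by
    intro y hy
    obtain ⟨e, he, h⟩ := hys y hy
    exact hε.pos e he y h
  constructor
  · intro l₁ y l₂ hl g hg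
    obtain ⟨e, he, hye⟩ := hys y (by simp [hl])
    refine glob hε (homog_ofList (fun z hz => ?_)) hye (fun p hp g hg => ?_) g hg
    · obtain ⟨e, -, h⟩ := hys z (by simp [hl, hz])
      exact ⟨e, h⟩
    · exact local_reg p (hCM p) ys hn hy0 hint l₁ y l₂ hl g hg
  · intro r hr g hg
    refine glob hε (homog_ofList (fun z hz => ?_)) (y := algebraMap R T r) (d := 0) ?_ (fun p hp g hg => ?_) g hg
    · obtain ⟨e, -, h⟩ := hys z hz
      exact ⟨e, h⟩
    · exact SetLike.algebraMap_mem_graded _ _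
    · exact local_reg' p (hCM p) ys hn hy0 hint r hr g hg
end Sub

end File3

section File4
open RingTheory.Sequence IsLocalRing Module Pointwise

section Part4
variable {R T : Type*} [CommRing R] [CommRing T] [Algebra R T]

/-- independence of the family `t` over the subalgebra `A` modulo `L` -/
def IndepMod {ι : Type*} (A : Subalgebra R T) (L : Ideal T) (t : ι → T) : Prop :=
  ∀ (s : Finset ι) (c : ι → T), (∀ j, c j ∈ A) → ∑ j ∈ s, c j * t j ∈ L → ∀ j ∈ s, c j = 0

lemma indepMod_step {ι : Type*} {A : Subalgebra R T} {L : Ideal T} {t : ι → T} {y : T}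
    (hy : ∀ g, y * g ∈ L → g ∈ L) (h : IndepMod A (L ⊔ Ideal.span {y}) t) (A' : Subalgebra R T)
    (hA' : ∀ a ∈ A', ∃ q : Polynomial A, Polynomial.aeval y q = a) : IndepMod A' L t := by
  have key : ∀ (s : Finset ι) (N : ℕ) (q : ι → Polynomial A), (∀ j ∈ s, ∀ k ≥ N, (q j).coeff k = 0) →
      ∑ j ∈ s, Polynomial.aeval y (q j) * t j ∈ L → ∀ j ∈ s, q j = 0 := by
    intro s N
    induction N with
    | zero =>
      intro q hq _ j hj
      ext k
      rw [hq j hj k (by omega)]; simp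
    | succ N ih =>
      intro q hq hsum
      have e : ∀ j, Polynomial.aeval y (q j) = y * Polynomial.aeval y (q j).divX + ((q j).coeff 0 : T) := by
        intro j
        conv_lhs => rw [← Polynomial.divX_mul_X_add (q j)]
        rw [map_add, map_mul, Polynomial.aeval_X, Polynomial.aeval_C, mul_comm]
        rfl
      have e2 : ∑ j ∈ s, Polynomial.aeval y (q j) * t j =
        y * (∑ j ∈ s, Polynomial.aeval y (q j).divX * t j) + ∑ j ∈ s, ((q j).coeff 0 : T) * t j := by
        rw [Finset.mul_sum, ← Finset.sum_add_distrib]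
        refine Finset.sum_congr rfl fun j _ => ?_
        rw [e]; ring
      have h0 : ∀ j ∈ s, ((q j).coeff 0 : T) = 0 := by
        refine h s _ (fun j => ((q j).coeff 0).2) ?_
        rw [eq_sub_of_add_eq' e2.symm]
        refine sub_mem (Ideal.mem_sup_left hsum) (Ideal.mem_sup_right ?_)
        exact Ideal.mul_mem_right _ _ (Ideal.mem_span_singleton_self y)
      have h1 : ∑ j ∈ s, ((q j).coeff 0 : T) * t j = 0 :=
        Finset.sum_eq_zero fun j hj => by rw [h0 j hj, zero_mul]
      rw [e2, h1, add_zero] at hsum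
      have h2 := ih (fun j => (q j).divX) (fun j hj k hk => by
        rw [Polynomial.coeff_divX]; exact hq j hj (k + 1) (by omega)) (hy _ hsum)
      intro j hj
      rw [← Polynomial.divX_mul_X_add (q j), h2 j hj]
      have : (q j).coeff 0 = 0 := Subtype.ext (h0 j hj)
      rw [this]; simp
  intro s c hc hsum j hj
  choose q hq using fun j => hA' (c j) (hc j)
  obtain ⟨N, hN⟩ : ∃ N, ∀ j ∈ s, (q j).natDegree < N :=
    ⟨s.sup (fun j => (q j).natDegree) + 1, fun j hj =>
      Nat.lt_succ_of_le (Finset.le_sup (f := fun j => (q j).natDegree) hj)⟩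
  have := key s N q (fun j hj k hk => Polynomial.coeff_eq_zero_of_natDegree_lt ((hN j hj).trans_le hk))
    (by simpa only [hq] using hsum) j hj
  rw [← hq, this, map_zero]

lemma adjoin_insert_poly (y : T) (s : Set T) (a : T) (ha : a ∈ Algebra.adjoin R (insert y s)) :
    ∃ q : Polynomial (Algebra.adjoin R s), Polynomial.aeval y q = a := by
  let B : Subalgebra R T := (Polynomial.aeval (R := Algebra.adjoin R s) y).range.restrictScalars R
  have : Algebra.adjoin R (insert y s) ≤ B := by
    rw [Algebra.adjoin_le_iff]
    intro x hx
    rcases hx with rfl | hx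
    · exact ⟨Polynomial.X, by simp⟩
    · exact ⟨Polynomial.C ⟨x, Algebra.subset_adjoin hx⟩, by simp⟩
  exact this ha

lemma indepMod_list {ι : Type*} {t : ι → T} {ys : List T} (hreg : GReg ys)
    (h : IndepMod (⊥ : Subalgebra R T) (Ideal.ofList ys) t) :
    IndepMod (Algebra.adjoin R {y | y ∈ ys}) ⊥ t := by
  have key : ∀ l₂ l₁ : List T, ys = l₁ ++ l₂ → IndepMod (Algebra.adjoin R {y | y ∈ l₂}) (Ideal.ofList l₁) t := by
    intro l₂
    induction l₂ with
    | nil =>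
      intro l₁ hl
      rw [List.append_nil] at hl
      subst hl
      have : {y : T | y ∈ ([] : List T)} = ∅ := by ext; simp
      rw [this, Algebra.adjoin_empty]
      exact h
    | cons y l₂ ih =>
      intro l₁ hl
      have := ih (l₁ ++ [y]) (by simp [hl])
      rw [Ideal.ofList_append, Ideal.ofList_singleton] at this
      refine indepMod_step (hreg l₁ y l₂ hl) this _ ?_
      intro a ha
      apply adjoin_insert_poly
      convert ha using 2
      ext; simp
  have := key ys [] rfl
  rwa [Ideal.ofList_nil] at this

/-- saturation with respect to nonzero scalars -/
def sat [IsDomain R] {A : Subalgebra R T} (N : Submodule A T) : Submodule A T where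
  carrier := {u | ∃ c : R, c ≠ 0 ∧ algebraMap R T c * u ∈ N}
  zero_mem' := ⟨1, one_ne_zero, by simp⟩
  add_mem' := by
    rintro a b ⟨c, hc, ha⟩ ⟨c', hc', hb⟩
    refine ⟨c * c', mul_ne_zero hc hc', ?_⟩
    have h1 := N.smul_mem (algebraMap R A c') ha
    have h2 := N.smul_mem (algebraMap R A c) hb
    convert N.add_mem h1 h2 using 1
    simp only [Algebra.smul_def, map_mul]
    rw [← IsScalarTower.algebraMap_apply, ← IsScalarTower.algebraMap_apply]
    ring
  smul_mem' := by
    rintro a u ⟨c, hc, hu⟩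
    refine ⟨c, hc, ?_⟩
    have := N.smul_mem a hu
    rwa [← mul_smul_comm] at this

lemma sat_of_smul [IsDomain R] {A : Subalgebra R T} {N : Submodule A T} {c : R} (hc : c ≠ 0) {u : T}
    (h : algebraMap R T c * u ∈ sat N) : u ∈ sat N := by
  obtain ⟨c', hc', h'⟩ := h
  exact ⟨c' * c, mul_ne_zero hc' hc, by rwa [map_mul, mul_assoc]⟩

lemma le_sat [IsDomain R] {A : Subalgebra R T} (N : Submodule A T) : N ≤ sat N :=
  fun u hu => ⟨1, one_ne_zero, by simpa using hu⟩

lemma sat_mono [IsDomain R] {A : Subalgebra R T} {N N' : Submodule A T} (h : N ≤ N') : sat N ≤ sat N' :=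
  fun _ ⟨c, hc, hu⟩ => ⟨c, hc, h hu⟩

variable (𝒯 : ℕ → Submodule R T) [GradedAlgebra 𝒯]

/-- If `u` is homogeneous and lies in the ideal generated by homogeneous `ys` of positive degree. -/
lemma mem_ofList_homog {ys : List T} (hys : ∀ y ∈ ys, ∃ e, 0 < e ∧ y ∈ 𝒯 e) {m : ℕ} {u : T}
    (hu : u ∈ Ideal.ofList ys) {A : Subalgebra R T} (hA : ∀ y ∈ ys, y ∈ A) {N : Submodule A T}
    (hN : ∀ k < m, ∀ g ∈ 𝒯 k, g ∈ N) : (DirectSum.decompose 𝒯 u m : T) ∈ N := by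
  refine Submodule.span_induction (p := fun u _ => ∀ g : T, (DirectSum.decompose 𝒯 (g * u) m : T) ∈ N)
    ?_ ?_ ?_ ?_ hu 1 |> fun h => by simpa using h
  · intro y hy g
    obtain ⟨e, he, hye⟩ := hys y hy
    by_cases hem : e ≤ m
    · rw [DirectSum.coe_decompose_mul_of_right_mem_of_le 𝒯 hye hem, mul_comm]
      exact N.smul_mem ⟨y, hA y hy⟩ (hN (m - e) (by omega) _ (DirectSum.decompose 𝒯 g (m - e)).2)
    · rw [DirectSum.coe_decompose_mul_of_right_mem_of_not_le 𝒯 hye hem]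
      exact zero_mem _
  · intro g; simp
  · intro a b _ _ ha hb g
    rw [mul_add, DirectSum.decompose_add, DirectSum.add_apply]
    exact N.add_mem (ha g) (hb g)
  · intro a b _ hb g
    rw [smul_eq_mul, ← mul_assoc]
    exact hb _

theorem graded_main [IsDomain R] [IsDomain T] (hRT : Function.Injective (algebraMap R T))
    {ys : List T} (hys : ∀ y ∈ ys, ∃ e, 0 < e ∧ y ∈ 𝒯 e) (hreg : GReg ys)
    (htf : ∀ r : R, r ≠ 0 → ∀ g, algebraMap R T r * g ∈ Ideal.ofList ys → g ∈ Ideal.ofList ys)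
    (δ : ℕ) (hB : ∀ e > δ, ∀ t ∈ 𝒯 e, ∃ a ∈ Algebra.adjoin R {y | y ∈ ys}, a ≠ 0 ∧
      a * t ∈ Submodule.span (Algebra.adjoin R {y | y ∈ ys}) {u : T | ∃ m ≤ δ, u ∈ 𝒯 m})
    (e : ℕ) (he : δ < e) (t : T) (ht : t ∈ 𝒯 e) : t ∈ Ideal.ofList ys := by
  classical
  set A := Algebra.adjoin R {y | y ∈ ys} with hA
  set I := Ideal.ofList ys with hI
  let v : (Σ e, 𝒯 e) → T ⧸ I := fun h => Ideal.Quotient.mk I (h.2 : T)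
  obtain ⟨s, hs, hmax⟩ := exists_maximal_linearIndepOn R v
  let w : s → T := fun j => (j.1.2 : T)
  have hind0 : IndepMod (⊥ : Subalgebra R T) I w := by
    intro F c hc hsum
    choose r hr using fun j => Algebra.mem_bot.1 (hc j)
    have h1 := linearIndependent_iff'.1 hs F r (by
      rw [← Ideal.Quotient.eq_zero_iff_mem, map_sum] at hsum
      rw [← hsum]
      refine Finset.sum_congr rfl fun j _ => ?_
      rw [← hr, Algebra.smul_def, map_mul]
      rfl)
    intro j hj
    rw [← hr, h1 j hj, map_zero]
  have hU := indepMod_list hreg hind0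
  -- spanning
  have hspan : ∀ u : (Σ e, 𝒯 e), ∃ a : R, a ≠ 0 ∧ ∃ z ∈ I, algebraMap R T a * u.2 - z ∈
      Submodule.span R ((fun h : (Σ e, 𝒯 e) => (h.2 : T)) '' s) := by
    intro u
    have : ∃ a : R, a ≠ 0 ∧ a • v u ∈ Submodule.span R (v '' s) := by
      by_cases hu : u ∈ s
      · exact ⟨1, one_ne_zero, by rw [one_smul]; exact Submodule.subset_span ⟨u, hu, rfl⟩⟩
      · exact hmax u hu
    obtain ⟨a, ha, h⟩ := this
    refine ⟨a, ha, ?_⟩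
    have e1 : v '' s = (Ideal.Quotient.mkₐ R I).toLinearMap '' ((fun h : (Σ e, 𝒯 e) => (h.2 : T)) '' s) := by
      rw [← Set.image_comp]; rfl
    rw [e1, ← Submodule.map_span, Submodule.mem_map] at h
    obtain ⟨x, hx, hxe⟩ := h
    refine ⟨algebraMap R T a * u.2 - x, ?_, by simpa using hx⟩
    rw [← Ideal.Quotient.eq_zero_iff_mem, map_sub, sub_eq_zero, map_mul]
    rw [Algebra.smul_def] at hxe
    exact hxe.symm
  have hcomp : ∀ m x, x ∈ Submodule.span R ((fun h : (Σ e, 𝒯 e) => (h.2 : T)) '' s) →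
      (DirectSum.decompose 𝒯 x m : T) ∈ Submodule.span A ((fun h : (Σ e, 𝒯 e) => (h.2 : T)) '' {h ∈ s | h.1 = m}) := by
    intro m x hx
    refine Submodule.span_induction ?_ ?_ ?_ ?_ hx
    · rintro _ ⟨h, hh, rfl⟩
      by_cases hm : h.1 = m
      · rw [← hm, DirectSum.decompose_of_mem_same 𝒯 h.2.2]
        exact Submodule.subset_span ⟨h, ⟨hh, rfl⟩, rfl⟩
      · rw [DirectSum.decompose_of_mem_ne 𝒯 h.2.2 hm]; exact zero_mem _
    · simp
    · intro a b _ _ ha hb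
      rw [DirectSum.decompose_add, DirectSum.add_apply]; exact add_mem ha hb
    · intro r a _ ha
      rw [DirectSum.decompose_smul, DirectSum.smul_apply, Submodule.coe_smul, ← algebraMap_smul A r]
      exact Submodule.smul_mem _ _ ha
  -- degree m part of the spanning statement
  have hspan' : ∀ m, ∀ u ∈ 𝒯 m, ∃ a : R, a ≠ 0 ∧ ∃ z ∈ I, algebraMap R T a * u - DirectSum.decompose 𝒯 z m ∈
      Submodule.span A ((fun h : (Σ e, 𝒯 e) => (h.2 : T)) '' {h ∈ s | h.1 = m}) := by
    intro m u hu
    obtain ⟨a, ha, z, hz, h⟩ := hspan ⟨m, u, hu⟩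
    refine ⟨a, ha, z, hz, ?_⟩
    have h1 := hcomp m _ h
    rw [DirectSum.decompose_sub, DirectSum.sub_apply, Submodule.coe_sub] at h1
    have h2 : algebraMap R T a * u ∈ 𝒯 m := by
      rw [← Algebra.smul_def]; exact (𝒯 m).smul_mem a hu
    rwa [DirectSum.decompose_of_mem_same 𝒯 h2] at h1
  have hE : ∀ m, ∀ u ∈ 𝒯 m, u ∈ sat (Submodule.span A ((fun h : (Σ e, 𝒯 e) => (h.2 : T)) '' {h ∈ s | h.1 ≤ m})) := by
    intro m
    induction m using Nat.strong_induction_on with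
    | _ m ih =>
      intro u hu
      obtain ⟨a, ha, z, hz, h⟩ := hspan' m u hu
      apply sat_of_smul ha
      have h1 := mem_ofList_homog 𝒯 hys hz (A := A) (fun y hy => Algebra.subset_adjoin hy)
        (N := sat (Submodule.span A ((fun h : (Σ e, 𝒯 e) => (h.2 : T)) '' {h ∈ s | h.1 ≤ m})))
        (fun k hk g hg => sat_mono (Submodule.span_mono (Set.image_mono
          (fun (h : (Σ e, 𝒯 e)) (hh : h ∈ s ∧ h.1 ≤ k) => (⟨hh.1, hh.2.trans hk.le⟩ : h ∈ s ∧ h.1 ≤ m)))) (ih k hk g hg))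
      have h2 := le_sat _ (Submodule.span_mono (Set.image_mono
          (fun (h : (Σ e, 𝒯 e)) (hh : h ∈ s ∧ h.1 = m) => (⟨hh.1, hh.2.le⟩ : h ∈ s ∧ h.1 ≤ m))) h)
      have := add_mem h2 h1
      rwa [sub_add_cancel] at this
  have hdeg : ∀ h ∈ s, h.1 ≤ δ := by
    intro h hh
    by_contra! hc
    obtain ⟨a, haA, ha0, ha⟩ := hB h.1 hc h.2 h.2.2
    have h1 : a * h.2 ∈ sat (Submodule.span A ((fun h : (Σ e, 𝒯 e) => (h.2 : T)) '' {h ∈ s | h.1 ≤ δ})) := by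
      refine (Submodule.span_le (p := sat _)).2 ?_ ha
      rintro u ⟨m, hm, hu⟩
      exact sat_mono (Submodule.span_mono (Set.image_mono
          (fun (h : (Σ e, 𝒯 e)) (hh : h ∈ s ∧ h.1 ≤ m) => (⟨hh.1, hh.2.trans hm⟩ : h ∈ s ∧ h.1 ≤ δ)))) (hE m u hu)
    obtain ⟨c, hc0, hcm⟩ := h1
    have h3 : ∃ (F : Finset s) (b : s → T), (∀ j, b j ∈ A) ∧ ⟨h, hh⟩ ∉ F ∧
        algebraMap R T c * (a * h.2) = ∑ j ∈ F, b j * w j := by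
      rw [Finsupp.mem_span_image_iff_linearCombination] at hcm
      obtain ⟨l, hl, hl2⟩ := hcm
      refine ⟨(l.comapDomain (Subtype.val : s → _) Subtype.val_injective.injOn).support,
        fun j => (l j.1 : T), fun j => (l j.1).2, ?_, ?_⟩
      · intro hmem
        rw [Finsupp.mem_support_iff, Finsupp.comapDomain_apply, ← Finsupp.mem_support_iff] at hmem
        have := hl hmem
        exact absurd this.2 (not_le.2 hc)
      · rw [← hl2, Finsupp.linearCombination_apply, Finsupp.sum]
        symm
        refine Finset.sum_bij (fun j _ => j.1) ?_ ?_ ?_ ?_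
        · intro j hj; simpa using hj
        · intro j _ k _ h; exact Subtype.ext h
        · intro j hj
          exact ⟨⟨j, (hl hj).1⟩, by simpa using hj, rfl⟩
        · intro j hj; rfl
    obtain ⟨F, b, hb, hF, hsum⟩ := h3
    have h4 := hU (insert ⟨h, hh⟩ F) (fun j => if j = ⟨h, hh⟩ then algebraMap R T c * a else - b j) ?_ ?_
      ⟨h, hh⟩ (Finset.mem_insert_self _ _)
    · rw [if_pos rfl] at h4
      rcases mul_eq_zero.1 h4 with h5 | h5
      · exact hc0 (hRT (by rw [h5, map_zero]))
      · exact ha0 h5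
    · intro j
      split_ifs
      · exact A.mul_mem (A.algebraMap_mem c) haA
      · exact A.neg_mem (hb j)
    · rw [Finset.sum_insert hF, if_pos rfl, mul_assoc]
      rw [Finset.sum_congr rfl (g := fun j => - (b j * w j))]
      · rw [Finset.sum_neg_distrib, ← hsum]
        simp [w]
      · intro j hj
        have hne : j ≠ ⟨h, hh⟩ := fun hjj => hF (hjj ▸ hj)
        rw [if_neg hne, neg_mul]
  obtain ⟨a, ha, z, hz, h⟩ := hspan' e t ht
  have : {h ∈ s | h.1 = e} = ∅ := by
    ext h
    simp only [Set.mem_ofPred_eq, Set.mem_empty_iff_false, iff_false, not_and]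
    intro hh h2
    have := hdeg h hh
    omega
  rw [this, Set.image_empty, Submodule.span_empty, Submodule.mem_bot, sub_eq_zero] at h
  apply htf a ha
  rw [h]
  exact homog_ofList (fun y hy => (hys y hy).imp fun _ h => h.2) e hz

end Part4

end File4

section File5
open RingTheory.Sequence IsLocalRing Module Pointwise

section Part5
variable {K T : Type*} [Field K] [CommRing T] [Algebra K T] (𝒯 : ℕ → Submodule K T)

/-- degree-`e` dimension of the quotient -/
noncomputable def qdim (I : Ideal T) (e : ℕ) : ℤ :=
  (finrank K (𝒯 e) : ℤ) - finrank K ((𝒯 e ⊓ I.restrictScalars K : Submodule K T))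

/-- Hilbert series of the quotient -/
noncomputable def qser (I : Ideal T) : PowerSeries ℤ := PowerSeries.mk (qdim 𝒯 I)

variable [GradedAlgebra 𝒯] [∀ e, FiniteDimensional K (𝒯 e)]

lemma qdim_step_lt {I : Ideal T} (hI : I.IsHomogeneous 𝒯) {y : T} {d e : ℕ} (hy : y ∈ 𝒯 d)
    (he : e < d) : qdim 𝒯 (I ⊔ Ideal.span {y}) e = qdim 𝒯 I e := by
  have : (𝒯 e ⊓ (I ⊔ Ideal.span {y}).restrictScalars K : Submodule K T) =
      𝒯 e ⊓ I.restrictScalars K := by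
    apply le_antisymm
    · rintro t ⟨hte, ht⟩
      refine ⟨hte, ?_⟩
      obtain ⟨i, hi, z, hz, rfl⟩ := Submodule.mem_sup.1 ht
      obtain ⟨g, rfl⟩ := Ideal.mem_span_singleton'.1 hz
      have h1 := DirectSum.decompose_of_mem_same 𝒯 hte
      rw [DirectSum.decompose_add, DirectSum.add_apply, Submodule.coe_add,
        DirectSum.coe_decompose_mul_of_right_mem_of_not_le 𝒯 hy (by omega), add_zero] at h1
      rw [← h1]
      exact hI e hi
    · exact inf_le_inf_left _ (fun x hx => Ideal.mem_sup_left hx)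
  rw [qdim, qdim, this]

lemma qdim_step [IsDomain T] {I : Ideal T} (hI : I.IsHomogeneous 𝒯) {y : T} {d e : ℕ} (hy : y ∈ 𝒯 d) (hy0 : y ≠ 0)
    (hreg : ∀ g, y * g ∈ I → g ∈ I) :
    qdim 𝒯 (I ⊔ Ideal.span {y}) (e + d) = qdim 𝒯 I (e + d) - qdim 𝒯 I e := by
  let μ : T →ₗ[K] T := LinearMap.mulLeft K y
  have hμ : Function.Injective μ := fun a b h => mul_left_cancel₀ hy0 h
  have e1 : (𝒯 (e + d) ⊓ (I ⊔ Ideal.span {y}).restrictScalars K : Submodule K T) =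
      (𝒯 (e + d) ⊓ I.restrictScalars K) ⊔ (𝒯 e).map μ := by
    apply le_antisymm
    · rintro t ⟨hte, ht⟩
      obtain ⟨i, hi, z, hz, rfl⟩ := Submodule.mem_sup.1 ht
      obtain ⟨g, rfl⟩ := Ideal.mem_span_singleton'.1 hz
      have h1 := DirectSum.decompose_of_mem_same 𝒯 hte
      rw [DirectSum.decompose_add, DirectSum.add_apply, Submodule.coe_add,
        DirectSum.coe_decompose_mul_of_right_mem_of_le 𝒯 hy (by omega), Nat.add_sub_cancel] at h1
      rw [← h1]
      refine Submodule.add_mem_sup ⟨SetLike.coe_mem _, hI _ hi⟩ ⟨_, (DirectSum.decompose 𝒯 g e).2, ?_⟩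
      exact mul_comm _ _
    · refine sup_le (inf_le_inf_left _ (fun x hx => Ideal.mem_sup_left hx)) ?_
      rintro _ ⟨g, hg, rfl⟩
      refine ⟨?_, ?_⟩
      · change y * g ∈ _
        rw [add_comm]; exact SetLike.mul_mem_graded hy hg
      · exact Ideal.mem_sup_right (Ideal.mul_mem_right _ _ (Ideal.mem_span_singleton_self y))
  have e2 : (𝒯 (e + d) ⊓ I.restrictScalars K) ⊓ (𝒯 e).map μ = (𝒯 e ⊓ I.restrictScalars K).map μ := by
    apply le_antisymm
    · rintro _ ⟨⟨_, h2⟩, g, hg, rfl⟩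
      exact ⟨g, ⟨hg, hreg g h2⟩, rfl⟩
    · rintro _ ⟨g, ⟨hg, hgI⟩, rfl⟩
      refine ⟨⟨?_, ?_⟩, g, hg, rfl⟩
      · change y * g ∈ _
        rw [add_comm]; exact SetLike.mul_mem_graded hy hg
      · exact Ideal.mul_mem_left _ _ hgI
  have h := Submodule.finrank_sup_add_finrank_inf_eq (𝒯 (e + d) ⊓ I.restrictScalars K) ((𝒯 e).map μ)
  rw [← e1, e2, ← (Submodule.equivMapOfInjective μ hμ _).finrank_eq, ← (Submodule.equivMapOfInjective μ hμ _).finrank_eq] at h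
  simp only [qdim]
  zify at h
  linarith

lemma qser_step [IsDomain T] {I : Ideal T} (hI : I.IsHomogeneous 𝒯) {y : T} {d : ℕ} (hy : y ∈ 𝒯 d) (hy0 : y ≠ 0)
    (hreg : ∀ g, y * g ∈ I → g ∈ I) :
    qser 𝒯 (I ⊔ Ideal.span {y}) = qser 𝒯 I * (1 - PowerSeries.X ^ d) := by
  ext e
  rw [mul_sub, mul_one, map_sub, PowerSeries.coeff_mul_X_pow']
  simp only [qser, PowerSeries.coeff_mk]
  split_ifs with h
  · obtain ⟨k, rfl⟩ := Nat.exists_eq_add_of_le' h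
    rw [qdim_step 𝒯 hI hy hy0 hreg, Nat.add_sub_cancel]
  · rw [qdim_step_lt 𝒯 hI hy (by omega), sub_zero]

lemma qser_list [IsDomain T] {ys : List T} (hreg : GReg ys) (d : T → ℕ) (hd : ∀ y ∈ ys, y ∈ 𝒯 (d y))
    (h0 : ∀ y ∈ ys, y ≠ 0) :
    qser 𝒯 (Ideal.ofList ys) = qser 𝒯 ⊥ * (ys.map fun y => 1 - PowerSeries.X ^ (d y)).prod := by
  have key : ∀ l₁ l₂ : List T, ys = l₁ ++ l₂ → qser 𝒯 (Ideal.ofList l₁) =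
      qser 𝒯 ⊥ * (l₁.map fun y => 1 - PowerSeries.X ^ (d y)).prod := by
    intro l₁
    induction l₁ using List.reverseRecOn with
    | nil => intro l₂ _; simp
    | append_singleton l₁ y ih =>
      intro l₂ hl
      rw [List.append_assoc, List.singleton_append] at hl
      have hy : y ∈ ys := by simp [hl]
      rw [Ideal.ofList_append, Ideal.ofList_singleton, qser_step 𝒯 _ (hd y hy) (h0 y hy) (hreg l₁ y l₂ hl), ih _ hl]
      · simp [mul_assoc]
      · exact homog_ofList fun z hz => ⟨_, hd z (by simp [hl, hz])⟩
  exact key ys [] (by simp)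

lemma one_sub_X_pow (d : ℕ) : (1 - PowerSeries.X ^ d : PowerSeries ℤ) =
    ((∑ k ∈ Finset.range d, Polynomial.X ^ k : Polynomial ℤ) : PowerSeries ℤ) * (1 - PowerSeries.X) := by
  have := geom_sum_mul_neg (Polynomial.X : Polynomial ℤ) d
  have := congrArg (fun p : Polynomial ℤ => (p : PowerSeries ℤ)) this
  simp only [Polynomial.coe_mul, Polynomial.coe_sub, Polynomial.coe_one, Polynomial.coe_pow, Polynomial.coe_X] at this
  exact this.symm

/-- Macaulay bound. -/
theorem macaulay [IsDomain T] {xs ys : List T} (hlen : xs.length = ys.length)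
    (hx : GReg xs) (hx1 : ∀ x ∈ xs, x ∈ 𝒯 1) (hx0 : ∀ x ∈ xs, x ≠ 0)
    (hone : qser 𝒯 (Ideal.ofList xs) = 1)
    (hreg : GReg ys) (d : T → ℕ) (hd : ∀ y ∈ ys, y ∈ 𝒯 (d y)) (h0 : ∀ y ∈ ys, y ≠ 0)
    (e : ℕ) (he : (ys.map fun y => d y - 1).sum < e) (t : T) (ht : t ∈ 𝒯 e) : t ∈ Ideal.ofList ys := by
  have h1 := qser_list 𝒯 hx (fun _ => 1) hx1 hx0
  have h2 := qser_list 𝒯 hreg d hd h0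
  simp only [pow_one, List.map_const', List.prod_replicate] at h1
  have h3 : (ys.map fun y => (1 - PowerSeries.X ^ (d y) : PowerSeries ℤ)).prod =
      (((ys.map fun y => (∑ k ∈ Finset.range (d y), Polynomial.X ^ k : Polynomial ℤ)).prod : Polynomial ℤ) : PowerSeries ℤ) *
        (1 - PowerSeries.X) ^ ys.length := by
    clear hlen hreg hd h0 he h2
    induction ys with
    | nil => simp
    | cons y ys ih =>
      rw [List.map_cons, List.prod_cons, ih, one_sub_X_pow, List.map_cons, List.prod_cons, Polynomial.coe_mul,
        List.length_cons, pow_succ]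
      ring
  rw [h3, mul_left_comm, ← hlen, ← h1, hone, mul_one] at h2
  have h4 : ((ys.map fun y => (∑ k ∈ Finset.range (d y), Polynomial.X ^ k : Polynomial ℤ)).prod).natDegree ≤
      (ys.map fun y => d y - 1).sum := by
    clear hlen hreg hd h0 he h2 h3
    induction ys with
    | nil => simp
    | cons y ys ih =>
      rw [List.map_cons, List.prod_cons, List.map_cons, List.sum_cons]
      refine Polynomial.natDegree_mul_le.trans (add_le_add ?_ ih)
      refine Polynomial.natDegree_sum_le_of_forall_le _ _ fun k hk => ?_
      rw [Polynomial.natDegree_X_pow]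
      have := Finset.mem_range.1 hk
      omega
  have h5 := congrArg (PowerSeries.coeff e) h2
  rw [Polynomial.coeff_coe, Polynomial.coeff_eq_zero_of_natDegree_lt (h4.trans_lt he), qser,
    PowerSeries.coeff_mk, qdim, sub_eq_zero] at h5
  have h6 : (𝒯 e ⊓ (Ideal.ofList ys).restrictScalars K : Submodule K T) = 𝒯 e :=
    Submodule.eq_of_le_of_finrank_eq inf_le_left (by exact_mod_cast h5.symm)
  rw [← h6] at ht
  exact ht.2
end Part5

end File5

section File6
open RingTheory.Sequence IsLocalRing Module Pointwise

section Part6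
open MvPolynomial

lemma GReg.isWeaklyRegular {T : Type*} [CommRing T] {ys : List T} (h : GReg ys) :
    IsWeaklyRegular T ys := by
  constructor
  intro i hi
  rw [isSMulRegular_iff_right_eq_zero_of_smul]
  intro x hx
  obtain ⟨g, rfl⟩ := Submodule.Quotient.mk_surjective _ x
  rw [← Submodule.Quotient.mk_smul, Submodule.Quotient.mk_eq_zero] at hx
  rw [Submodule.Quotient.mk_eq_zero]
  have e : (Ideal.ofList (ys.take i) • ⊤ : Submodule T T) = Ideal.ofList (ys.take i) := by
    rw [smul_eq_mul, Ideal.mul_top]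
  rw [e] at hx ⊢
  refine h (ys.take i) ys[i] (ys.drop (i+1)) ?_ g (by simpa using hx)
  rw [List.getElem_cons_drop, List.take_append_drop]

variable {K : Type*} [Field K] {n : ℕ}

lemma ofList_vars_eq (i : ℕ) (hi : i ≤ n) (l : List (MvPolynomial (Fin n) K))
    (hl : ∀ g, g ∈ l ↔ ∃ j : Fin n, j.1 < i ∧ X j = g) :
    Ideal.ofList l = RingHom.ker (zeroOut K n i) := by
  apply le_antisymm
  · rw [Ideal.ofList, Ideal.span_le]
    intro g hg
    obtain ⟨j, hj, rfl⟩ := (hl g).1 hg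
    simp [zeroOut, hj]
  · intro g hg
    have h1 : ((Ideal.Quotient.mkₐ K (Ideal.ofList l)).comp (zeroOut K n i)) =
        Ideal.Quotient.mkₐ K (Ideal.ofList l) := by
      apply MvPolynomial.algHom_ext
      intro j
      simp only [zeroOut, AlgHom.comp_apply, aeval_X]
      split_ifs with h
      · rw [map_zero, eq_comm, Ideal.Quotient.mkₐ_eq_mk, Ideal.Quotient.eq_zero_iff_mem]
        exact Ideal.subset_span ((hl _).2 ⟨j, h, rfl⟩)
      · rfl
    have h2 := DFunLike.congr_fun h1 g
    rw [AlgHom.comp_apply, (RingHom.mem_ker).1 hg, map_zero, eq_comm, Ideal.Quotient.mkₐ_eq_mk,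
      Ideal.Quotient.eq_zero_iff_mem] at h2
    exact h2

/-- the list of variables -/
noncomputable def vars' (K : Type*) [Field K] (n : ℕ) : List (MvPolynomial (Fin n) K) := List.ofFn X

lemma greg_vars : GReg (vars' K n) := by
  intro l₁ y l₂ h g hg
  have hlen := congrArg List.length h
  simp only [vars', List.length_ofFn, List.length_append, List.length_cons] at hlen
  have hi : l₁.length < n := by omega
  have h1 : ∀ g, g ∈ l₁ ↔ ∃ j : Fin n, j.1 < l₁.length ∧ X j = g := by
    intro g
    have : l₁ = (vars' K n).take l₁.length := by rw [h, List.take_left]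
    rw [this, List.mem_iff_getElem]
    constructor
    · rintro ⟨k, hk, rfl⟩
      rw [List.length_take] at hk
      refine ⟨⟨k, by omega⟩, by rw [← this]; simp; omega, ?_⟩
      simp [vars']
    · rintro ⟨j, hj, rfl⟩
      rw [← this] at hj
      refine ⟨j.1, by rw [← this]; exact hj, ?_⟩
      simp [vars']
  have h2 : y = X ⟨l₁.length, hi⟩ := by
    have : (vars' K n)[l₁.length]? = some y := by rw [h]; simp
    rw [vars', List.getElem?_ofFn] at this
    simp [hi] at this
    exact this.symm
  rw [ofList_vars_eq _ hi.le l₁ h1] at hg ⊢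
  rw [RingHom.mem_ker, map_mul, mul_eq_zero] at hg
  rcases hg with hg | hg
  · simp [h2, zeroOut] at hg
  · exact hg

lemma ofList_vars : Ideal.ofList (vars' K n) = RingHom.ker (constantCoeff (R := K) (σ := Fin n)) := by
  rw [ofList_vars_eq n le_rfl]
  · ext g
    rw [RingHom.mem_ker, RingHom.mem_ker, zeroOut_n, map_eq_zero_iff _ (C_injective _ _)]
  · intro g
    simp [vars', List.mem_ofFn]

noncomputable instance grId {R : Type*} [CommRing R] {n : ℕ} : GradedAlgebra (grT R n (MvPolynomial (Fin n) R)) :=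
  grT_gradedAlgebra (fun _ _ h => h) (fun t e => ⟨homogeneousComponent e t, rfl⟩)

lemma grT_id (e : ℕ) : grT K n (MvPolynomial (Fin n) K) e = homogeneousSubmodule (Fin n) K e := by
  ext g
  rw [mem_grT]; rfl

instance (e : ℕ) : FiniteDimensional K (grT K n (MvPolynomial (Fin n) K) e) := by
  rw [grT_id]
  exact Module.Finite.iff_fg.2 (homogeneousSubmodule_fg _ _ _)

lemma qser_vars : qser (grT K n (MvPolynomial (Fin n) K)) (Ideal.ofList (vars' K n)) = 1 := by
  ext e
  rw [qser, PowerSeries.coeff_mk, PowerSeries.coeff_one, qdim, grT_id]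
  split_ifs with h
  · subst h
    have h1 : (homogeneousSubmodule (Fin n) K 0 ⊓ (Ideal.ofList (vars' K n)).restrictScalars K :
        Submodule K (MvPolynomial (Fin n) K)) = ⊥ := by
      rw [eq_bot_iff]
      rintro g ⟨h1, h2⟩
      have h3 : constantCoeff g = 0 := by
        have : g ∈ Ideal.ofList (vars' K n) := h2
        rwa [ofList_vars] at this
      have := (totalDegree_zero_iff_isHomogeneous _).2 h1
      rw [totalDegree_eq_zero_iff_eq_C] at this
      rw [this, ← constantCoeff_eq, h3, C_0]
      exact zero_mem _
    rw [h1, homogeneousSubmodule_zero, Submodule.one_eq_span, finrank_span_singleton one_ne_zero]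
    simp
  · have h1 : (homogeneousSubmodule (Fin n) K e ⊓ (Ideal.ofList (vars' K n)).restrictScalars K :
        Submodule K (MvPolynomial (Fin n) K)) = homogeneousSubmodule (Fin n) K e := by
      rw [inf_eq_left]
      intro g hg
      change g ∈ Ideal.ofList (vars' K n)
      rw [ofList_vars, RingHom.mem_ker, constantCoeff_eq]
      exact IsHomogeneous.coeff_eq_zero hg (by simpa using fun h' => h h'.symm)
    rw [h1, sub_self]

lemma cmat_field (p : Ideal K) [p.IsMaximal] : CMat (bigP (n := n) (MvPolynomial (Fin n) K) p) := by
  have hp : p = ⊥ := by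
    rcases Ideal.eq_bot_or_top p with h | h
    · exact h
    · exact absurd h (Ideal.IsMaximal.ne_top inferInstance)
  refine ⟨n, ⟨(vars' K n).map (algebraMap _ _), by simp [vars'], ?_, ?_⟩, ?_⟩
  · intro r hr
    obtain ⟨g, hg, rfl⟩ := List.mem_map.1 hr
    rw [IsLocalization.AtPrime.to_map_mem_maximal_iff _ (bigP (n := n) (MvPolynomial (Fin n) K) p)]
    have : g ∈ Ideal.ofList (vars' K n) := Ideal.subset_span hg
    rw [ofList_vars] at this
    subst hp
    exact this
  · exact IsWeaklyRegular.of_isLocalization _ (bigP (n := n) (MvPolynomial (Fin n) K) p).primeCompl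
      greg_vars.isWeaklyRegular
  · rw [IsLocalization.AtPrime.ringKrullDim_eq_height (bigP (n := n) (MvPolynomial (Fin n) K) p)]
    refine (Ideal.height_le_ringKrullDim_of_ne_top (Ideal.IsPrime.ne_top inferInstance)).trans ?_
    rw [MvPolynomial.ringKrullDim_of_isNoetherianRing]
    simp

theorem macaulay_poly (F : Fin n → MvPolynomial (Fin n) K) (d : Fin n → ℕ)
    (hF : ∀ i, (F i).IsHomogeneous (d i)) (hd : ∀ i, 0 < d i) (h0 : ∀ i, F i ≠ 0)
    (hint : Algebra.IsIntegral K (MvPolynomial (Fin n) K ⧸ Ideal.span (Set.range F)))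
    (e : ℕ) (he : ∑ i, (d i - 1) < e) (t : MvPolynomial (Fin n) K) (ht : t.IsHomogeneous e) :
    t ∈ Ideal.span (Set.range F) := by
  have hs : Ideal.span (Set.range F) = Ideal.ofList (List.ofFn F) := by
    rw [Ideal.ofList]; congr 1; ext g; simp [List.mem_ofFn]
  rw [hs] at hint ⊢
  have hreg := greg_of_CM (T := MvPolynomial (Fin n) K) (fun _ _ h => h) (fun p _ => cmat_field p)
    (List.ofFn F) (by simp) (fun y hy => by
      obtain ⟨i, rfl⟩ := (List.mem_ofFn).1 hy
      exact ⟨d i, hd i, hF i⟩) hint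
  refine macaulay (grT K n (MvPolynomial (Fin n) K)) (xs := vars' K n) (by simp [vars']) greg_vars ?_ ?_
    qser_vars hreg.1 totalDegree ?_ ?_ e ?_ t ht
  · intro x hx
    obtain ⟨i, rfl⟩ := (List.mem_ofFn).1 hx
    exact isHomogeneous_X _ _
  · intro x hx
    obtain ⟨i, rfl⟩ := (List.mem_ofFn).1 hx
    exact X_ne_zero _
  · intro x hx
    obtain ⟨i, rfl⟩ := (List.mem_ofFn).1 hx
    rw [(hF i).totalDegree (h0 i)]
    exact hF i
  · intro x hx
    obtain ⟨i, rfl⟩ := (List.mem_ofFn).1 hx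
    exact h0 i
  · rw [List.map_ofFn, List.sum_ofFn]
    simpa [(hF _).totalDegree (h0 _)] using he
end Part6

end File6

section File7
open RingTheory.Sequence IsLocalRing Module Pointwise

section Part7
open MvPolynomial

lemma integral_quot {R X : Type*} [CommRing R] [CommRing X] [Algebra R X] (s : Set X)
    (h : ∀ x : X, IsIntegral (Algebra.adjoin R s) x) (J : Ideal X) (hs : s ⊆ J) :
    Algebra.IsIntegral R (X ⧸ J) := by
  constructor
  intro x
  obtain ⟨x, rfl⟩ := Ideal.Quotient.mk_surjective x
  obtain ⟨p, hp, hx⟩ := h x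
  have hA : Algebra.adjoin R s ≤ (⊥ : Subalgebra R (X ⧸ J)).comap (Ideal.Quotient.mkₐ R J) := by
    apply Algebra.adjoin_le
    intro a ha
    change Ideal.Quotient.mk J a ∈ (⊥ : Subalgebra R (X ⧸ J))
    rw [Ideal.Quotient.eq_zero_iff_mem.2 (hs ha)]
    exact zero_mem _
  let φ : Algebra.adjoin R s →+* X ⧸ J := (Ideal.Quotient.mk J).comp (algebraMap (Algebra.adjoin R s) X)
  have hl : p.map φ ∈ Polynomial.lifts (algebraMap R (X ⧸ J)) := by
    rw [Polynomial.lifts_iff_coeff_lifts]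
    intro k
    rw [Polynomial.coeff_map]
    exact Algebra.mem_bot.1 (hA (p.coeff k).2)
  rcases subsingleton_or_nontrivial (X ⧸ J) with h0 | h0
  · exact ⟨1, Polynomial.monic_one, Subsingleton.elim _ _⟩
  obtain ⟨q, hq, -, hqm⟩ := Polynomial.lifts_and_natDegree_eq_and_monic hl (hp.map φ)
  refine ⟨q, hqm, ?_⟩
  rw [← Polynomial.eval_map, hq, Polynomial.eval_map]
  rw [← Polynomial.hom_eval₂, hx, map_zero]

variable {R : Type*} [CommRing R] [IsDomain R] {n : ℕ}

theorem macaulay_domain (f : Fin n → MvPolynomial (Fin n) R) (d : Fin n → ℕ)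
    (hf : ∀ i, (f i).IsHomogeneous (d i)) (hd : ∀ i, 0 < d i) (h0 : ∀ i, f i ≠ 0)
    (hint : Algebra.IsIntegral R (MvPolynomial (Fin n) R ⧸ Ideal.span (Set.range f)))
    (e : ℕ) (he : ∑ i, (d i - 1) < e) (t : MvPolynomial (Fin n) R) (ht : t.IsHomogeneous e) :
    ∃ c : R, c ≠ 0 ∧ C c * t ∈ Ideal.span (Set.range f) := by
  let K := FractionRing R
  let φ : MvPolynomial (Fin n) R →+* MvPolynomial (Fin n) K := MvPolynomial.map (algebraMap R K)
  have hinj : Function.Injective φ := map_injective _ (IsFractionRing.injective R K)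
  have hI : Ideal.span (Set.range fun i => φ (f i)) = (Ideal.span (Set.range f)).map φ := by
    rw [Ideal.map_span, ← Set.range_comp]; rfl
  have hint' : Algebra.IsIntegral K (MvPolynomial (Fin n) K ⧸ Ideal.span (Set.range fun i => φ (f i))) := by
    constructor
    intro x
    obtain ⟨x, rfl⟩ := Ideal.Quotient.mk_surjective x
    induction x using MvPolynomial.induction_on with
    | C a => exact isIntegral_algebraMap (x := a)
    | add p q hp hq => rw [map_add]; exact IsIntegral.add (A := MvPolynomial (Fin n) K ⧸ Ideal.span (Set.range fun i => φ (f i))) hp hq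
    | mul_X p i hp =>
      rw [map_mul]
      refine IsIntegral.mul (A := MvPolynomial (Fin n) K ⧸ Ideal.span (Set.range fun i => φ (f i))) hp ?_
      obtain ⟨p, hp, hx⟩ := hint.isIntegral (Ideal.Quotient.mk _ (X i))
      refine ⟨p.map (algebraMap R K), hp.map _, ?_⟩
      let ψ := Ideal.quotientMap (Ideal.span (Set.range fun i => φ (f i))) φ
        (hI ▸ Ideal.le_comap_map : Ideal.span (Set.range f) ≤ _)
      have := congrArg ψ hx
      rw [Polynomial.hom_eval₂, map_zero] at this
      rw [Polynomial.eval₂_map]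
      convert this using 2
      · ext r
        change Ideal.Quotient.mk _ (C (algebraMap R K r)) = ψ (Ideal.Quotient.mk _ (C r))
        rw [Ideal.quotientMap_mk]
        congr 1
        exact (map_C _ _).symm
      · rw [Ideal.quotientMap_mk]
        congr 1
        exact (map_X _ _).symm
  have h1 := macaulay_poly (fun i => φ (f i)) d (fun i => (hf i).map _) hd
    (fun i h => h0 i ((map_eq_zero_iff φ hinj).1 h)) hint' e he (φ t) (ht.map _)
  rw [hI] at h1
  letI : Algebra (MvPolynomial (Fin n) R) (MvPolynomial (Fin n) K) := algebraMvPolynomial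
  haveI := MvPolynomial.isLocalization (σ := Fin n) (nonZeroDivisors R) K
  have h2 := (IsLocalization.algebraMap_mem_map_algebraMap_iff
    ((nonZeroDivisors R).map C) (MvPolynomial (Fin n) K) (Ideal.span (Set.range f)) t).1 h1
  obtain ⟨m, hm, h⟩ := h2
  obtain ⟨c, hc, rfl⟩ := hm
  exact ⟨c, nonZeroDivisors.ne_zero hc, h⟩

theorem sat_all (f : Fin n → MvPolynomial (Fin n) R) (d : Fin n → ℕ)
    (hf : ∀ i, (f i).IsHomogeneous (d i)) (hd : ∀ i, 0 < d i) (h0 : ∀ i, f i ≠ 0)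
    (hint : Algebra.IsIntegral R (MvPolynomial (Fin n) R ⧸ Ideal.span (Set.range f)))
    (s : MvPolynomial (Fin n) R) :
    ∃ c : R, c ≠ 0 ∧ C c * s ∈ Submodule.span (Algebra.adjoin R (Set.range f))
      {u : MvPolynomial (Fin n) R | ∃ m ≤ ∑ i, (d i - 1), u.IsHomogeneous m} := by
  set N := Submodule.span (Algebra.adjoin R (Set.range f))
      {u : MvPolynomial (Fin n) R | ∃ m ≤ ∑ i, (d i - 1), u.IsHomogeneous m}
  suffices h : s ∈ sat N from h
  have key : ∀ e, ∀ u : MvPolynomial (Fin n) R, u.IsHomogeneous e → u ∈ sat N := by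
    intro e
    induction e using Nat.strong_induction_on with
    | _ e ih =>
      intro u hu
      by_cases he : e ≤ ∑ i, (d i - 1)
      · exact le_sat _ (Submodule.subset_span ⟨e, he, hu⟩)
      · obtain ⟨c, hc, h⟩ := macaulay_domain f d hf hd h0 hint e (by omega) u hu
        have hs : Ideal.span (Set.range f) = Ideal.ofList (List.ofFn f) := by
          rw [Ideal.ofList]; congr 1; ext g; simp [List.mem_ofFn]
        rw [hs] at h
        apply sat_of_smul hc
        have h3 := mem_ofList_homog (grT R n (MvPolynomial (Fin n) R)) (ys := List.ofFn f) (m := e)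
          (fun y hy => by
            obtain ⟨i, rfl⟩ := (List.mem_ofFn).1 hy
            exact ⟨d i, hd i, hf i⟩) h
          (A := Algebra.adjoin R (Set.range f)) (fun y hy => by
            obtain ⟨i, rfl⟩ := (List.mem_ofFn).1 hy
            exact Algebra.subset_adjoin ⟨i, rfl⟩) (N := sat N) (fun k hk g hg => ih k hk g hg)
        have h4 : C c * u ∈ grT R n (MvPolynomial (Fin n) R) e := by
          rw [mem_grT]; exact (hu.C_mul c)
        rwa [DirectSum.decompose_of_mem_same _ h4] at h3
  rw [← sum_homogeneousComponent s]
  exact sum_mem fun i _ => key i _ (homogeneousComponent_isHomogeneous _ _)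
end Part7

end File7

section Part8
open RingTheory.Sequence IsLocalRing Module Pointwise

lemma integral_sub {R S : Type*} [CommRing R] [CommRing S] [Algebra R S] (T : Subalgebra R S)
    (s : Set T) (t : T) (h : IsIntegral (Algebra.adjoin R (T.val '' s)) (t : S)) :
    IsIntegral (Algebra.adjoin R s) t := by
  rw [← AlgHom.map_adjoin] at h
  obtain ⟨p, hp, hx⟩ := h
  let φ := (Subalgebra.equivMapOfInjective (Algebra.adjoin R s) T.val Subtype.val_injective)
  refine ⟨p.map (φ.symm : _ →+* _), hp.map _, ?_⟩
  apply Subtype.val_injective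
  change T.val _ = T.val 0
  rw [Polynomial.eval₂_map, map_zero, ← AlgHom.coe_toRingHom, Polynomial.hom_eval₂]
  refine Eq.trans (Polynomial.eval₂_congr ?_ rfl rfl) hx
  refine RingHom.ext fun a => ?_
  obtain ⟨a, rfl⟩ := φ.surjective a
  simp [φ]
  rfl

variable {R : Type*} [CommRing R] {n : ℕ}

lemma glAct_X (σ : Matrix.GeneralLinearGroup (Fin n) R) (i : Fin n) :
    glAct σ (X i) = ∑ j, ((σ⁻¹ : Matrix.GeneralLinearGroup (Fin n) R) : Matrix (Fin n) (Fin n) R) i j •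
      (X j : MvPolynomial (Fin n) R) := by
  simp [glAct]

lemma glAct_glAct (σ τ : Matrix.GeneralLinearGroup (Fin n) R) (s : MvPolynomial (Fin n) R) :
    glAct σ (glAct τ s) = glAct (σ * τ) s := by
  suffices h : (glAct σ).comp (glAct τ) = glAct (σ * τ) from DFunLike.congr_fun h s
  apply MvPolynomial.algHom_ext
  intro i
  rw [AlgHom.comp_apply, glAct_X, glAct_X, map_sum]
  simp only [map_smul, glAct_X, mul_inv_rev, Units.val_mul, Matrix.mul_apply, Finset.smul_sum,
    Finset.sum_smul, smul_smul]
  rw [Finset.sum_comm]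

lemma glAct_one (s : MvPolynomial (Fin n) R) : glAct 1 s = s := by
  suffices h : glAct 1 = AlgHom.id R (MvPolynomial (Fin n) R) from DFunLike.congr_fun h s
  apply MvPolynomial.algHom_ext
  intro i
  rw [glAct_X]
  simp [Matrix.one_apply]

lemma glAct_homog (σ : Matrix.GeneralLinearGroup (Fin n) R) {s : MvPolynomial (Fin n) R} {e : ℕ}
    (hs : s.IsHomogeneous e) : (glAct σ s).IsHomogeneous e := by
  have := hs.aeval (fun i => ∑ j, ((σ⁻¹ : Matrix.GeneralLinearGroup (Fin n) R) : Matrix (Fin n) (Fin n) R) i j •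
      (X j : MvPolynomial (Fin n) R)) (n := 1) (fun i => by
        apply IsHomogeneous.sum
        intro j _
        rw [smul_eq_C_mul]
        exact (isHomogeneous_X _ _).C_mul _)
  rwa [one_mul] at this

lemma glAct_comp (σ : Matrix.GeneralLinearGroup (Fin n) R) (s : MvPolynomial (Fin n) R) (e : ℕ) :
    homogeneousComponent e (glAct σ s) = glAct σ (homogeneousComponent e s) := by
  conv_lhs => rw [← sum_homogeneousComponent s, map_sum, map_sum]
  have : ∀ k, homogeneousComponent e (glAct σ (homogeneousComponent k s)) =
      if k = e then glAct σ (homogeneousComponent e s) else 0 := by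
    intro k
    rw [homogeneousComponent_of_mem (glAct_homog σ (homogeneousComponent_isHomogeneous k s))]
    split_ifs with h1 h2 h2
    · rw [h1]
    · exact absurd h1.symm h2
    · exact absurd h2.symm h1
    · rfl
  simp only [this, Finset.sum_ite_eq', Finset.mem_range]
  split_ifs with h
  · rfl
  · rw [homogeneousComponent_eq_zero _ _ (by omega), map_zero]

lemma glAct_inj [Nontrivial R] {σ τ : Matrix.GeneralLinearGroup (Fin n) R}
    (h : ∀ s : MvPolynomial (Fin n) R, glAct σ s = glAct τ s) : σ = τ := by
  apply inv_injective
  ext i j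
  have := congrArg (coeff (Finsupp.single j 1)) (h (X i))
  rw [glAct_X, glAct_X] at this
  simpa [coeff_sum, coeff_smul, coeff_X, Finsupp.single_left_inj] using this

variable {G : Subgroup (Matrix.GeneralLinearGroup (Fin n) R)}

lemma mem_inv {s : MvPolynomial (Fin n) R} : s ∈ invariants G ↔ ∀ σ ∈ G, glAct σ s = s := by
  simp [invariants, Algebra.mem_iInf, AlgHom.mem_equalizer]

/-- the action as a semiring action -/
@[reducible] noncomputable def glMSA (G : Subgroup (Matrix.GeneralLinearGroup (Fin n) R)) :
    MulSemiringAction G (MvPolynomial (Fin n) R) where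
  smul σ s := glAct σ.1 s
  one_smul s := glAct_one s
  mul_smul σ τ s := (glAct_glAct σ.1 τ.1 s).symm
  smul_zero σ := map_zero _
  smul_add σ := map_add _
  smul_one σ := map_one _
  smul_mul σ := map_mul _

lemma exists_trace [IsDomain R] [Finite G] : ∃ Tr : MvPolynomial (Fin n) R →+ MvPolynomial (Fin n) R,
    (∀ s, Tr s ∈ invariants G) ∧ (∀ t ∈ invariants G, ∀ s, Tr (t * s) = t * Tr s) ∧
    (∀ s e, s.IsHomogeneous e → (Tr s).IsHomogeneous e) ∧ ∃ s, Tr s ≠ 0 := by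
  have := Fintype.ofFinite G
  refine ⟨∑ σ : G, (glAct σ.1 : MvPolynomial (Fin n) R →+ MvPolynomial (Fin n) R), ?_, ?_, ?_, ?_⟩
  · intro s
    rw [mem_inv]
    intro τ hτ
    simp only [AddMonoidHom.finsetSum_apply, AddMonoidHom.coe_coe, map_sum, glAct_glAct]
    exact Equiv.sum_comp (Equiv.mulLeft (⟨τ, hτ⟩ : G)) (fun σ => glAct σ.1 s)
  · intro t ht s
    simp only [AddMonoidHom.finsetSum_apply, AddMonoidHom.coe_coe, map_mul]
    rw [Finset.mul_sum]
    exact Finset.sum_congr rfl fun σ _ => by rw [mem_inv.1 ht σ.1 σ.2]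
  · intro s e hs
    simp only [AddMonoidHom.finsetSum_apply, AddMonoidHom.coe_coe]
    exact IsHomogeneous.sum _ _ _ fun σ _ => glAct_homog _ hs
  · by_contra! h
    let ι : G → (MvPolynomial (Fin n) R →* MvPolynomial (Fin n) R) := fun σ => (glAct σ.1 : _ →* _)
    have hι : Function.Injective ι := by
      intro σ τ hst
      exact Subtype.ext (glAct_inj fun s => DFunLike.congr_fun hst s)
    have hl := (linearIndependent_monoidHom (MvPolynomial (Fin n) R) (MvPolynomial (Fin n) R)).comp ι hι
    rw [Fintype.linearIndependent_iff] at hl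
    refine one_ne_zero (hl (fun _ => 1) ?_ 1)
    ext1 s
    have := h s
    simp only [AddMonoidHom.finsetSum_apply, AddMonoidHom.coe_coe] at this
    simpa [ι] using this

end Part8

section Part9
open RingTheory.Sequence IsLocalRing Module Pointwise

variable {R : Type*} [CommRing R] {n : ℕ} {G : Subgroup (Matrix.GeneralLinearGroup (Fin n) R)}

lemma inv_integral [Finite G] : Algebra.IsIntegral (invariants G) (MvPolynomial (Fin n) R) := by
  let _ := glMSA G
  have : Algebra.IsInvariant (invariants G) (MvPolynomial (Fin n) R) G :=
    ⟨fun b hb => ⟨⟨b, mem_inv.2 fun σ hσ => hb ⟨σ, hσ⟩⟩, rfl⟩⟩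
  exact Algebra.IsInvariant.isIntegral (invariants G) (MvPolynomial (Fin n) R) G

lemma all_integral [Finite G] {f : Fin n → MvPolynomial (Fin n) R} (hsop : IsHSOPInv G f)
    (x : MvPolynomial (Fin n) R) : IsIntegral (Algebra.adjoin R (Set.range f)) x := by
  obtain ⟨hf, -, -, s, hs, hspan⟩ := hsop
  have hA : Algebra.adjoin R (Set.range f) ≤ invariants G := by
    apply Algebra.adjoin_le
    rintro _ ⟨i, rfl⟩
    exact hf i
  let TA : Subalgebra (Algebra.adjoin R (Set.range f)) (MvPolynomial (Fin n) R) :=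
    { (invariants G) with algebraMap_mem' := fun a => hA a.2 }
  have hfg : TA.toSubmodule.FG := by
    refine ⟨s, le_antisymm ?_ hspan⟩
    rw [Submodule.span_le]
    exact hs
  have hTA : Algebra.IsIntegral (Algebra.adjoin R (Set.range f)) TA := by
    have : Module.Finite (Algebra.adjoin R (Set.range f)) TA := Module.Finite.iff_fg.2 hfg
    exact Algebra.IsIntegral.of_finite _ _
  let _ := glMSA G
  have : Algebra.IsInvariant TA (MvPolynomial (Fin n) R) G :=
    ⟨fun b hb => ⟨⟨b, mem_inv.2 fun σ hσ => hb ⟨σ, hσ⟩⟩, rfl⟩⟩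
  have := Algebra.IsInvariant.isIntegral TA (MvPolynomial (Fin n) R) G
  exact isIntegral_trans (A := TA) x (this.isIntegral x)

lemma inv_noeth [IsNoetherianRing R] {f : Fin n → MvPolynomial (Fin n) R} (hsop : IsHSOPInv G f) :
    IsNoetherianRing (invariants G) := by
  obtain ⟨hf, -, -, s, hs, hspan⟩ := hsop
  have h1 : Algebra.adjoin R (Set.range f ∪ s) = invariants G := by
    apply le_antisymm
    · apply Algebra.adjoin_le
      rintro x (⟨i, rfl⟩ | hx)
      · exact hf i
      · exact hs hx
    · intro t ht
      refine Submodule.span_induction (p := fun t _ => t ∈ Algebra.adjoin R (Set.range f ∪ s)) ?_ ?_ ?_ ?_ (hspan ht)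
      · intro x hx; exact Algebra.subset_adjoin (Or.inr hx)
      · exact zero_mem _
      · intro a b _ _ ha hb; exact add_mem ha hb
      · intro a b _ hb
        exact mul_mem (Algebra.adjoin_mono Set.subset_union_left a.2) hb
  have h2 : (invariants G).FG := by
    rw [← h1]
    exact Subalgebra.fg_def.2 ⟨_, (Set.finite_range f).union s.finite_toSet, rfl⟩
  have := (Subalgebra.fg_iff_finiteType _).1 h2
  exact Algebra.FiniteType.isNoetherianRing R _

theorem main_aux [IsDomain R] [IsNoetherianRing R] [Finite G]
    (f : Fin n → MvPolynomial (Fin n) R) (d : Fin n → ℕ)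
    (hd : ∀ i, (f i).IsHomogeneous (d i)) (hsop : IsHSOPInv G f)
    (hCM : IsCohenMacaulayRing ↥(invariants G)) :
    genByDeg R G (max (Finset.univ.sup d) (∑ i, (d i - 1))) := by
  have hf := hsop.1
  have h0 : ∀ i, f i ≠ 0 := fun i => hsop.2.2.1.ne_zero i
  have hdpos : ∀ i, 0 < d i := by
    intro i
    obtain ⟨e, he, h⟩ := hsop.2.1 i
    rwa [(hd i).inj_right h (h0 i)]
  have hAint := all_integral hsop
  have hTint := inv_integral (G := G)
  have hnoeth := inv_noeth hsop
  set T := invariants G with hT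
  set δ := ∑ i, (d i - 1) with hδ
  have hinj : Function.Injective (algebraMap T (MvPolynomial (Fin n) R)) := Subtype.val_injective
  let _ : GradedAlgebra (grT R n T) := grT_gradedAlgebra hinj (fun t e =>
    ⟨⟨homogeneousComponent e t.1, mem_inv.2 fun σ hσ => by
      rw [← glAct_comp, mem_inv.1 t.2 σ hσ]⟩, rfl⟩)
  let fT : Fin n → T := fun i => ⟨f i, hf i⟩
  let ys : List T := List.ofFn fT
  have hys : ∀ y ∈ ys, ∃ e, 0 < e ∧ y ∈ grT R n T e := by
    intro y hy
    obtain ⟨i, rfl⟩ := (List.mem_ofFn).1 hy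
    exact ⟨d i, hdpos i, hd i⟩
  have himg : T.val '' {y | y ∈ ys} = Set.range f := by
    ext g
    constructor
    · rintro ⟨y, hy, rfl⟩
      obtain ⟨i, rfl⟩ := (List.mem_ofFn).1 hy
      exact ⟨i, rfl⟩
    · rintro ⟨i, rfl⟩
      exact ⟨fT i, (List.mem_ofFn).2 ⟨i, rfl⟩, rfl⟩
  have hAmap : (Algebra.adjoin R {y | y ∈ ys}).map T.val = Algebra.adjoin R (Set.range f) := by
    rw [AlgHom.map_adjoin, himg]
  have hintT : Algebra.IsIntegral R (T ⧸ Ideal.ofList ys) := by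
    refine integral_quot {y | y ∈ ys} (fun t => integral_sub T _ t ?_) _ Ideal.subset_span
    rw [himg]
    exact hAint t
  have hintS : Algebra.IsIntegral R (MvPolynomial (Fin n) R ⧸ Ideal.span (Set.range f)) :=
    integral_quot _ hAint _ Ideal.subset_span
  have hCM' : ∀ (p : Ideal R) [p.IsMaximal], CMat (bigP (n := n) T p) := by
    intro p hp
    obtain ⟨rs, h1, h2, h3⟩ := hCM (bigP (n := n) T p) (bigP_maximal p)
    exact ⟨rs.length, ⟨rs, rfl, h1, h2.toIsWeaklyRegular⟩, h3.ge⟩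
  obtain ⟨hreg, htf⟩ := greg_of_CM hinj hCM' ys (by simp [ys]) hys hintT
  obtain ⟨Tr, hTr, hTlin, hThom, s, hs⟩ := exists_trace (G := G)
  have hRT : Function.Injective (algebraMap R T) := by
    intro a b hab
    exact C_injective (Fin n) R (congrArg Subtype.val hab)
  -- transporting spans along the trace
  have hTspan : ∀ w ∈ Submodule.span (Algebra.adjoin R (Set.range f))
      {u : MvPolynomial (Fin n) R | ∃ m ≤ δ, u.IsHomogeneous m},
      (⟨Tr w, hTr w⟩ : T) ∈ Submodule.span (Algebra.adjoin R {y | y ∈ ys}) {u : T | ∃ m ≤ δ, u ∈ grT R n T m} := by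
    intro w hw
    induction hw using Submodule.span_induction with
    | mem x hx =>
      obtain ⟨m, hm, hx⟩ := hx
      exact Submodule.subset_span ⟨m, hm, hThom _ _ hx⟩
    | zero =>
      convert Submodule.zero_mem (Submodule.span (Algebra.adjoin R {y | y ∈ ys}) {u : T | ∃ m ≤ δ, u ∈ grT R n T m})
      exact map_zero _
    | add x y _ _ hx hy =>
      convert add_mem hx hy
      exact map_add _ _ _
    | smul a x _ hx =>
      have ha : a.1 ∈ (Algebra.adjoin R {y | y ∈ ys}).map T.val := by rw [hAmap]; exact a.2
      obtain ⟨a', ha', haa⟩ := ha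
      convert Submodule.smul_mem _ (⟨a', ha'⟩ : Algebra.adjoin R {y | y ∈ ys}) hx
      change Tr (a.1 * x) = a'.1 * Tr x
      have haa' : a'.1 = a.1 := haa
      rw [← haa', hTlin _ a'.2]
  have hB : ∀ e > δ, ∀ t ∈ grT R n T e, ∃ a ∈ Algebra.adjoin R {y | y ∈ ys}, a ≠ 0 ∧
      a * t ∈ Submodule.span (Algebra.adjoin R {y | y ∈ ys}) {u : T | ∃ m ≤ δ, u ∈ grT R n T m} := by
    intro e _ t _
    let τ : T := ⟨Tr s, hTr s⟩
    have hτ : τ ≠ 0 := fun h => hs (congrArg Subtype.val h)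
    have hτint : IsIntegral (Algebra.adjoin R {y | y ∈ ys}) τ := by
      apply integral_sub
      rw [himg]
      exact hAint _
    obtain ⟨a, ha0, b, hb⟩ := hτint.isAlgebraic.exists_nonzero_dvd (mem_nonZeroDivisors_of_ne_zero hτ)
    obtain ⟨c, hc, h⟩ := sat_all f d hd hdpos h0 hintS (b.1 * t.1 * s)
    refine ⟨algebraMap R T c * a.1, mul_mem (Subalgebra.algebraMap_mem _ _) a.2, ?_, ?_⟩
    · apply mul_ne_zero
      · exact fun h => hc (hRT (h.trans (map_zero _).symm))
      · exact fun h => ha0 (Subtype.ext h)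
    · convert hTspan _ h
      have hb' : a.1.1 = Tr s * b.1 := congrArg Subtype.val hb
      change C c * a.1.1 * t.1 = Tr (C c * (b.1 * t.1 * s))
      have : Tr (C c * (b.1 * t.1 * s)) = C c * (b.1 * t.1 * Tr s) := by
        rw [hTlin (C c) (Subalgebra.algebraMap_mem T c), hTlin _ (mul_mem b.2 t.2)]
      rw [this, hb']
      ring
  have hmain := graded_main (grT R n T) hRT hys hreg htf δ hB
  -- generation
  set D := max (Finset.univ.sup d) δ with hD
  have hle : Algebra.adjoin R {f : MvPolynomial (Fin n) R |
      f ∈ T ∧ ∃ i ≤ D, MvPolynomial.IsHomogeneous f i} ≤ T :=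
    Algebra.adjoin_le fun g hg => hg.1
  refine le_antisymm hle ?_
  set B := Algebra.adjoin R {f : MvPolynomial (Fin n) R |
      f ∈ T ∧ ∃ i ≤ D, MvPolynomial.IsHomogeneous f i} with hBdef
  have key : ∀ e, ∀ t ∈ grT R n T e, t.1 ∈ B := by
    intro e
    induction e using Nat.strong_induction_on with
    | _ e ih =>
      intro t ht
      by_cases he : e ≤ D
      · exact Algebra.subset_adjoin ⟨t.2, e, he, ht⟩
      · have hδe : δ < e := lt_of_le_of_lt (le_max_right _ _) (not_le.1 he)
        have hmem := hmain e hδe t ht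
        have h3 := mem_ofList_homog (grT R n T) (m := e) hys hmem (A := B.comap T.val)
          (fun y hy => by
            obtain ⟨i, rfl⟩ := (List.mem_ofFn).1 hy
            exact Algebra.subset_adjoin ⟨hf i, d i, (Finset.le_sup (Finset.mem_univ i)).trans (le_max_left _ _), hd i⟩)
          (N := Submodule.span (B.comap T.val) {1})
          (fun k hk g hg => Submodule.mem_span_singleton.2 ⟨⟨g, ih k hk g hg⟩, mul_one g⟩)
        rw [DirectSum.decompose_of_mem_same _ ht] at h3
        obtain ⟨a, ha⟩ := Submodule.mem_span_singleton.1 h3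
        have ha' : a.1 = t := (mul_one a.1).symm.trans ha
        rw [← ha']
        exact a.2
  intro t ht
  rw [← sum_homogeneousComponent t]
  refine sum_mem fun e _ => key e ⟨homogeneousComponent e t, mem_inv.2 fun σ hσ => by
      rw [← glAct_comp, mem_inv.1 ht σ hσ]⟩ (homogeneousComponent_isHomogeneous e t)

end Part9

/-- Let `R` be a Noetherian integral domain, `G ⊆ GLₙ(R)` a finite
subgroup with `S^G = R[x₁,…,xₙ]^G` Cohen-Macaulay, and let `f₁,…,fₙ` be a homogeneous
system of parameters in `S^G` with `deg fᵢ = dᵢ`. Then `S^G` is generated as an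
`R`-algebra by homogeneous elements of degree at most
`max(d₁, …, dₙ, ∑ᵢ (dᵢ - 1))`, i.e. `β_R(G)` is at most this number. -/
theorem stmt_15 {n : ℕ} (R : Type*) [CommRing R] [IsDomain R] [IsNoetherianRing R]
    (G : Subgroup (Matrix.GeneralLinearGroup (Fin n) R)) [Finite G]
    (f : Fin n → MvPolynomial (Fin n) R) (d : Fin n → ℕ)
    (hd : ∀ i, (f i).IsHomogeneous (d i)) (hsop : IsHSOPInv G f)
    (hCM : IsCohenMacaulayRing ↥(invariants G)) :
    genByDeg R G (max (Finset.univ.sup d) (∑ i, (d i - 1))) := by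
  exact main_aux f d hd hsop hCM
end

section
/- Let R be a Noetherian integral domain, G ⊆ GL_n(R) a finite subgroup, and S = R[x_1,…,x_n]. If the ring of invariants S^G is a Cohen-Macaulay ring, then S^G is generated as an R-algebra by homogeneous elements of degree at most max(|G|, n(|G|−1)); that is, β_R(G) ≤ max(|G|, n(|G|−1)). -/
open MvPolynomial TensorProduct

set_option synthInstance.maxHeartbeats 1000000
set_option maxHeartbeats 1000000

section
open IsLocalRing

set_option linter.unusedSectionVars false

namespace CMInv

/-- `r` is a nonzerodivisor modulo `I`. -/
def NZ {B : Type*} [CommRing B] (I : Ideal B) (r : B) : Prop := ∀ v, r * v ∈ I → v ∈ I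

/-- `B ⧸ I` has a weakly regular sequence of length `k` in the maximal ideal. -/
def DD {B : Type*} [CommRing B] [IsLocalRing B] : ℕ → Ideal B → Prop
  | 0, _ => True
  | k + 1, I => ∃ r ∈ maximalIdeal B, NZ I r ∧ DD k (I ⊔ Ideal.span {r})

/-- `ys` is weakly regular modulo `I`. -/
def RegList {B : Type*} [CommRing B] : List B → Ideal B → Prop
  | [], _ => True
  | y :: ys, I => NZ I y ∧ RegList ys (I ⊔ Ideal.span {y})

section
variable {B : Type*} [CommRing B]

theorem mem_sup_single {I : Ideal B} {r v : B} :
    v ∈ I ⊔ Ideal.span {r} ↔ ∃ w, v - r * w ∈ I := by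
  rw [sup_comm, Ideal.mem_span_singleton_sup]
  constructor
  · rintro ⟨a, b, hb, rfl⟩
    exact ⟨a, by convert hb using 1; ring⟩
  · rintro ⟨w, hw⟩
    exact ⟨w, _, hw, by ring⟩

theorem swap2 {I : Ideal B} {r z : B} (hr : NZ I r) (hz : NZ (I ⊔ Ideal.span {r}) z) :
    NZ (I ⊔ Ideal.span {z}) r := by
  intro v hv
  rw [mem_sup_single] at hv ⊢
  obtain ⟨w, hw⟩ := hv
  have : w ∈ I ⊔ Ideal.span {r} := hz w (mem_sup_single.2 ⟨v, by
    have := I.neg_mem hw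
    convert this using 1; ring⟩)
  obtain ⟨w', hw'⟩ := mem_sup_single.1 this
  refine ⟨w', hr _ ?_⟩
  have := I.add_mem hw (I.mul_mem_left z hw')
  convert this using 1; ring

variable [IsLocalRing B] [IsNoetherianRing B]

theorem nak {K I : Ideal B} {r : B} (hr : r ∈ maximalIdeal B)
    (h : ∀ v ∈ K, ∃ w ∈ K, v - r * w ∈ I) : K ≤ I := by
  apply Submodule.le_of_le_smul_of_le_jacobson_bot (I := maximalIdeal B)
    (IsNoetherian.noetherian K) (by rw [jacobson_eq_maximalIdeal _ bot_ne_top])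
  intro v hv
  obtain ⟨w, hw, h⟩ := h v hv
  have : v = (v - r * w) + r * w := by ring
  rw [this]
  exact Submodule.add_mem_sup h (Submodule.smul_mem_smul hr hw)

theorem swap1 {I : Ideal B} {r z : B} (hrm : r ∈ maximalIdeal B) (hr : NZ I r)
    (hz : NZ (I ⊔ Ideal.span {r}) z) : NZ I z := by
  let K : Ideal B := Submodule.comap (LinearMap.mulLeft B z) I
  have hK : K ≤ I := by
    apply nak hrm
    intro v hv
    have hv' : z * v ∈ I := hv
    obtain ⟨w, hw⟩ := mem_sup_single.1 (hz v (Ideal.mem_sup_left hv'))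
    refine ⟨w, ?_, hw⟩
    change z * w ∈ I
    apply hr
    have := I.sub_mem hv' (I.mul_mem_left z hw)
    convert this using 1; ring
  intro v hv
  exact hK hv

/-- no socle -/
def NoSoc (I : Ideal B) : Prop := ∀ m, (∀ c ∈ maximalIdeal B, c * m ∈ I) → m ∈ I

theorem soc {I : Ideal B} {r y : B} (hrm : r ∈ maximalIdeal B) (hr : NZ I r) (hy : NZ I y)
    (h : NoSoc (I ⊔ Ideal.span {r})) : NoSoc (I ⊔ Ideal.span {y}) := by
  intro m hm
  obtain ⟨m', hm'⟩ := mem_sup_single.1 (hm r hrm)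
  have h1 : m' ∈ I ⊔ Ideal.span {r} := by
    apply h
    intro c hc
    obtain ⟨mc, hmc⟩ := mem_sup_single.1 (hm c hc)
    refine mem_sup_single.2 ⟨mc, hy _ ?_⟩
    have := I.sub_mem (I.mul_mem_left r hmc) (I.mul_mem_left c hm')
    convert this using 1; ring
  obtain ⟨m'', hm''⟩ := mem_sup_single.1 h1
  refine mem_sup_single.2 ⟨m'', hr _ ?_⟩
  have := I.add_mem hm' (I.mul_mem_left y hm'')
  convert this using 1; ring

theorem exists_assoc {I : Ideal B} {v : B} (hv : v ∉ I) :
    ∃ q : Ideal B, q ∈ associatedPrimes B (B ⧸ I) ∧ ∀ c, c * v ∈ I → c ∈ q := by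
  obtain ⟨P, hP, h⟩ := exists_le_isAssociatedPrime_of_isNoetherianRing B
    (Ideal.Quotient.mk I v) (by rwa [Ne, Ideal.Quotient.eq_zero_iff_mem])
  refine ⟨P, hP, fun c hc => h ?_⟩
  rw [Submodule.mem_colon_singleton]
  change Ideal.Quotient.mk I (c * v) = 0
  rwa [Ideal.Quotient.eq_zero_iff_mem]

theorem assoc_elt {I q : Ideal B} (hq : q ∈ associatedPrimes B (B ⧸ I)) :
    ∃ v, v ∉ I ∧ ∀ c, c ∈ q ↔ c * v ∈ I := by
  obtain ⟨hp, x, hx⟩ := isAssociatedPrime_iff.1 hq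
  obtain ⟨v, rfl⟩ := Ideal.Quotient.mk_surjective x
  have key : ∀ c, c ∈ q ↔ c * v ∈ I := by
    intro c
    rw [hx, Submodule.mem_colon_singleton]
    change Ideal.Quotient.mk I (c * v) = 0 ↔ _
    rw [Ideal.Quotient.eq_zero_iff_mem]
  refine ⟨v, fun hv => hp.ne_top ((Ideal.eq_top_iff_one _).2 ((key 1).2 (by simpa using hv))), key⟩

theorem avoid {I J : Ideal B} (hI : NoSoc I) (hJ : NoSoc J) :
    ∃ z ∈ maximalIdeal B, NZ I z ∧ NZ J z := by
  by_contra! hcon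
  have hfin : (associatedPrimes B (B ⧸ I) ∪ associatedPrimes B (B ⧸ J)).Finite :=
    (associatedPrimes.finite B _).union (associatedPrimes.finite B _)
  have := (Ideal.subset_iUnion_iff_mem_of_isMaximal_of_finite (M := maximalIdeal B) hfin ⊥ ⊥
    (fun P hP _ _ => by rcases hP with h | h <;> exact h.1) bot_ne_top bot_ne_top).1 (by
      intro z hz
      simp only [Set.mem_iUnion]
      by_cases h1 : NZ I z
      · have h2 := hcon z hz h1
        simp only [NZ, not_forall] at h2
        obtain ⟨v, hv, hv'⟩ := h2
        obtain ⟨q, hq, hq'⟩ := exists_assoc hv'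
        exact ⟨q, Or.inr hq, hq' _ hv⟩
      · simp only [NZ, not_forall] at h1
        obtain ⟨v, hv, hv'⟩ := h1
        obtain ⟨q, hq, hq'⟩ := exists_assoc hv'
        exact ⟨q, Or.inl hq, hq' _ hv⟩)
  rcases this with h | h
  · obtain ⟨v, hv, h⟩ := assoc_elt h
    exact hv (hI v fun c hc => (h c).1 hc)
  · obtain ⟨v, hv, h⟩ := assoc_elt h
    exact hv (hJ v fun c hc => (h c).1 hc)

theorem exch (k : ℕ) : ∀ (I : Ideal B) (y : B), DD (k + 1) I → y ∈ maximalIdeal B → NZ I y →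
    DD k (I ⊔ Ideal.span {y}) := by
  induction k with
  | zero => intro I y _ _ _; trivial
  | succ k ih =>
    rintro I y ⟨r, hrm, hr, hD⟩ hym hy
    obtain ⟨r2, hr2m, hr2, -⟩ := id hD
    have s1 : NoSoc (I ⊔ Ideal.span {r}) := fun m hm => hr2 m (hm r2 hr2m)
    have s2 := soc hrm hr hy s1
    obtain ⟨z, hzm, hz1, hz2⟩ := avoid s1 s2
    have h1 := ih _ z hD hzm hz1
    have hDz : DD (k + 1) (I ⊔ Ideal.span {z}) :=
      ⟨r, hrm, swap2 hr hz1, by rwa [sup_right_comm]⟩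
    have h2 := ih _ y hDz hym (swap2 hy hz2)
    exact ⟨z, hzm, hz2, by rwa [sup_right_comm]⟩

theorem dim_lt {p q : Ideal B} [p.IsPrime] (h : p ≤ q) {r : B} (hr : r ∈ q) (hrp : r ∉ p) :
    ringKrullDim (B ⧸ q) + 1 ≤ ringKrullDim (B ⧸ p) := by
  have h1 := ringKrullDim_quotient_succ_le_of_nonZeroDivisor (R := B ⧸ p)
    (r := Ideal.Quotient.mk p r) (mem_nonZeroDivisors_of_ne_zero
      (by rwa [Ne, Ideal.Quotient.eq_zero_iff_mem]))
  refine le_trans ?_ h1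
  gcongr
  refine ringKrullDim_le_of_surjective
    (Ideal.Quotient.lift (Ideal.span {Ideal.Quotient.mk p r}) (Ideal.Quotient.factor h) ?_) ?_
  · intro a ha
    have : Ideal.span {Ideal.Quotient.mk p r} ≤ RingHom.ker (Ideal.Quotient.factor h) := by
      rw [Ideal.span_singleton_le_iff_mem, RingHom.mem_ker, Ideal.Quotient.factor_mk,
        Ideal.Quotient.eq_zero_iff_mem]
      exact hr
    exact this ha
  · apply Ideal.Quotient.lift_surjective_of_surjective
    exact Ideal.Quotient.factor_surjective h

theorem depth_le (k : ℕ) : ∀ (I p : Ideal B), p.IsPrime → ∀ v, v ∉ I → (∀ c ∈ p, c * v ∈ I) →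
    DD k I → (k : WithBot ℕ∞) ≤ ringKrullDim (B ⧸ p) := by
  induction k with
  | zero =>
    intro I p hp v _ _ _
    exact_mod_cast ringKrullDim_nonneg_of_nontrivial
  | succ k ih =>
    rintro I p hp v hv hpv ⟨r, hrm, hr, hD⟩
    let K : Ideal B := 
      { carrier := {m | ∀ c ∈ p, c * m ∈ I}
        add_mem' := fun {a b} ha hb c hc => by rw [mul_add]; exact I.add_mem (ha c hc) (hb c hc)
        zero_mem' := fun c _ => by simp
        smul_mem' := fun a m hm c hc => by
          rw [smul_eq_mul, mul_left_comm]; exact I.mul_mem_left _ (hm c hc) }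
    have : ∃ m ∈ K, m ∉ I ⊔ Ideal.span {r} := by
      by_contra! hcon
      refine hv ((nak (K := K) hrm ?_) hpv)
      intro m hm
      obtain ⟨w, hw⟩ := mem_sup_single.1 (hcon m hm)
      refine ⟨w, fun c hc => hr _ ?_, hw⟩
      have := I.sub_mem (hm c hc) (I.mul_mem_left c hw)
      convert this using 1; ring
    obtain ⟨m, hmK, hm⟩ := this
    obtain ⟨q, hq, hq'⟩ := exists_assoc hm
    have hpq : p ≤ q := fun c hc => hq' c (Ideal.mem_sup_left (hmK c hc))
    have hrq : r ∈ q := hq' r (Ideal.mem_sup_right (Ideal.mem_span_singleton.2 (dvd_mul_right _ _)))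
    have hrp : r ∉ p := fun h => hv (hr v (hpv r h))
    obtain ⟨v', hv', h'⟩ := assoc_elt hq
    have := ih _ q hq.1 v' hv' (fun c hc => (h' c).1 hc) hD
    refine le_trans ?_ (dim_lt hpq hrq hrp)
    push_cast
    gcongr

theorem krull_quot (p : Ideal B) [p.IsPrime] (ys : List B)
    (h : ∀ P : Ideal B, P.IsPrime → p ≤ P → (∀ y ∈ ys, y ∈ P) → P = maximalIdeal B) 
    (hys : ∀ y ∈ ys, y ∈ maximalIdeal B) :
    ringKrullDim (B ⧸ p) ≤ ys.length := by
  classical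
  have hple : p ≤ maximalIdeal B := le_maximalIdeal ‹p.IsPrime›.ne_top
  have hnt : Nontrivial (B ⧸ p) := Ideal.Quotient.nontrivial_iff.2 ‹p.IsPrime›.ne_top
  have : IsLocalRing (B ⧸ p) := IsLocalRing.of_surjective' (Ideal.Quotient.mk p)
    Ideal.Quotient.mk_surjective
  rw [← IsLocalRing.maximalIdeal_height_eq_ringKrullDim]
  let s : Finset (B ⧸ p) := (ys.map (Ideal.Quotient.mk p)).toFinset
  have hcm : (maximalIdeal (B ⧸ p)).comap (Ideal.Quotient.mk p) = maximalIdeal B :=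
    eq_maximalIdeal (Ideal.comap_isMaximal_of_surjective _ Ideal.Quotient.mk_surjective)
  have hmin : maximalIdeal (B ⧸ p) ∈ (Ideal.span (s : Set (B ⧸ p))).minimalPrimes := by
    refine ⟨⟨inferInstance, ?_⟩, ?_⟩
    · rw [Ideal.span_le]
      intro a ha
      simp only [s, List.coe_toFinset, List.mem_map, Set.mem_ofPred_eq] at ha
      obtain ⟨y, hy, rfl⟩ := ha
      have := hys y hy
      rwa [← hcm] at this
    · rintro P ⟨hP, hsP⟩ _
      have := h (P.comap (Ideal.Quotient.mk p)) (Ideal.IsPrime.comap _) (by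
        intro a ha
        rw [Ideal.mem_comap, Ideal.Quotient.eq_zero_iff_mem.2 ha]
        exact P.zero_mem) (by
        intro y hy
        rw [Ideal.mem_comap]
        apply hsP
        apply Ideal.subset_span
        simp only [s, List.coe_toFinset, List.mem_map, Set.mem_ofPred_eq]
        exact ⟨y, hy, rfl⟩)
      intro a ha
      obtain ⟨b, rfl⟩ := Ideal.Quotient.mk_surjective a
      rw [← Ideal.mem_comap, hcm, ← this] at ha
      exact ha
  have h1 := Ideal.height_le_card_of_mem_minimalPrimes_span_finset hmin
  have h2 : s.card ≤ ys.length := (List.toFinset_card_le _).trans (by simp)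
  have h3 : (maximalIdeal (B ⧸ p)).height ≤ (ys.length : ℕ∞) := h1.trans (by exact_mod_cast h2)
  exact_mod_cast h3

theorem sop_reg (ys : List B) : ∀ (I : Ideal B), DD ys.length I →
    (∀ y ∈ ys, y ∈ maximalIdeal B) →
    (∀ P : Ideal B, P.IsPrime → I ≤ P → (∀ y ∈ ys, y ∈ P) → P = maximalIdeal B) →
    RegList ys I := by
  induction ys with
  | nil => intros; trivial
  | cons y ys ih =>
    intro I hD hm hP
    have hy : NZ I y := by
      by_contra hcon
      simp only [NZ, not_forall] at hcon
      obtain ⟨v, hv, hv'⟩ := hcon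
      obtain ⟨p, hp, hp'⟩ := exists_assoc hv'
      obtain ⟨v2, hv2, h2⟩ := assoc_elt hp
      have hpp : p.IsPrime := hp.1
      have a1 := depth_le _ I p hpp v2 hv2 (fun c hc => (h2 c).1 hc) hD
      have a2 := krull_quot p ys (by
        intro P hPp hpP hys
        refine hP P hPp (fun a ha => hpP ((h2 a).2 (I.mul_mem_right _ ha))) ?_
        intro z hz
        rcases List.mem_cons.1 hz with rfl | hz
        · exact hpP (hp' _ hv)
        · exact hys z hz) (fun z hz => hm z (List.mem_cons_of_mem _ hz))
      have a3 := a1.trans a2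
      rw [List.length_cons] at a3
      have : ys.length + 1 ≤ ys.length := by exact_mod_cast a3
      omega
    refine ⟨hy, ih _ (exch _ I y hD (hm y (by simp)) hy)
      (fun z hz => hm z (List.mem_cons_of_mem _ hz)) ?_⟩
    intro P hPp hIP hys
    refine hP P hPp (le_sup_left.trans hIP) ?_
    intro z hz
    rcases List.mem_cons.1 hz with rfl | hz
    · exact hIP (Ideal.mem_sup_right (Ideal.mem_span_singleton_self _))
    · exact hys z hz

end

theorem RegList.nz {B : Type*} [CommRing B] (l1 : List B) : ∀ (I : Ideal B) (y : B) (l2 : List B),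
    RegList (l1 ++ y :: l2) I → NZ (I ⊔ Ideal.span {a | a ∈ l1}) y := by
  induction l1 with
  | nil => intro I y l2 h; simpa using h.1
  | cons a l1 ih =>
    intro I y l2 h
    have := ih _ _ _ h.2
    rwa [sup_assoc, ← Ideal.span_union, show ({a} ∪ {b | b ∈ l1} : Set B) = {b | b ∈ a :: l1} by
      ext; simp] at this

theorem DD.mono {B : Type*} [CommRing B] [IsLocalRing B] {j : ℕ} : ∀ {k : ℕ} {I : Ideal B},
    j ≤ k → DD k I → DD j I := by
  induction j with
  | zero => intros; trivial
  | succ j ih =>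
    intro k I hk h
    obtain ⟨k, rfl⟩ : ∃ k', k = k' + 1 := ⟨k - 1, by omega⟩
    obtain ⟨r, h1, h2, h3⟩ := h
    exact ⟨r, h1, h2, ih (by omega) h3⟩

/-- a weakly regular sequence in the sense of Mathlib gives `DD` -/
theorem DD_of_isWeaklyRegular {B : Type*} [CommRing B] [IsLocalRing B] (rs : List B)
    (hm : ∀ r ∈ rs, r ∈ maximalIdeal B)
    (h : RingTheory.Sequence.IsWeaklyRegular B rs) : DD rs.length (⊥ : Ideal B) := by
  have key : ∀ (l2 l1 : List B), rs = l1 ++ l2 → DD l2.length (Ideal.ofList l1) := by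
    intro l2
    induction l2 with
    | nil => intros; trivial
    | cons r l2 ih =>
      intro l1 hl
      refine ⟨r, hm r (by simp [hl]), ?_, ?_⟩
      · have := h.regular_mod_prev l1.length (by simp [hl])
        intro v hv
        have e : (Ideal.ofList (rs.take l1.length) • ⊤ : Ideal B) = Ideal.ofList l1 := by
          simp [hl]
        rw [e] at this
        have h3 := @this (Submodule.Quotient.mk v) 0 (by
          have : rs[l1.length]'(by simp [hl]) = r := by simp [hl]
          simp only [this]
          rw [smul_zero, ← Submodule.Quotient.mk_smul, Submodule.Quotient.mk_eq_zero]
          exact hv)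
        rwa [Submodule.Quotient.mk_eq_zero] at h3
      · have := ih (l1 ++ [r]) (by simp [hl])
        rwa [Ideal.ofList_append, Ideal.ofList_singleton] at this
  simpa using key rs [] rfl

end CMInv

end

section
open IsLocalRing

namespace CMInv

theorem colon_pow {B : Type*} [CommRing B] {n : ℕ} (f : Fin n → B)
    (H : ∀ (i : Fin n) (e : Fin n → ℕ), (∀ j, 1 ≤ e j) →
      NZ (Ideal.span {a | ∃ j, j ≠ i ∧ a = f j ^ e j}) (f i)) (N : ℕ) (s : Finset (Fin n)) :
    ∀ v, (∏ j ∈ s, f j ^ N) * v ∈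
      Ideal.span (Set.range fun j => f j ^ (if j ∈ s then N + 1 else 1)) →
      v ∈ Ideal.span (Set.range f) := by
  classical
  induction s using Finset.induction_on with
  | empty => intro v hv; simpa using hv
  | insert a s ha ih =>
    intro v hv
    apply ih
    rw [Finset.prod_insert ha, mul_assoc] at hv
    set x := (∏ j ∈ s, f j ^ N) * v
    let e : Fin n → ℕ := fun j => if j ∈ s then N + 1 else 1
    let J := Ideal.span {b | ∃ j, j ≠ a ∧ b = f j ^ e j}
    have hle : Ideal.span (Set.range fun j => f j ^ (if j ∈ insert a s then N + 1 else 1)) ≤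
        J ⊔ Ideal.span {f a ^ (N + 1)} := by
      rw [Ideal.span_le]
      rintro _ ⟨j, rfl⟩
      by_cases hj : j = a
      · subst hj
        exact Ideal.mem_sup_right (by simpa using Ideal.mem_span_singleton_self _)
      · refine Ideal.mem_sup_left (Ideal.subset_span ⟨j, hj, ?_⟩)
        simp [e, hj]
    obtain ⟨w, hw⟩ := mem_sup_single.1 (hle hv)
    have hpow : ∀ (k : ℕ) (y : B), f a ^ k * y ∈ J → y ∈ J := by
      intro k
      induction k with
      | zero => intro y hy; simpa using hy
      | succ k ihk =>
        intro y hy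
        refine ihk y (H a e (fun j => by simp only [e]; split_ifs <;> omega) _ ?_)
        convert hy using 1; ring
    have h2 : x - f a * w ∈ J := hpow N _ (by convert hw using 1; ring)
    have hJle : J ≤ Ideal.span (Set.range fun j => f j ^ (if j ∈ s then N + 1 else 1)) := by
      rw [Ideal.span_le]
      rintro _ ⟨j, hj, rfl⟩
      exact Ideal.subset_span ⟨j, rfl⟩
    have h3 : f a * w ∈ Ideal.span (Set.range fun j => f j ^ (if j ∈ s then N + 1 else 1)) :=
      Ideal.mul_mem_right _ _ (Ideal.subset_span ⟨a, by simp [ha]⟩)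
    have := Ideal.add_mem _ (hJle h2) h3
    simpa using this

theorem main_local {B : Type*} [CommRing B] [IsLocalRing B] [IsNoetherianRing B] {n : ℕ}
    (f : Fin n → B) (zs : List B) (hf : ∀ i, f i ∈ maximalIdeal B)
    (hz : ∀ z ∈ zs, z ∈ maximalIdeal B) (hD : DD (n + zs.length) (⊥ : Ideal B))
    (hP : ∀ P : Ideal B, P.IsPrime → (∀ i, f i ∈ P) → (∀ z ∈ zs, z ∈ P) → P = maximalIdeal B)
    (b : B) (hb : IsUnit b ∨ ∃ zs', zs = b :: zs') (N : ℕ) (v : B)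
    (hv : (∏ j, f j ^ N) * (b * v) ∈ Ideal.span (Set.range fun j => f j ^ (N + 1))) :
    v ∈ Ideal.span (Set.range f) := by
  classical
  have hbv : b * v ∈ Ideal.span (Set.range f) := by
    refine colon_pow f ?_ N Finset.univ _ (by simpa using hv)
    intro i e he
    have hreg := sop_reg ((((Finset.univ.erase i).toList.map fun j => f j ^ e j)) ++ f i :: zs)
      (⊥ : Ideal B) (by
        have hn : n ≠ 0 := by rintro rfl; exact i.elim0
        have : (n - 1) + (zs.length + 1) = n + zs.length := by omega
        simpa [this] using hD) (by
        intro y hy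
        rcases List.mem_append.1 hy with hy | hy
        · obtain ⟨j, hj, rfl⟩ := List.mem_map.1 hy
          exact Ideal.pow_mem_of_mem _ (hf j) _ (he j)
        · rcases List.mem_cons.1 hy with rfl | hy
          · exact hf i
          · exact hz y hy) (by
        intro P hPp _ hy
        refine hP P hPp ?_ ?_
        · intro j
          by_cases hj : j = i
          · subst hj; exact hy _ (by simp)
          · refine hPp.mem_of_pow_mem (e j) (hy _ ?_)
            apply List.mem_append_left
            exact List.mem_map.2 ⟨j, by simp [hj], rfl⟩
        · intro z hz
          exact hy z (by simp [hz]))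
    have := hreg.nz
    rw [bot_sup_eq] at this
    convert this using 2
    ext a
    simp [eq_comm]
  rcases hb with hb | ⟨zs', rfl⟩
  · obtain ⟨c, hc⟩ := hb.exists_left_inv
    have := Ideal.mul_mem_left _ c hbv
    rwa [← mul_assoc, hc, one_mul] at this
  · have hreg := sop_reg (List.ofFn f ++ b :: zs') (⊥ : Ideal B) (by simpa using hD) (by
        intro y hy
        rcases List.mem_append.1 hy with hy | hy
        · obtain ⟨j, rfl⟩ := (List.mem_ofFn' _ _).1 hy
          exact hf j
        · exact hz y hy) (by
        intro P hPp _ hy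
        refine hP P hPp ?_ ?_
        · intro j
          exact hy _ (List.mem_append_left _ ((List.mem_ofFn' _ _).2 ⟨j, rfl⟩))
        · intro z hz
          exact hy z (List.mem_append_right _ hz))
    have := hreg.nz
    rw [bot_sup_eq] at this
    have e : {a | a ∈ List.ofFn f} = Set.range f := by
      ext; simp
    rw [e] at this
    exact this v hbv

open MvPolynomial

/-- elements that lie in `I` after multiplication with a constant outside `p`. -/
noncomputable def sat {R : Type*} [CommRing R] {n : ℕ} (p : Ideal R) [hp : p.IsPrime]
    (I : Ideal (MvPolynomial (Fin n) R)) : Ideal (MvPolynomial (Fin n) R) where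
  carrier := {h | ∃ w, w ∉ p ∧ C w * h ∈ I}
  add_mem' := by
    rintro a b ⟨w, hw, ha⟩ ⟨w', hw', hb⟩
    refine ⟨w * w', fun h => (hp.mem_or_mem h).elim hw hw', ?_⟩
    have := I.add_mem (I.mul_mem_left (C w') ha) (I.mul_mem_left (C w) hb)
    convert this using 1
    rw [C_mul]; ring
  zero_mem' := ⟨1, fun h => hp.ne_top ((Ideal.eq_top_iff_one _).2 h), by simp⟩
  smul_mem' := by
    rintro c a ⟨w, hw, ha⟩
    refine ⟨w, hw, ?_⟩
    rw [smul_eq_mul, mul_left_comm]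
    exact I.mul_mem_left _ ha

theorem mem_sat {R : Type*} [CommRing R] {n : ℕ} {p : Ideal R} [hp : p.IsPrime]
    {I : Ideal (MvPolynomial (Fin n) R)} {h : MvPolynomial (Fin n) R} :
    h ∈ sat p I ↔ ∃ w, w ∉ p ∧ C w * h ∈ I := Iff.rfl

theorem sat_cancel {R : Type*} [CommRing R] {n : ℕ} {p : Ideal R} [hp : p.IsPrime]
    {I : Ideal (MvPolynomial (Fin n) R)} {h : MvPolynomial (Fin n) R} {w : R} (hw : w ∉ p)
    (hh : C w * h ∈ sat p I) : h ∈ sat p I := by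
  obtain ⟨w', hw', h'⟩ := hh
  refine ⟨w' * w, fun h => (hp.mem_or_mem h).elim hw' hw, ?_⟩
  rwa [C_mul, mul_assoc]

theorem le_sat {R : Type*} [CommRing R] {n : ℕ} {p : Ideal R} [hp : p.IsPrime]
    {I : Ideal (MvPolynomial (Fin n) R)} : I ≤ sat p I := fun h hh =>
  ⟨1, fun h => hp.ne_top ((Ideal.eq_top_iff_one _).2 h), by simpa using hh⟩

/-- the linear form with coefficient vector `v`. -/
noncomputable def lf {R : Type*} [CommRing R] {n : ℕ} (v : Fin n → R) :
    MvPolynomial (Fin n) R := ∑ j, C (v j) * X j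

theorem cramer_lf {R : Type*} [CommRing R] {n : ℕ} (A : Matrix (Fin n) (Fin n) R) (k : Fin n) :
    C A.det * X k = ∑ i, C (A.adjugate k i) * lf (A i) := by
  simp only [lf, Finset.mul_sum]
  rw [Finset.sum_comm]
  have : ∀ j, ∑ i, C (A.adjugate k i) * (C (A i j) * X j) =
      C ((A.adjugate * A) k j) * (X j : MvPolynomial (Fin n) R) := by
    intro j
    rw [Matrix.mul_apply, map_sum, Finset.sum_mul]
    simp [mul_assoc]
  simp_rw [this, Matrix.adjugate_mul]
  rw [Finset.sum_eq_single k]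
  · simp
  · intro j _ hj
    simp [Matrix.one_apply, hj.symm]
  · simp

theorem lin {R : Type*} [CommRing R] (p : Ideal R) [hp : p.IsPrime] {n : ℕ} (d : ℕ) :
    ∀ (L : Fin n → List (Fin n → R)),
    (∀ c : Fin n → (Fin n → R), (∀ i, c i ∈ L i) → (Matrix.of c).det ∉ p) →
    ∑ i, (L i).length < d + n → ∀ h : MvPolynomial (Fin n) R, h.IsHomogeneous d →
    h ∈ sat p (Ideal.span (Set.range fun i => ((L i).map lf).prod)) := by
  have triv : ∀ (L : Fin n → List (Fin n → R)) (i : Fin n) (h : MvPolynomial (Fin n) R),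
      L i = [] → h ∈ sat p (Ideal.span (Set.range fun i => ((L i).map lf).prod)) := by
    intro L i h hi
    apply le_sat
    have : Ideal.span (Set.range fun i => ((L i).map lf).prod) = ⊤ := by
      rw [Ideal.eq_top_iff_one]
      exact Ideal.subset_span ⟨i, by simp [hi]⟩
    rw [this]; trivial
  induction d with
  | zero =>
    intro L hL hsum h hh
    have : ∃ i, L i = [] := by
      by_contra! hcon
      have : ∑ i : Fin n, 1 ≤ ∑ i, (L i).length :=
        Finset.sum_le_sum fun i _ => List.length_pos_iff.2 (hcon i)
      simp at this
      omega
    obtain ⟨i, hi⟩ := this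
    exact triv L i h hi
  | succ d ih =>
    intro L hL hsum h hh
    by_cases hcon : ∃ i, L i = []
    · obtain ⟨i, hi⟩ := hcon
      exact triv L i h hi
    push Not at hcon
    choose c l hcl using fun i => List.exists_cons_of_ne_nil (hcon i)
    have hdet := hL c (fun i => by simp [hcl i])
    set I := Ideal.span (Set.range fun i => ((L i).map lf).prod) with hI
    rw [h.as_sum]
    refine Ideal.sum_mem _ fun m hm => ?_
    have hm' : m.degree = d + 1 := by
      have := hh (mem_support_iff.1 hm)
      rw [Finsupp.degree_eq_weight_one]; exact this
    have : ∃ k, m k ≠ 0 := by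
      by_contra! h0
      have : m = 0 := Finsupp.ext h0
      rw [this] at hm'
      simp at hm'
    obtain ⟨k, hk⟩ := this
    obtain ⟨m', rfl⟩ : ∃ m', m = Finsupp.single k 1 + m' :=
      ⟨m - Finsupp.single k 1, (add_tsub_cancel_of_le
        (Finsupp.single_le_iff.2 (Nat.one_le_iff_ne_zero.2 hk))).symm⟩
    set a := coeff (Finsupp.single k 1 + m') h
    have hdeg : m'.degree = d := by
      rw [map_add, Finsupp.degree_single] at hm'
      omega
    have hmon : monomial (Finsupp.single k 1 + m') a = X k * monomial m' a := by
      rw [X, monomial_mul, one_mul]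
    have hhom : (monomial m' a).IsHomogeneous d := isHomogeneous_monomial _ hdeg
    rw [hmon]
    apply sat_cancel hdet
    rw [← mul_assoc, cramer_lf, Finset.sum_mul]
    refine Ideal.sum_mem _ fun i _ => ?_
    rw [mul_assoc]
    refine Ideal.mul_mem_left _ _ ?_
    let L' := Function.update L i (l i)
    have hlen : ∑ j, (L' j).length + 1 = ∑ j, (L j).length := by
      rw [← Finset.add_sum_erase _ _ (Finset.mem_univ i),
        ← Finset.add_sum_erase _ (fun j => (L j).length) (Finset.mem_univ i)]
      have : ∑ x ∈ Finset.univ.erase i, (L' x).length = ∑ x ∈ Finset.univ.erase i, (L x).length :=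
        Finset.sum_congr rfl fun x hx => by
          simp [L', Function.update_of_ne (Finset.ne_of_mem_erase hx)]
      rw [this]
      simp [L', hcl i]
      omega
    have := ih L' (by
      intro c' hc'
      apply hL
      intro j
      have := hc' j
      by_cases hj : j = i
      · subst hj
        simp only [L', Function.update_self] at this
        rw [hcl j]; exact List.mem_cons_of_mem _ this
      · simpa [L', Function.update_of_ne hj] using this) (by omega) _ hhom
    obtain ⟨w, hw, hmem⟩ := this
    refine ⟨w, hw, ?_⟩
    rw [mul_left_comm]
    have hle : Ideal.span (Set.range fun i => ((L' i).map lf).prod) ≤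
        Submodule.comap (LinearMap.mulLeft _ (lf (c i))) I := by
      rw [Ideal.span_le]
      rintro _ ⟨j, rfl⟩
      change lf (c i) * _ ∈ I
      by_cases hj : j = i
      · subst hj
        apply Ideal.subset_span
        exact ⟨j, by simp [hcl j, L']⟩
      · apply Ideal.mul_mem_left
        apply Ideal.subset_span
        exact ⟨j, by simp [L', Function.update_of_ne hj]⟩
    exact hle hmem

end CMInv

end

section
open MvPolynomial

namespace CMInv

section act
variable {R : Type*} [CommRing R] {n : ℕ}

theorem glAct_X (σ : Matrix.GeneralLinearGroup (Fin n) R) (i : Fin n) :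
    glAct σ (X i) = lf (((σ⁻¹ : Matrix.GeneralLinearGroup (Fin n) R) :
      Matrix (Fin n) (Fin n) R) i) := by
  simp [glAct, lf, smul_eq_C_mul]

theorem glAct_C (σ : Matrix.GeneralLinearGroup (Fin n) R) (r : R) :
    glAct σ (C r) = C r := by
  simp [glAct]

theorem glAct_lf (σ : Matrix.GeneralLinearGroup (Fin n) R) (v : Fin n → R) :
    glAct σ (lf v) = lf (Matrix.vecMul v ((σ⁻¹ : Matrix.GeneralLinearGroup (Fin n) R) :
      Matrix (Fin n) (Fin n) R)) := by
  conv_lhs => rw [lf]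
  rw [map_sum]
  simp only [map_mul, glAct_C, glAct_X]
  simp only [lf, Matrix.vecMul, dotProduct, Finset.mul_sum, map_sum, Finset.sum_mul, C_mul]
  rw [Finset.sum_comm]
  simp only [mul_assoc]

theorem glAct_mul (σ τ : Matrix.GeneralLinearGroup (Fin n) R) (f : MvPolynomial (Fin n) R) :
    glAct (σ * τ) f = glAct σ (glAct τ f) := by
  have : glAct (σ * τ) = (glAct σ).comp (glAct τ) := by
    ext1 i
    rw [AlgHom.comp_apply, glAct_X, glAct_X, glAct_lf]
    rw [mul_inv_rev, Units.val_mul]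
    rfl
  rw [this]; rfl

theorem lf_one_row (i : Fin n) : lf ((1 : Matrix (Fin n) (Fin n) R) i) = X i := by
  rw [lf, Finset.sum_eq_single i]
  · simp
  · intro j _ hj
    simp [hj.symm]
  · simp

theorem glAct_one (f : MvPolynomial (Fin n) R) :
    glAct (1 : Matrix.GeneralLinearGroup (Fin n) R) f = f := by
  have : glAct (1 : Matrix.GeneralLinearGroup (Fin n) R) = AlgHom.id R _ := by
    ext1 i
    rw [glAct_X, inv_one, Units.val_one, lf_one_row]; rfl
  rw [this]; rfl

theorem lf_hom (v : Fin n → R) : (lf v).IsHomogeneous 1 := by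
  refine IsHomogeneous.sum _ _ _ fun j _ => ?_
  simpa using (isHomogeneous_C (Fin n) (v j)).mul (isHomogeneous_X R j)

theorem glAct_hom (σ : Matrix.GeneralLinearGroup (Fin n) R) {f : MvPolynomial (Fin n) R} {d : ℕ}
    (hf : f.IsHomogeneous d) : (glAct σ f).IsHomogeneous d := by
  have := hf.aeval (fun i => ∑ j, ((σ⁻¹ : Matrix.GeneralLinearGroup (Fin n) R) :
    Matrix (Fin n) (Fin n) R) i j • (X j : MvPolynomial (Fin n) R)) (n := 1) (fun i => by
      simpa [lf, smul_eq_C_mul] using lf_hom _)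
  simpa [glAct] using this

theorem glAct_comp (σ : Matrix.GeneralLinearGroup (Fin n) R) (f : MvPolynomial (Fin n) R) (d : ℕ) :
    homogeneousComponent d (glAct σ f) = glAct σ (homogeneousComponent d f) := by
  conv_lhs => rw [← sum_homogeneousComponent f]
  rw [map_sum, map_sum]
  by_cases hd : d ∈ Finset.range (f.totalDegree + 1)
  · rw [Finset.sum_eq_single_of_mem d hd]
    · rw [homogeneousComponent_of_mem (glAct_hom σ (homogeneousComponent_isHomogeneous d f))]
      simp
    · intro e _ he
      rw [homogeneousComponent_of_mem (glAct_hom σ (homogeneousComponent_isHomogeneous e f))]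
      simp [he.symm]
  · rw [homogeneousComponent_eq_zero d f (by simpa using hd), map_zero]
    refine Finset.sum_eq_zero fun e he => ?_
    rw [homogeneousComponent_of_mem (glAct_hom σ (homogeneousComponent_isHomogeneous e f)), if_neg]
    rintro rfl; exact hd he

theorem mem_inv {G : Subgroup (Matrix.GeneralLinearGroup (Fin n) R)}
    {f : MvPolynomial (Fin n) R} : f ∈ invariants G ↔ ∀ σ ∈ G, glAct σ f = f := by
  simp [invariants, Algebra.mem_iInf, AlgHom.mem_equalizer]

theorem comp_mem_inv {G : Subgroup (Matrix.GeneralLinearGroup (Fin n) R)}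
    {f : MvPolynomial (Fin n) R} (hf : f ∈ invariants G) (d : ℕ) :
    homogeneousComponent d f ∈ invariants G := by
  rw [mem_inv] at hf ⊢
  intro σ hσ
  rw [← glAct_comp, hf σ hσ]

/-- product of a graded component. -/
theorem comp_mul_hom {f h : MvPolynomial (Fin n) R} {d : ℕ} (hf : f.IsHomogeneous d) (e : ℕ) :
    homogeneousComponent (d + e) (f * h) = f * homogeneousComponent e h := by
  conv_lhs => rw [← sum_homogeneousComponent h]
  rw [Finset.mul_sum, map_sum]
  by_cases hd : e ∈ Finset.range (h.totalDegree + 1)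
  · rw [Finset.sum_eq_single_of_mem e hd]
    · rw [homogeneousComponent_of_mem (hf.mul (homogeneousComponent_isHomogeneous e h))]
      simp
    · intro e' _ he
      rw [homogeneousComponent_of_mem (hf.mul (homogeneousComponent_isHomogeneous e' h))]
      simp [he.symm]
  · rw [homogeneousComponent_eq_zero e h (by simpa using hd), mul_zero]
    refine Finset.sum_eq_zero fun e' he => ?_
    rw [homogeneousComponent_of_mem (hf.mul (homogeneousComponent_isHomogeneous e' h)), if_neg]
    intro h; have : e = e' := by omega
    exact hd (this ▸ he)

theorem comp_mul_hom_lt {f h : MvPolynomial (Fin n) R} {d : ℕ} (hf : f.IsHomogeneous d) {e : ℕ}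
    (he : e < d) : homogeneousComponent e (f * h) = 0 := by
  conv_lhs => rw [← sum_homogeneousComponent h]
  rw [Finset.mul_sum, map_sum]
  refine Finset.sum_eq_zero fun e' _ => ?_
  rw [homogeneousComponent_of_mem (hf.mul (homogeneousComponent_isHomogeneous e' h)), if_neg]
  omega

variable (G : Subgroup (Matrix.GeneralLinearGroup (Fin n) R))

/-- the action of the group on polynomials -/
noncomputable abbrev msa : MulSemiringAction G (MvPolynomial (Fin n) R) where
  smul σ f := glAct σ.1 f
  one_smul f := glAct_one f
  mul_smul σ τ f := glAct_mul σ.1 τ.1 f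
  smul_zero _ := map_zero _
  smul_add _ := map_add _
  smul_one _ := map_one _
  smul_mul _ := map_mul _

theorem integral_inv [Finite G] : Algebra.IsIntegral (invariants G) (MvPolynomial (Fin n) R) := by
  let := msa G
  have : Algebra.IsInvariant (invariants G) (MvPolynomial (Fin n) R) G := ⟨fun b hb =>
    ⟨⟨b, mem_inv.2 fun σ hσ => hb ⟨σ, hσ⟩⟩, rfl⟩⟩
  exact Algebra.IsInvariant.isIntegral (invariants G) (MvPolynomial (Fin n) R) G

theorem fg_inv [Finite G] [IsNoetherianRing R] : (invariants G).FG := by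
  have := integral_inv G
  have : Algebra.FiniteType (invariants G) (MvPolynomial (Fin n) R) :=
    Algebra.FiniteType.of_restrictScalars_finiteType R _ _
  have : Module.Finite (invariants G) (MvPolynomial (Fin n) R) := Algebra.IsIntegral.finite
  have := fg_of_fg_of_fg R (invariants G) (MvPolynomial (Fin n) R) Algebra.FiniteType.out
    Module.Finite.fg_top Subtype.val_injective
  exact (Subalgebra.fg_top _).1 this

theorem noeth_inv [Finite G] [IsNoetherianRing R] : IsNoetherianRing (invariants G) := by
  have : Algebra.FiniteType R (invariants G) := ⟨(Subalgebra.fg_top _).2 (fg_inv G)⟩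
  exact Algebra.FiniteType.isNoetherianRing R _

variable [Fintype G]

/-- the trace -/
noncomputable def tr : MvPolynomial (Fin n) R →ₗ[R] MvPolynomial (Fin n) R :=
  ∑ σ : G, (glAct σ.1).toLinearMap

theorem tr_apply (f : MvPolynomial (Fin n) R) : tr G f = ∑ σ : G, glAct σ.1 f := by
  simp [tr]

theorem tr_mem (f : MvPolynomial (Fin n) R) : tr G f ∈ invariants G := by
  rw [mem_inv]
  intro σ hσ
  rw [tr_apply, map_sum]
  simp_rw [← glAct_mul]
  exact Fintype.sum_equiv (Equiv.mulLeft (⟨σ, hσ⟩ : G)) _ _ fun τ => rfl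

theorem tr_mul {t : MvPolynomial (Fin n) R} (ht : t ∈ invariants G) (f : MvPolynomial (Fin n) R) :
    tr G (t * f) = t * tr G f := by
  rw [mem_inv] at ht
  simp_rw [tr_apply, map_mul, Finset.mul_sum]
  exact Finset.sum_congr rfl fun σ _ => by rw [ht σ.1 σ.2]

theorem tr_comp (f : MvPolynomial (Fin n) R) (d : ℕ) :
    homogeneousComponent d (tr G f) = tr G (homogeneousComponent d f) := by
  simp_rw [tr_apply, map_sum, glAct_comp]

theorem lf_inj {v w : Fin n → R} (h : lf v = lf w) : v = w := by
  classical
  funext k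
  have := congrArg (coeff (Finsupp.single k 1)) h
  simpa [lf, coeff_sum, coeff_C_mul, coeff_X, Finsupp.single_left_inj] using this

theorem glAct_inj {σ τ : Matrix.GeneralLinearGroup (Fin n) R} (h : glAct σ = glAct τ) : σ = τ := by
  have : (σ⁻¹ : Matrix.GeneralLinearGroup (Fin n) R) = τ⁻¹ := by
    apply Units.ext
    funext i
    apply lf_inj
    rw [← glAct_X, ← glAct_X, h]
  exact inv_injective this

theorem tr_ne [IsDomain R] : ∃ s, tr G s ≠ 0 := by
  by_contra! hcon
  have hli := linearIndependent_monoidHom (MvPolynomial (Fin n) R) (MvPolynomial (Fin n) R)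
  have hinj : Function.Injective fun σ : G =>
      ((glAct σ.1 : MvPolynomial (Fin n) R →ₐ[R] _) : MvPolynomial (Fin n) R →* MvPolynomial (Fin n) R) := by
    intro σ τ h
    apply Subtype.ext
    apply glAct_inj
    ext1 i
    exact DFunLike.congr_fun h (X i)
  have h2 := hli.comp _ hinj
  rw [Fintype.linearIndependent_iff] at h2
  have := h2 (fun _ => 1) (by
    funext s
    have := hcon s
    rw [tr_apply] at this
    simpa using this) 1
  exact one_ne_zero this

end act
end CMInv

end

section
open MvPolynomial

namespace CMInv

section thmA
variable {R : Type*} [CommRing R] {n : ℕ}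
  (G : Subgroup (Matrix.GeneralLinearGroup (Fin n) R)) [Fintype G] (l : Fin n → Fin n → R)

/-- the norm of the linear form `l i`. -/
noncomputable def nf (i : Fin n) : MvPolynomial (Fin n) R := ∏ σ : G, glAct σ.1 (lf (l i))

theorem nf_mem (i : Fin n) : nf G l i ∈ invariants G := by
  rw [mem_inv]
  intro σ hσ
  rw [nf, map_prod]
  simp_rw [← glAct_mul]
  exact Fintype.prod_equiv (Equiv.mulLeft (⟨σ, hσ⟩ : G)) _ _ fun τ => rfl

theorem nf_hom (i : Fin n) : (nf G l i).IsHomogeneous (Fintype.card G) := by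
  have := IsHomogeneous.prod (Finset.univ : Finset G) (fun σ => glAct σ.1 (lf (l i))) (fun _ => 1)
    (fun σ _ => glAct_hom σ.1 (lf_hom (l i)))
  simpa [nf] using this

/-- all dets are outside `p` -/
def Gen (p : Ideal R) : Prop := ∀ s : Fin n → G, (Matrix.of fun i => Matrix.vecMul (l i)
  (((s i).1⁻¹ : Matrix.GeneralLinearGroup (Fin n) R) : Matrix (Fin n) (Fin n) R)).det ∉ p

variable (p : Ideal R) [hp : p.IsPrime]

theorem step1 (hl : Gen G l p) (N d : ℕ) (hd : n * ((N + 1) * Fintype.card G) < d + n)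
    {h : MvPolynomial (Fin n) R} (hh : h.IsHomogeneous d) :
    h ∈ sat p (Ideal.span (Set.range fun i => nf G l i ^ (N + 1))) := by
  classical
  let L0 : Fin n → List (Fin n → R) := fun i => (Finset.univ : Finset G).toList.map
    fun σ => Matrix.vecMul (l i)
      ((σ.1⁻¹ : Matrix.GeneralLinearGroup (Fin n) R) : Matrix (Fin n) (Fin n) R)
  let L : Fin n → List (Fin n → R) := fun i => (List.replicate (N + 1) (L0 i)).flatten
  have h0 : ∀ i, ((L0 i).map lf).prod = nf G l i := by
    intro i
    simp only [L0, List.map_map, nf]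
    rw [← Finset.prod_map_toList]
    congr 1
    apply List.map_congr_left
    intro σ _
    simp [glAct_lf]
  have h1 : ∀ i, ((L i).map lf).prod = nf G l i ^ (N + 1) := by
    intro i
    simp only [L, List.map_flatten, List.prod_flatten, List.map_replicate, List.prod_replicate, h0]
  have := lin p d L (by
    intro c hc
    have : ∀ i, ∃ σ : G, Matrix.vecMul (l i)
      ((σ.1⁻¹ : Matrix.GeneralLinearGroup (Fin n) R) : Matrix (Fin n) (Fin n) R) = c i := by
      intro i
      have := hc i
      simp only [L, List.mem_flatten, List.mem_replicate] at this
      obtain ⟨a, ⟨_, rfl⟩, h2⟩ := this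
      simp only [L0, List.mem_map] at h2
      obtain ⟨σ, _, h2⟩ := h2
      exact ⟨σ, h2⟩
    choose s hs using this
    have := hl s
    simp_rw [hs] at this
    exact this) (by simpa [L, L0] using hd) h hh
  simpa only [h1] using this

theorem comp_sum (f : Fin n → MvPolynomial (Fin n) R) (g : ℕ) (hf : ∀ i, (f i).IsHomogeneous g)
    (c : Fin n → MvPolynomial (Fin n) R) (d : ℕ) :
    homogeneousComponent d (∑ i, c i * f i) =
      ∑ i, (if g ≤ d then homogeneousComponent (d - g) (c i) else 0) * f i := by
  rw [map_sum]
  refine Finset.sum_congr rfl fun i _ => ?_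
  split_ifs with h
  · rw [mul_comm, mul_comm _ (f i), ← comp_mul_hom (hf i)]
    congr 2; omega
  · rw [mul_comm, comp_mul_hom_lt (hf i) (by omega), zero_mul]

theorem comp_self {h : MvPolynomial (Fin n) R} {d : ℕ} (hh : h.IsHomogeneous d) :
    homogeneousComponent d h = h := by
  rw [homogeneousComponent_of_mem hh]; simp

theorem hom_C_mul {h : MvPolynomial (Fin n) R} {d : ℕ} (w : R) (hh : h.IsHomogeneous d) :
    (C w * h).IsHomogeneous d := by
  simpa using (isHomogeneous_C (Fin n) w).mul hh

/-- saturation of a module over a subalgebra -/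
noncomputable def satM {A : Subalgebra R (MvPolynomial (Fin n) R)}
    (I : Submodule A (MvPolynomial (Fin n) R)) : Submodule A (MvPolynomial (Fin n) R) where
  carrier := {h | ∃ w, w ∉ p ∧ C w * h ∈ I}
  add_mem' := by
    rintro a b ⟨w, hw, ha⟩ ⟨w', hw', hb⟩
    refine ⟨w * w', fun h => (hp.mem_or_mem h).elim hw hw', ?_⟩
    have := I.add_mem (I.smul_mem (algebraMap R A w') ha) (I.smul_mem (algebraMap R A w) hb)
    convert this using 1
    simp only [Algebra.smul_def, C_mul, ← IsScalarTower.algebraMap_apply, algebraMap_eq]; ring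
  zero_mem' := ⟨1, fun h => hp.ne_top ((Ideal.eq_top_iff_one _).2 h), by simp⟩
  smul_mem' := by
    rintro c a ⟨w, hw, ha⟩
    refine ⟨w, hw, ?_⟩
    rw [mul_smul_comm]
    exact I.smul_mem _ ha

/-- the finite set of small monomials -/
def W (R : Type*) [CommRing R] (n : ℕ) (D : ℕ) : Set (MvPolynomial (Fin n) R) :=
  (fun m : Fin n →₀ ℕ => monomial m (1 : R)) ''
    Set.Iic (Finsupp.equivFunOnFinite.symm fun _ : Fin n => D)

theorem W_fin (D : ℕ) : (W R n D).Finite := (Set.finite_Iic _).image _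

theorem hom_mem_W (D : ℕ) (A : Subalgebra R (MvPolynomial (Fin n) R)) {d : ℕ} (hd : d ≤ D)
    {h : MvPolynomial (Fin n) R} (hh : h.IsHomogeneous d) :
    h ∈ Submodule.span A (W R n D) := by
  rw [h.as_sum]
  refine Submodule.sum_mem _ fun m hm => ?_
  have hm' : m.degree = d := by
    have := hh (mem_support_iff.1 hm)
    rw [Finsupp.degree_eq_weight_one]; exact this
  have : monomial m (coeff m h) = (algebraMap R A (coeff m h)) • monomial m (1 : R) := by
    rw [Algebra.smul_def, ← IsScalarTower.algebraMap_apply, algebraMap_eq, C_mul_monomial, mul_one]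
  rw [this]
  refine Submodule.smul_mem _ _ (Submodule.subset_span ⟨m, ?_, rfl⟩)
  intro i
  have := Finsupp.le_degree i m
  simp
  omega

theorem step2 (hl : Gen G l p) (d : ℕ) : ∀ {h : MvPolynomial (Fin n) R}, h.IsHomogeneous d →
    h ∈ satM p (Submodule.span (Algebra.adjoin R (Set.range (nf G l)))
      (W R n (n * (Fintype.card G - 1)))) := by
  have hg : 1 ≤ Fintype.card G := Fintype.card_pos
  have hone : (1 : R) ∉ p := fun h => hp.ne_top ((Ideal.eq_top_iff_one _).2 h)
  induction d using Nat.strong_induction_on with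
  | _ d ih =>
    intro h hh
    by_cases hd : d ≤ n * (Fintype.card G - 1)
    · exact ⟨1, hone, by rw [C_1, one_mul]; exact hom_mem_W _ _ hd hh⟩
    · obtain ⟨w, hw, hmem⟩ := step1 G l p hl 0 d (by
        rw [Nat.mul_sub_one] at hd
        have : n ≤ n * Fintype.card G := Nat.le_mul_of_pos_right n hg
        simp; omega) hh
      simp only [zero_add, pow_one] at hmem
      obtain ⟨c, hc⟩ := Ideal.mem_span_range_iff_exists_fun.1 hmem
      have h2 := comp_sum (nf G l) _ (nf_hom G l) c d
      rw [hc, comp_self (hom_C_mul w hh)] at h2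
      have h3 : C w * h ∈ satM p (Submodule.span (Algebra.adjoin R (Set.range (nf G l)))
          (W R n (n * (Fintype.card G - 1)))) := by
        rw [h2]
        refine Submodule.sum_mem _ fun i _ => ?_
        split_ifs with hgd
        · have := ih (d - Fintype.card G) (by omega)
            (homogeneousComponent_isHomogeneous (d - Fintype.card G) (c i))
          have h4 := Submodule.smul_mem _ (⟨nf G l i, Algebra.subset_adjoin ⟨i, rfl⟩⟩ :
            Algebra.adjoin R (Set.range (nf G l))) this
          rw [mul_comm (homogeneousComponent _ _)]
          exact h4
        · rw [zero_mul]; exact Submodule.zero_mem _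
      obtain ⟨w', hw', h4⟩ := h3
      exact ⟨w' * w, fun h => (hp.mem_or_mem h).elim hw' hw, by rwa [C_mul, mul_assoc]⟩

theorem step2' (hl : Gen G l p) (h : MvPolynomial (Fin n) R) :
    h ∈ satM p (Submodule.span (Algebra.adjoin R (Set.range (nf G l)))
      (W R n (n * (Fintype.card G - 1)))) := by
  rw [← sum_homogeneousComponent h]
  exact Submodule.sum_mem _ fun i _ => step2 G l p hl i (homogeneousComponent_isHomogeneous i h)

theorem step2b [IsDomain R] (hl : Gen G l p) : ∃ (P : MvPolynomial (Fin n) R) (s : MvPolynomial (Fin n) R),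
    P ≠ 0 ∧ aeval (nf G l) P = tr G s := by
  obtain ⟨s0, hs0⟩ := tr_ne G
  set c := tr G s0 with hc
  set M := Submodule.span (Algebra.adjoin R (Set.range (nf G l)))
      (W R n (n * (Fintype.card G - 1))) with hM
  have hw0 : ∃ w, w ∉ p ∧ ∀ v ∈ W R n (n * (Fintype.card G - 1)), C w * (c * v) ∈ M := by
    have hfin := W_fin (R := R) (n := n) (n * (Fintype.card G - 1))
    generalize W R n (n * (Fintype.card G - 1)) = W0 at hfin
    induction W0, hfin using Set.Finite.induction_on with
    | empty => exact ⟨1, fun h => hp.ne_top ((Ideal.eq_top_iff_one _).2 h), by simp⟩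
    | insert _ _ ih =>
      rename_i a s ha hs
      obtain ⟨w, hw, h⟩ := ih
      obtain ⟨w', hw', h'⟩ := step2' G l p hl (c * a)
      refine ⟨w * w', fun h => (hp.mem_or_mem h).elim hw hw', ?_⟩
      have key : ∀ (r : R) x, x ∈ M → C r * x ∈ M := by
        intro r x hx
        have := M.smul_mem (algebraMap R _ r) hx
        rwa [Algebra.smul_def, ← IsScalarTower.algebraMap_apply, algebraMap_eq] at this
      rintro v (rfl | hv)
      · rw [C_mul, mul_assoc]; exact key _ _ h'
      · rw [mul_comm w, C_mul, mul_assoc]; exact key _ _ (h v hv)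
  obtain ⟨w, hw, hwM⟩ := hw0
  have hwne : w ≠ 0 := fun h => hw (h ▸ p.zero_mem)
  have hne : C w * c ≠ 0 := mul_ne_zero (by simpa using hwne) hs0
  have hIntg : IsIntegral (Algebra.adjoin R (Set.range (nf G l))) (C w * c) := by
    refine isIntegral_of_smul_mem_submodule M ?_ (Submodule.fg_span (W_fin _)) _ ?_
    · intro h0
      have : (1 : MvPolynomial (Fin n) R) ∈ M :=
        hom_mem_W _ _ (Nat.zero_le _) (isHomogeneous_one _ _)
      rw [h0, Submodule.mem_bot] at this
      exact one_ne_zero this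
    · intro x hx
      induction hx using Submodule.span_induction with
      | mem x hx => rw [smul_eq_mul, mul_assoc]; exact hwM x hx
      | zero => simp
      | add x y _ _ hx hy => rw [smul_add]; exact M.add_mem hx hy
      | smul a x _ hx => rw [smul_comm]; exact M.smul_mem _ hx
  obtain ⟨a, ha0, c', ha⟩ := hIntg.isAlgebraic.exists_nonzero_dvd (mem_nonZeroDivisors_of_ne_zero hne)
  have haA : (a : MvPolynomial (Fin n) R) ∈ (aeval (R := R) (nf G l)).range :=
    (Algebra.adjoin_range_eq_range_aeval R (nf G l)).le a.2
  obtain ⟨P, hP⟩ := haA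
  have ha' : (a : MvPolynomial (Fin n) R) = C w * c * c' := ha
  have hAT : (a : MvPolynomial (Fin n) R) ∈ invariants G :=
    (Algebra.adjoin_le (S := invariants G) (by rintro _ ⟨i, rfl⟩; exact nf_mem G l i)) a.2
  have hcw : C w * c ∈ invariants G := Subalgebra.mul_mem _
    (Subalgebra.algebraMap_mem (invariants G) w) (tr_mem G s0)
  have hcT : c' ∈ invariants G := by
    rw [mem_inv] at hAT hcw ⊢
    intro σ hσ
    have := hAT σ hσ
    rw [ha', map_mul, hcw σ hσ] at this
    exact mul_left_cancel₀ hne this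
  refine ⟨P, C w * c' * s0, ?_, ?_⟩
  · rintro rfl
    apply ha0
    apply Subtype.ext
    rw [← hP]; simp
  · have hwc : C w * c' ∈ invariants G :=
      Subalgebra.mul_mem _ (Subalgebra.algebraMap_mem (invariants G) w) hcT
    rw [tr_mul G hwc, ← hc]
    refine hP.trans ?_
    rw [ha']; ring

/-- the `T`-span of the powers -/
noncomputable def IM (k : ℕ) : Submodule (invariants G) (MvPolynomial (Fin n) R) :=
  Submodule.span (invariants G) (Set.range fun i => nf G l i ^ k)

theorem mem_IM {k : ℕ} {x : MvPolynomial (Fin n) R} : x ∈ IM G l k ↔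
    ∃ c : Fin n → invariants G, ∑ i, (c i : MvPolynomial (Fin n) R) * nf G l i ^ k = x := by
  rw [IM, Submodule.mem_span_range_iff_exists_fun]; rfl

theorem IM_mul {k : ℕ} {x t : MvPolynomial (Fin n) R} (ht : t ∈ invariants G) (hx : x ∈ IM G l k) :
    t * x ∈ IM G l k := (IM G l k).smul_mem ⟨t, ht⟩ hx

theorem IM_comp {k : ℕ} {x : MvPolynomial (Fin n) R} (hx : x ∈ IM G l k) (d : ℕ) :
    homogeneousComponent d x ∈ IM G l k := by
  obtain ⟨c, rfl⟩ := (mem_IM G l).1 hx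
  rw [comp_sum (fun i => nf G l i ^ k) (Fintype.card G * k) (fun i => (nf_hom G l i).pow k)]
  refine Submodule.sum_mem _ fun i _ => ?_
  refine IM_mul G l ?_ (Submodule.subset_span ⟨i, rfl⟩)
  split_ifs
  · exact comp_mem_inv (c i).2 _
  · exact Subalgebra.zero_mem _

theorem tr_IM {k : ℕ} {x : MvPolynomial (Fin n) R}
    (hx : x ∈ Ideal.span (Set.range fun i => nf G l i ^ k)) : tr G x ∈ IM G l k := by
  obtain ⟨c, rfl⟩ := Ideal.mem_span_range_iff_exists_fun.1 hx
  rw [map_sum]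
  refine Submodule.sum_mem _ fun i _ => ?_
  rw [mul_comm, tr_mul G (Subalgebra.pow_mem _ (nf_mem G l i) k), mul_comm]
  exact IM_mul G l (tr_mem G _) (Submodule.subset_span ⟨i, rfl⟩)

theorem step3 [IsDomain R] (hl : Gen G l p) : ∃ (N : ℕ) (b : R) (s : MvPolynomial (Fin n) R),
    b ≠ 0 ∧ s.IsHomogeneous (n * N * Fintype.card G) ∧
    C b * ∏ i, nf G l i ^ N - tr G s ∈ IM G l (N + 1) := by
  obtain ⟨P, s, hP0, hP⟩ := step2b G l p hl
  obtain ⟨α, hα, hmin⟩ := Finset.exists_min_image P.support (fun α => α.degree)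
    (by simpa [Finset.nonempty_iff_ne_empty] using hP0)
  set N := α.degree with hN
  have hle : ∀ i, α i ≤ N := fun i => Finsupp.le_degree i α
  set e := ∏ i, nf G l i ^ (N - α i)
  have hT : ∀ k : Fin n → ℕ, ∏ i, nf G l i ^ k i ∈ invariants G := fun k =>
    Subalgebra.prod_mem _ fun i _ => Subalgebra.pow_mem _ (nf_mem G l i) _
  have h1 : C (coeff α P) * ∏ i, nf G l i ^ N - tr G (e * s) ∈ IM G l (N + 1) := by
    rw [tr_mul G (hT _), ← hP, aeval_def, eval₂_eq', ← Finset.add_sum_erase _ _ hα, mul_add]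
    have : e * ((algebraMap R (MvPolynomial (Fin n) R)) (coeff α P) * ∏ i, nf G l i ^ α i) =
        C (coeff α P) * ∏ i, nf G l i ^ N := by
      rw [algebraMap_eq, mul_left_comm, ← Finset.prod_mul_distrib]
      congr 1
      refine Finset.prod_congr rfl fun i _ => ?_
      rw [← pow_add, Nat.sub_add_cancel (hle i)]
    rw [this, sub_add_cancel_left, Finset.mul_sum]
    refine Submodule.neg_mem _ (Submodule.sum_mem _ fun β hβ => ?_)
    have hβα : β ≠ α := Finset.ne_of_mem_erase hβ
    have hdeg := hmin β (Finset.mem_of_mem_erase hβ)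
    have : ∃ i, α i < β i := by
      by_contra! hcon
      have hba : β ≤ α := hcon
      obtain ⟨γ, rfl⟩ := exists_add_of_le hba
      rw [hN, map_add] at hdeg
      have : γ.degree = 0 := by omega
      rw [Finsupp.degree_eq_zero_iff] at this
      exact hβα (by simp [this])
    obtain ⟨i, hi⟩ := this
    rw [mul_left_comm, ← Finset.prod_mul_distrib, algebraMap_eq]
    refine IM_mul G l (Subalgebra.algebraMap_mem (invariants G) _) ?_
    simp_rw [← pow_add]
    rw [← Finset.prod_erase_mul _ _ (Finset.mem_univ i)]
    have h5 : N - α i + β i = (N - α i + β i - (N + 1)) + (N + 1) := by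
      have := hle i
      omega
    rw [h5, pow_add, ← mul_assoc]
    refine IM_mul G l (Subalgebra.mul_mem _ (Subalgebra.prod_mem _ fun i _ =>
      Subalgebra.pow_mem _ (nf_mem G l i) _) (Subalgebra.pow_mem _ (nf_mem G l i) _))
      (Submodule.subset_span ⟨i, rfl⟩)
  refine ⟨N, coeff α P, homogeneousComponent (n * N * Fintype.card G) (e * s),
    mem_support_iff.1 hα, homogeneousComponent_isHomogeneous _ _, ?_⟩
  have h2 := IM_comp G l h1 (n * N * Fintype.card G)
  rw [map_sub, tr_comp, comp_self] at h2
  · exact h2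
  · apply hom_C_mul
    have := IsHomogeneous.prod (Finset.univ : Finset (Fin n)) (fun i => nf G l i ^ N)
      (fun _ => Fintype.card G * N) (fun i _ => (nf_hom G l i).pow N)
    convert this using 1
    simp; ring

theorem step4 [IsDomain R] (hl : Gen G l p) : ∃ N : ℕ, ∀ (d : ℕ) (u : MvPolynomial (Fin n) R),
    u ∈ invariants G → u.IsHomogeneous d → n * (Fintype.card G - 1) < d →
    ∃ b : R, b ≠ 0 ∧ (∏ i, nf G l i ^ N) * (C b * u) ∈ IM G l (N + 1) := by
  obtain ⟨N, b, s, hb, hs, h⟩ := step3 G l p hl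
  have hg : 1 ≤ Fintype.card G := Fintype.card_pos
  refine ⟨N, fun d u hu hud hd => ?_⟩
  obtain ⟨w, hw, hmem⟩ := step1 G l p hl N _ (by
    rw [Nat.mul_sub_one] at hd
    have : n ≤ n * Fintype.card G := Nat.le_mul_of_pos_right n hg
    have e : n * ((N + 1) * Fintype.card G) = n * N * Fintype.card G + n * Fintype.card G := by ring
    rw [e]
    have : n * Fintype.card G < d + n := by omega
    omega : n * ((N + 1) * Fintype.card G) < (n * N * Fintype.card G + d) + n) (hs.mul hud)
  have hCw : C w ∈ invariants G := Subalgebra.algebraMap_mem (invariants G) w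
  have h1 := tr_IM G l hmem
  have e1 : C w * (s * u) = (C w * u) * s := by ring
  rw [e1, tr_mul G (Subalgebra.mul_mem _ hCw hu)] at h1
  have h2 := IM_mul G l (Subalgebra.mul_mem _ hCw hu) h
  refine ⟨w * b, mul_ne_zero (fun h => hw (h ▸ p.zero_mem)) hb, ?_⟩
  convert (IM G l (N + 1)).add_mem h1 h2 using 1
  rw [C_mul]; ring

end thmA
end CMInv

end

section
open MvPolynomial

namespace CMInv

theorem zs_exists {R : Type*} [CommRing R] [IsDomain R] [IsNoetherianRing R] (p : Ideal R)
    [hp : p.IsPrime] (k : ℕ) (hk : p.height ≤ k) (b : R) (hb : b ≠ 0) :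
    ∃ zs : List R, zs.length ≤ k ∧ (∀ z ∈ zs, z ∈ p) ∧
      (∀ q : Ideal R, q.IsPrime → q ≤ p → (∀ z ∈ zs, z ∈ q) → q = p) ∧
      (b ∉ p ∨ ∃ zs', zs = b :: zs') := by
  by_cases hbp : b ∈ p
  · let A := R ⧸ Ideal.span {b}
    let π : R →+* A := Ideal.Quotient.mk _
    have hπ : Function.Surjective π := Ideal.Quotient.mk_surjective
    have hker : RingHom.ker π = Ideal.span {b} := Ideal.mk_ker
    have hkp : RingHom.ker π ≤ p := by
      rw [hker, Ideal.span_singleton_le_iff_mem]; exact hbp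
    have hpp : (p.map π).IsPrime := Ideal.map_isPrime_of_surjective hπ hkp
    have hcm : (p.map π).comap π = p := by
      rw [Ideal.comap_map_of_surjective' π hπ, sup_eq_left.2 hkp]
    have hht : (p.map π).height + 1 ≤ p.height := by
      have := Ideal.finiteHeight_of_isNoetherianRing (p.map π)
      obtain ⟨s, hs1, hs2⟩ := (p.map π).exists_ltSeries_length_eq_height
      let F : PrimeSpectrum A → PrimeSpectrum R := PrimeSpectrum.comap π
      have hF : StrictMono F := by
        intro x y hxy
        refine lt_of_le_of_ne (Ideal.comap_mono hxy.le) ?_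
        intro h
        exact hxy.ne (PrimeSpectrum.comap_injective_of_surjective π hπ h)
      have hlt : (⟨⊥, Ideal.isPrime_bot⟩ : PrimeSpectrum R) < (s.map F hF).head := by
        rw [LTSeries.head_map]
        change (⊥ : Ideal R) < (F s.head).asIdeal
        rw [bot_lt_iff_ne_bot]
        intro h0
        have : b ∈ (F s.head).asIdeal := by
          change π b ∈ s.head.asIdeal
          have hb0 : π b = 0 := Ideal.Quotient.eq_zero_iff_mem.2 (Ideal.mem_span_singleton_self b)
          rw [hb0]; exact Ideal.zero_mem _
        rw [h0] at this
        exact hb this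
      let s' := (s.map F hF).cons ⟨⊥, Ideal.isPrime_bot⟩ hlt
      have h1 := Order.length_le_height_last (p := s')
      have h2 : s'.last = ⟨p, hp⟩ := by
        rw [RelSeries.last_cons, LTSeries.last_map, hs1]
        exact PrimeSpectrum.ext hcm
      rw [h2, ← PrimeSpectrum.height_eq_orderHeight] at h1
      have h3 : s'.length = s.length + 1 := by simp [s']
      rw [h3, Nat.cast_add, hs2] at h1
      exact_mod_cast h1
    obtain ⟨s, hs1, hs2⟩ := (p.map π).exists_finset_card_eq_height_of_isNoetherianRing
    let g := Function.surjInv hπ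
    refine ⟨b :: s.toList.map g, ?_, ?_, ?_, Or.inr ⟨_, rfl⟩⟩
    · have := hht.trans hk
      rw [← hs2] at this
      simp only [List.length_cons, List.length_map, Finset.length_toList]
      exact_mod_cast this
    · intro z hz
      rcases List.mem_cons.1 hz with rfl | hz
      · exact hbp
      · obtain ⟨y, hy, rfl⟩ := List.mem_map.1 hz
        rw [← hcm, Ideal.mem_comap, Function.surjInv_eq hπ]
        exact hs1.1.2 (Ideal.subset_span (by simpa using hy))
    · intro q hq hqp hz
      have hkq : RingHom.ker π ≤ q := by
        rw [hker, Ideal.span_singleton_le_iff_mem]; exact hz b (by simp)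
      have hqp' : (q.map π).IsPrime := Ideal.map_isPrime_of_surjective hπ hkq
      have hcq : (q.map π).comap π = q := by
        rw [Ideal.comap_map_of_surjective' π hπ, sup_eq_left.2 hkq]
      have : p.map π ≤ q.map π := hs1.2 ⟨hqp', by
        rw [Ideal.span_le]
        intro y hy
        have := Ideal.mem_map_of_mem π (hz (g y) (List.mem_cons_of_mem _
          (List.mem_map.2 ⟨y, by simpa using hy, rfl⟩)))
        rwa [Function.surjInv_eq hπ] at this⟩ (Ideal.map_mono hqp)
      apply le_antisymm hqp
      rw [← hcm, ← hcq]
      exact Ideal.comap_mono this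
  · obtain ⟨s, hs1, hs2⟩ := p.exists_finset_card_eq_height_of_isNoetherianRing
    refine ⟨s.toList, ?_, ?_, ?_, Or.inl hbp⟩
    · rw [← hs2] at hk
      simpa using hk
    · intro z hz
      exact hs1.1.2 (Ideal.subset_span (by simpa using hz))
    · intro q hq hqp hz
      exact le_antisymm hqp (hs1.2 ⟨hq, by
        rw [Ideal.span_le]; intro y hy; exact hz y (by simpa using hy)⟩ hqp)

section thmA
variable {R : Type*} [CommRing R] {n : ℕ}
  (G : Subgroup (Matrix.GeneralLinearGroup (Fin n) R)) (p : Ideal R) [hp : p.IsPrime]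

/-- the constant coefficient on invariants -/
noncomputable def cc : invariants G →+* R := constantCoeff.comp (invariants G).val.toRingHom

/-- the prime of the invariant ring over `p`, containing all positive degree elements -/
noncomputable def QQ : Ideal (invariants G) := p.comap (cc G)

instance : (QQ G p).IsPrime := by unfold QQ; infer_instance

variable [Fintype G] (l : Fin n → Fin n → R)

theorem thmA [IsDomain R] [IsNoetherianRing R] (hl : Gen G l p) (k : ℕ) (hk : p.height ≤ k)
    (hD : DD (B := Localization.AtPrime (QQ G p)) (k + n) ⊥) {d : ℕ}
    {u : MvPolynomial (Fin n) R} (hu : u ∈ invariants G) (hud : u.IsHomogeneous d)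
    (hd : n * (Fintype.card G - 1) < d) :
    ∃ w, w ∉ p ∧ ∃ h : Fin n → MvPolynomial (Fin n) R, (∀ i, h i ∈ invariants G ∧
      (h i).IsHomogeneous (d - Fintype.card G)) ∧ C w * u = ∑ i, h i * nf G l i := by
  have hnT := noeth_inv G
  have hIntg := integral_inv G
  obtain ⟨N, hN⟩ := step4 G l p hl
  obtain ⟨b, hb, hbmem⟩ := hN d u hu hud hd
  obtain ⟨zs, hzk, hzp, hzmin, hzb⟩ := zs_exists p k hk b hb
  have hg : 1 ≤ Fintype.card G := Fintype.card_pos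
  set Q := QQ G p with hQ
  let B := Localization.AtPrime Q
  let φ : invariants G →+* B := algebraMap (invariants G) B
  have hmax : ∀ x, φ x ∈ IsLocalRing.maximalIdeal B ↔ x ∈ Q :=
    fun x => IsLocalization.AtPrime.to_map_mem_maximal_iff B Q x
  have hccC : ∀ r, cc G (algebraMap R _ r) = r := fun r => by
    change constantCoeff (algebraMap R (MvPolynomial (Fin n) R) r) = r
    simp [algebraMap_eq]
  have hQR : ∀ r, algebraMap R (invariants G) r ∈ Q ↔ r ∈ p := fun r => by
    rw [hQ, QQ, Ideal.mem_comap, hccC]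
  let fT : Fin n → invariants G := fun i => ⟨nf G l i, nf_mem G l i⟩
  have hfQ : ∀ i, fT i ∈ Q := by
    intro i
    have : cc G (fT i) = 0 := by
      change constantCoeff (nf G l i) = 0
      rw [constantCoeff_eq]
      exact (nf_hom G l i).coeff_eq_zero (by simp; omega)
    rw [hQ, QQ, Ideal.mem_comap, this]; exact p.zero_mem
  have key : φ ⟨u, hu⟩ ∈ Ideal.span (Set.range fun i => φ (fT i)) := by
    refine main_local (fun i => φ (fT i)) (zs.map fun z => φ (algebraMap R _ z)) ?_ ?_ ?_ ?_
      (φ (algebraMap R _ b)) ?_ N _ ?_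
    · intro i; rw [hmax]; exact hfQ i
    · intro z hz
      obtain ⟨y, hy, rfl⟩ := List.mem_map.1 hz
      rw [hmax, hQR]; exact hzp y hy
    · exact DD.mono (by simp; omega) hD
    · intro P hP hf hz
      let P0 := P.comap φ
      have hP0 : P0.IsPrime := inferInstanceAs (P.comap φ).IsPrime
      have hP0Q : P0 ≤ Q := by
        intro x hx
        rw [← hmax]
        exact IsLocalRing.le_maximalIdeal hP.ne_top hx
      have hP0R : P0.comap (algebraMap R (invariants G)) = p := by
        refine hzmin _ inferInstance ?_ ?_
        · intro r hr
          rw [← hQR]; exact hP0Q hr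
        · intro z hzz
          exact hz _ (List.mem_map.2 ⟨z, hzz, rfl⟩)
      obtain ⟨P', hP'1, hP'⟩ := Ideal.exists_ideal_over_prime_of_isIntegral_of_isDomain
        (S := MvPolynomial (Fin n) R) P0 (by
          rw [(RingHom.injective_iff_ker_eq_bot _).1 Subtype.val_injective]; exact bot_le)
      have hP'0 : ∀ t : invariants G, (t : MvPolynomial (Fin n) R) ∈ P' ↔ t ∈ P0 := by
        intro t
        rw [← hP']; rfl
      have hP'C : ∀ r, C r ∈ P' ↔ r ∈ p := by
        intro r
        rw [← hP0R, Ideal.mem_comap, ← hP'0]; rfl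
      have hX : ∀ j, X j ∈ P' := by
        intro j
        obtain ⟨w, hw, hm⟩ := step1 G l p hl 0 (n * Fintype.card G + 1) (by simp; omega)
          ((isHomogeneous_X R j).pow (n * Fintype.card G + 1) |> fun h => by simpa using h)
        have hle : Ideal.span (Set.range fun i => nf G l i ^ (0 + 1)) ≤ P' := by
          rw [Ideal.span_le]
          rintro _ ⟨i, rfl⟩
          simp only [zero_add, pow_one]
          exact (hP'0 (fT i)).2 (hf i)
        rcases hP'1.mem_or_mem (hle hm) with h | h
        · exact absurd ((hP'C w).1 h) hw
        · exact hP'1.mem_of_pow_mem _ h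
      have hQP : Q ≤ P0 := by
        intro q hq
        rw [← hP'0, ← Ideal.Quotient.eq_zero_iff_mem]
        have e : (Ideal.Quotient.mk P') = ((Ideal.Quotient.mk P').comp C).comp
            (constantCoeff : MvPolynomial (Fin n) R →+* R) := by
          apply MvPolynomial.ringHom_ext
          · intro r; simp
          · intro j
            simpa using Ideal.Quotient.eq_zero_iff_mem.2 (hX j)
        rw [e, RingHom.comp_apply, RingHom.comp_apply, Ideal.Quotient.eq_zero_iff_mem, hP'C]
        exact hq
      have e0 : P0 = Q := le_antisymm hP0Q hQP
      apply le_antisymm (IsLocalRing.le_maximalIdeal hP.ne_top)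
      rw [← IsLocalization.map_under Q.primeCompl B (IsLocalRing.maximalIdeal B), Ideal.map_le_iff_le_comap]
      intro x hx
      exact hQP ((hmax x).1 hx)
    · rcases hzb with h | ⟨zs', h⟩
      · left
        exact IsLocalization.map_units B (⟨algebraMap R _ b, fun h' => h ((hQR b).1 h')⟩ : Q.primeCompl)
      · right
        exact ⟨_, by rw [h, List.map_cons]⟩
    · obtain ⟨c, hc⟩ := (mem_IM G l).1 hbmem
      rw [Ideal.mem_span_range_iff_exists_fun]
      refine ⟨fun i => φ (c i), ?_⟩
      have : ∑ i, c i * fT i ^ (N + 1) = (∏ i, fT i ^ N) * (algebraMap R _ b * ⟨u, hu⟩) := by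
        apply Subtype.ext
        simpa [fT] using hc
      have := congrArg φ this
      simpa only [map_sum, map_mul, map_pow, map_prod] using this
  have e1 : Ideal.span (Set.range fun i => φ (fT i)) = (Ideal.span (Set.range fT)).map φ := by
    rw [Ideal.map_span, ← Set.range_comp]; rfl
  rw [e1, IsLocalization.algebraMap_mem_map_algebraMap_iff Q.primeCompl] at key
  obtain ⟨q, hq, hqu⟩ := key
  obtain ⟨c, hc⟩ := Ideal.mem_span_range_iff_exists_fun.1 hqu
  have hc' := congrArg Subtype.val hc
  have hc2 : ∑ i, (c i : MvPolynomial (Fin n) R) * nf G l i = q * u := by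
    simpa [fT] using hc'
  have h2 := comp_sum (nf G l) _ (nf_hom G l) (fun i => (c i : MvPolynomial (Fin n) R)) d
  rw [hc2, mul_comm] at h2
  have h3 := comp_mul_hom (h := (q : MvPolynomial (Fin n) R)) hud 0
  rw [add_zero, h2, homogeneousComponent_zero] at h3
  refine ⟨cc G q, hq, fun i => if Fintype.card G ≤ d then
    homogeneousComponent (d - Fintype.card G) (c i : MvPolynomial (Fin n) R) else 0, ?_, ?_⟩
  · intro i
    dsimp only
    split_ifs
    · exact ⟨comp_mem_inv (c i).2 _, homogeneousComponent_isHomogeneous _ _⟩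
    · exact ⟨Subalgebra.zero_mem _, isHomogeneous_zero _ _ _⟩
  · rw [h3, mul_comm]; rfl

end thmA
end CMInv

end

section
open MvPolynomial

namespace CMInv

section hts
variable {R : Type*} [CommRing R]

theorem primeC {τ : Type*} (m : Ideal R) [m.IsPrime] :
    (m.map (C : R →+* MvPolynomial τ R)).IsPrime := by
  have e : m.map (C : R →+* MvPolynomial τ R) =
      RingHom.ker (MvPolynomial.map (σ := τ) (Ideal.Quotient.mk m)) := by
    rw [MvPolynomial.ker_map, Ideal.mk_ker]
  rw [e]
  exact RingHom.ker_isPrime _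

theorem ht_mapC {τ : Type*} [Finite τ] [IsNoetherianRing R] (m : Ideal R) [hm : m.IsPrime] :
    (m.map (C : R →+* MvPolynomial τ R)).height = m.height := by
  have h1 := primeC (τ := τ) m
  have h2 : (m.map (C : R →+* MvPolynomial τ R)).LiesOver m := ⟨by
    ext x
    rw [Ideal.under_def, Ideal.mem_comap, algebraMap_eq, mem_map_C_iff]
    constructor
    · intro h d
      classical
      rw [coeff_C]; split_ifs; exacts [h, m.zero_mem]
    · intro h
      simpa using h 0⟩
  have := Ideal.height_eq_height_add_of_liesOver_of_hasGoingDown m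
    (m.map (C : R →+* MvPolynomial τ R))
  rw [this]
  have e : (m.map (C : R →+* MvPolynomial τ R)).map
      (Ideal.Quotient.mk (m.map (algebraMap R (MvPolynomial τ R)))) = ⊥ := by
    rw [algebraMap_eq, Ideal.map_quotient_self]
  have : Nontrivial (MvPolynomial τ R ⧸ m.map (algebraMap R (MvPolynomial τ R))) := by
    rw [algebraMap_eq]; exact Ideal.Quotient.nontrivial_iff.2 h1.ne_top
  rw [e, Ideal.height_bot, add_zero]

variable {n : ℕ} 

/-- kill the first `j` variables -/
noncomputable def ev (R : Type*) [CommRing R] (n j : ℕ) :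
    MvPolynomial (Fin n) R →ₐ[R] MvPolynomial (Fin n) R :=
  aeval fun i => if i.1 < j then 0 else X i

theorem chain_ht [IsNoetherianRing R] (m : Ideal R) [hm : m.IsPrime] (j : ℕ) (hj : j ≤ n) :
    m.height + j ≤ ((m.map (C : R →+* MvPolynomial (Fin n) R)).comap (ev R n j)).height := by
  have h1 := primeC (τ := Fin n) m
  induction j with
  | zero =>
    have : ((m.map (C : R →+* MvPolynomial (Fin n) R)).comap (ev R n 0)) = m.map C := by
      have : ev R n 0 = AlgHom.id R _ := by
        ext1 i; simp [ev]
      rw [this]; rfl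
    rw [this, ht_mapC]; simp
  | succ j ih =>
    have hlt : ((m.map (C : R →+* MvPolynomial (Fin n) R)).comap (ev R n j)) <
        ((m.map (C : R →+* MvPolynomial (Fin n) R)).comap (ev R n (j + 1))) := by
      refine lt_of_le_of_ne ?_ ?_
      · intro f hf
        rw [Ideal.mem_comap] at hf ⊢
        have e : ev R n (j + 1) = (ev R n (j + 1)).comp (ev R n j) := by
          ext1 i
          by_cases hi : i.1 < j
          · simp [ev, hi, show i.1 < j + 1 by omega]; try omega
          · simp [ev, hi]
        rw [e, AlgHom.comp_apply]
        have hle : m.map (C : R →+* MvPolynomial (Fin n) R) ≤ (m.map C).comap (ev R n (j + 1)) := by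
          rw [Ideal.map_le_iff_le_comap]
          intro r hr
          rw [Ideal.mem_comap, Ideal.mem_comap]
          have : ev R n (j + 1) (C r) = C r := (ev R n (j + 1)).commutes r
          rw [this]; exact Ideal.mem_map_of_mem _ hr
        exact hle hf
      · intro h
        have h2 : (X ⟨j, hj⟩ : MvPolynomial (Fin n) R) ∈
          ((m.map (C : R →+* MvPolynomial (Fin n) R)).comap (ev R n j)) := by
          rw [h, Ideal.mem_comap]; simp [ev]
        rw [Ideal.mem_comap, mem_map_C_iff] at h2
        have := h2 (Finsupp.single ⟨j, hj⟩ 1)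
        simp [ev] at this
        exact hm.ne_top ((Ideal.eq_top_iff_one _).2 this)
    have := Ideal.height_add_one_le_of_lt_of_isPrime hlt
    refine le_trans ?_ this
    rw [Nat.cast_add, ← add_assoc]
    exact add_le_add (ih (by omega)) le_rfl

theorem ht_QQ [IsNoetherianRing R] (G : Subgroup (Matrix.GeneralLinearGroup (Fin n) R)) [Finite G]
    (m : Ideal R) [hm : m.IsPrime] : m.height + n ≤ (QQ G m).height := by
  have h1 := primeC (τ := Fin n) m
  have hIntg := integral_inv G
  let F : PrimeSpectrum (MvPolynomial (Fin n) R) → PrimeSpectrum (invariants G) :=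
    PrimeSpectrum.comap (algebraMap _ _)
  have hF : StrictMono F := by
    intro x y hxy
    exact Ideal.IsIntegral.comap_lt_comap hxy
  have h2 := Order.height_le_height_apply_of_strictMono F hF
    ⟨((m.map (C : R →+* MvPolynomial (Fin n) R)).comap (ev R n n)), inferInstance⟩
  rw [← PrimeSpectrum.height_eq_orderHeight, ← PrimeSpectrum.height_eq_orderHeight] at h2
  refine (chain_ht m n le_rfl).trans (h2.trans (le_of_eq ?_))
  congr 1
  ext t
  change ev R n n t.1 ∈ m.map (C : R →+* MvPolynomial (Fin n) R) ↔ constantCoeff t.1 ∈ m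
  have e : ∀ f, ev R n n f = C (constantCoeff f) := by
    intro f
    have : ev R n n = (Algebra.ofId R _).comp (MvPolynomial.aeval fun _ : Fin n => (0 : R)) := by
      ext1 i; simp [ev]
    rw [this]
    simp [Algebra.ofId_apply, aeval_zero, algebraMap_eq, constantCoeff]
  rw [e, mem_map_C_iff]
  constructor
  · intro h; simpa using h 0
  · intro h d
    classical
    rw [coeff_C]; split_ifs; exacts [h, m.zero_mem]

end hts
end CMInv

end

section
open MvPolynomial TensorProduct
set_option synthInstance.maxHeartbeats 1000000
set_option maxHeartbeats 1000000

namespace CMInv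

theorem DD_flat {A B : Type*} [CommRing A] [CommRing B] (f : A →+* B) (hf : f.Flat)
    (P : Ideal A) (Q : Ideal B) [P.IsPrime] [Q.IsPrime] (hPQ : P = Q.comap f)
    (rs : List (Localization.AtPrime P))
    (hm : ∀ r ∈ rs, r ∈ IsLocalRing.maximalIdeal (Localization.AtPrime P))
    (hr : RingTheory.Sequence.IsWeaklyRegular (Localization.AtPrime P) rs) :
    DD (B := Localization.AtPrime Q) rs.length ⊥ := by
  have hfl := hf.localRingHom Q P hPQ
  let φ := Localization.localRingHom P Q f hPQ
  have hloc : IsLocalHom φ := Localization.isLocalHom_localRingHom P Q f hPQ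
  let _ : Algebra (Localization.AtPrime P) (Localization.AtPrime Q) := φ.toAlgebra
  have : Module.Flat (Localization.AtPrime P) (Localization.AtPrime Q) := hfl
  have h1 := hr.of_flat (S := Localization.AtPrime Q)
  have h2 := DD_of_isWeaklyRegular _ (by
    intro r hr'
    obtain ⟨y, hy, rfl⟩ := List.mem_map.1 hr'
    have hy' := hm y hy
    rw [IsLocalRing.mem_maximalIdeal, mem_nonunits_iff] at hy' ⊢
    exact fun hu => hy' (hloc.map_nonunit y hu)) h1
  simpa using h2

section bc
variable {R : Type*} [CommRing R] {n : ℕ} (τ : Type*)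

/-- swap the two sets of variables -/
noncomputable abbrev Phi : MvPolynomial (Fin n) (MvPolynomial τ R) ≃ₐ[R]
    MvPolynomial τ (MvPolynomial (Fin n) R) := commAlgEquiv R (Fin n) τ

theorem glMap_inv (f : R →+* MvPolynomial τ R) (σ : Matrix.GeneralLinearGroup (Fin n) R)
    (i j : Fin n) : ((glMap f σ)⁻¹ : Matrix.GeneralLinearGroup (Fin n) (MvPolynomial τ R)) i j =
      f ((σ⁻¹ : Matrix.GeneralLinearGroup (Fin n) R) i j) := by
  rw [← map_inv]; rfl

theorem Phi_glAct (σ : Matrix.GeneralLinearGroup (Fin n) R)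
    (F : MvPolynomial (Fin n) (MvPolynomial τ R)) :
    Phi τ (glAct (glMap C σ) F) = MvPolynomial.map (glAct σ).toRingHom (Phi τ F) := by
  have : ((Phi (R := R) (n := n) τ).toRingEquiv.toRingHom).comp (glAct (glMap C σ)).toRingHom =
      (MvPolynomial.map (glAct σ).toRingHom).comp (Phi τ).toRingEquiv.toRingHom := by
    apply MvPolynomial.ringHom_ext
    · intro r
      change Phi τ (glAct (glMap C σ) (C r)) = MvPolynomial.map (glAct σ).toRingHom (Phi τ (C r))
      rw [glAct_C, commAlgEquiv_C, MvPolynomial.map_map]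
      have e : (glAct σ).toRingHom.comp C = C := RingHom.ext fun x => glAct_C σ x
      rw [e]
    · intro i
      change Phi τ (glAct (glMap C σ) (X i)) = MvPolynomial.map (glAct σ).toRingHom (Phi τ (X i))
      rw [commAlgEquiv_X, glAct_X, MvPolynomial.map_C]
      change _ = C (glAct σ (X i))
      rw [glAct_X, lf, lf, map_sum, map_sum]
      refine Finset.sum_congr rfl fun j _ => ?_
      rw [map_mul, commAlgEquiv_X, commAlgEquiv_C, glMap_inv, MvPolynomial.map_C, C_mul]
  exact DFunLike.congr_fun this F

variable (G : Subgroup (Matrix.GeneralLinearGroup (Fin n) R))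

/-- extended group -/
noncomputable abbrev GG : Subgroup (Matrix.GeneralLinearGroup (Fin n) (MvPolynomial τ R)) :=
  G.map (glMap C)

theorem mem_inv' {F : MvPolynomial (Fin n) (MvPolynomial τ R)} :
    F ∈ invariants (GG τ G) ↔ ∀ α, coeff α (Phi τ F) ∈ invariants G := by
  simp only [mem_inv]
  constructor
  · intro h α σ hσ
    have := h (glMap C σ) (Subgroup.mem_map_of_mem _ hσ)
    have := congrArg (coeff α) (congrArg (Phi τ) this)
    rw [Phi_glAct, coeff_map] at this
    exact this
  · rintro h _ ⟨σ, hσ, rfl⟩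
    apply (Phi τ).injective
    rw [Phi_glAct]
    ext1 α
    rw [coeff_map]
    exact h α σ hσ

theorem Phi_map (f : MvPolynomial (Fin n) R) : Phi τ (MvPolynomial.map C f) = C f := by
  induction f using MvPolynomial.induction_on with
  | C r => rw [MvPolynomial.map_C, commAlgEquiv_C, MvPolynomial.map_C]
  | add p q hp hq => rw [map_add, map_add, hp, hq, map_add]
  | mul_X p i hp => rw [map_mul, map_mul, hp, MvPolynomial.map_X, commAlgEquiv_X, C_mul]

theorem Phi_hom {d : ℕ} {F : MvPolynomial (Fin n) (MvPolynomial τ R)} (hF : F.IsHomogeneous d)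
    (α : τ →₀ ℕ) : (coeff α (Phi τ F)).IsHomogeneous d := by
  rw [F.as_sum, map_sum, coeff_sum]
  refine IsHomogeneous.sum _ _ _ fun m hm => ?_
  have hm' : m.degree = d := by
    have := hF (mem_support_iff.1 hm)
    rw [Finsupp.degree_eq_weight_one]; exact this
  have e : monomial m (coeff m F) = C (coeff m F) * MvPolynomial.map C (monomial m (1 : R)) := by
    rw [map_monomial, C_1, C_mul_monomial, mul_one]
  rw [e, map_mul, Phi_map, commAlgEquiv_C, mul_comm, coeff_C_mul, coeff_map, mul_comm]
  exact hom_C_mul _ (isHomogeneous_monomial _ hm')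

noncomputable def EE : MvPolynomial τ (invariants G) →+* invariants (GG τ G) :=
  RingHom.codRestrict ((Phi τ).symm.toRingEquiv.toRingHom.comp
    (MvPolynomial.map (invariants G).val.toRingHom)) (invariants (GG τ G)) (by
      intro x
      rw [mem_inv']
      intro α
      change coeff α (Phi τ ((Phi τ).symm (MvPolynomial.map (invariants G).val.toRingHom x))) ∈ _
      rw [AlgEquiv.apply_symm_apply, coeff_map]
      exact (coeff α x).2)

theorem EE_val (x : MvPolynomial τ (invariants G)) :
    (EE τ G x).1 = (Phi τ).symm (MvPolynomial.map (invariants G).val.toRingHom x) := rfl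

theorem EE_bij : Function.Bijective (EE τ G) := by
  constructor
  · intro x y h
    have := congrArg Subtype.val h
    rw [EE_val, EE_val] at this
    exact MvPolynomial.map_injective (invariants G).val.toRingHom Subtype.val_injective
      ((Phi τ).symm.injective this)
  · intro F
    have hF := (mem_inv' τ G).1 F.2
    have : Phi τ F.1 ∈ Set.range (MvPolynomial.map (σ := τ) (invariants G).val.toRingHom) := by
      rw [MvPolynomial.mem_range_map_iff_coeffs_subset]
      intro c hc
      obtain ⟨α, -, rfl⟩ := mem_coeffs_iff.1 hc
      exact ⟨⟨_, hF α⟩, rfl⟩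
    obtain ⟨x, hx⟩ := this
    refine ⟨x, Subtype.ext ?_⟩
    rw [EE_val]
    erw [hx]
    exact (Phi τ).symm_apply_apply _

/-- base change map -/
noncomputable def io : invariants G →+* invariants (GG τ G) := (EE τ G).comp C

theorem io_val (t : invariants G) : (io τ G t).1 = MvPolynomial.map C t.1 := by
  apply (Phi τ).injective
  rw [Phi_map]
  change Phi τ ((Phi τ).symm (MvPolynomial.map (invariants G).val.toRingHom (C t))) = _
  rw [AlgEquiv.apply_symm_apply, MvPolynomial.map_C]; rfl

theorem C_flat {T : Type*} [CommRing T] : (C : T →+* MvPolynomial τ T).Flat :=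
  (RingHom.flat_algebraMap_iff (R := T) (S := MvPolynomial τ T)).2 inferInstance

theorem flat_aux {T U : Type*} [CommRing T] [CommRing U] (e : MvPolynomial τ T →+* U)
    (he : Function.Bijective e) : (e.comp C).Flat :=
  RingHom.Flat.comp (C_flat τ) (RingHom.Flat.of_bijective he)

theorem io_flat : (io τ G).Flat :=
  flat_aux τ (EE τ G) (EE_bij τ G)

theorem mem_mapC (m : Ideal R) (r : R) : C r ∈ m.map (C : R →+* MvPolynomial τ R) ↔ r ∈ m := by
  rw [mem_map_C_iff]
  constructor
  · intro h; simpa using h 0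
  · intro h d
    classical
    rw [coeff_C]; split_ifs; exacts [h, m.zero_mem]

theorem QQ_comap (m : Ideal R) : QQ G m = (QQ (GG τ G) (m.map C)).comap (io τ G) := by
  ext t
  change constantCoeff t.1 ∈ m ↔ constantCoeff (io τ G t).1 ∈ m.map (C : R →+* MvPolynomial τ R)
  rw [io_val, constantCoeff_map, mem_mapC]

theorem glMap_inj : Function.Injective (glMap (n := n) (C : R →+* MvPolynomial τ R)) := by
  intro σ τ' h
  apply Units.ext
  have := congrArg Units.val h
  ext i j
  have := congrFun (congrFun this i) j
  exact C_injective τ R this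

theorem gen_generic (m : Ideal R) [hm : m.IsPrime] :
    Gen (GG (Fin n × Fin n) G) (fun i j => X (i, j)) (m.map C) := by
  intro s hs
  choose σ hσ hσs using fun i => (Subgroup.mem_map.1 (s i).2)
  let e : MvPolynomial (Fin n × Fin n) R →+* R := eval fun x => (σ x.1 : Matrix (Fin n) (Fin n) R) x.1 x.2
  have hle : m.map (C : R →+* MvPolynomial (Fin n × Fin n) R) ≤ m.comap e := by
    rw [Ideal.map_le_iff_le_comap]
    intro r hr
    simpa [e] using hr
  have h1 := hle hs
  rw [Ideal.mem_comap, RingHom.map_det] at h1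
  have h2 : e.mapMatrix (Matrix.of fun i => Matrix.vecMul (fun j => X (i, j))
      (((s i).1⁻¹ : Matrix.GeneralLinearGroup (Fin n) (MvPolynomial (Fin n × Fin n) R)) :
        Matrix (Fin n) (Fin n) (MvPolynomial (Fin n × Fin n) R))) = 1 := by
    ext i k
    rw [RingHom.mapMatrix_apply, Matrix.map_apply, Matrix.of_apply, ← hσs i]
    have h3 : ((σ i : Matrix (Fin n) (Fin n) R) *
      ((σ i)⁻¹ : Matrix.GeneralLinearGroup (Fin n) R).1) i k = (1 : Matrix (Fin n) (Fin n) R) i k := by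
      rw [← Units.val_mul, mul_inv_cancel, Units.val_one]
    rw [← h3, Matrix.mul_apply]
    simp only [Matrix.vecMul, dotProduct, map_sum, map_mul]
    refine Finset.sum_congr rfl fun j _ => ?_
    congr 1
    · simp [e]
    · have := glMap_inv (Fin n × Fin n) C (σ i) j k
      rw [this]
      simp [e]
  rw [h2, Matrix.det_one] at h1
  exact hm.ne_top ((Ideal.eq_top_iff_one _).2 h1)

theorem thmB [IsDomain R] [IsNoetherianRing R] [Finite G]
    (hCM : IsCohenMacaulayRing (invariants G)) (m : Ideal R) [hm : m.IsMaximal]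
    {d : ℕ} {u : MvPolynomial (Fin n) R} (hu : u ∈ invariants G) (hud : u.IsHomogeneous d)
    (hd : n * (Nat.card G - 1) < d) (A : Subalgebra R (MvPolynomial (Fin n) R))
    (hA : ∀ x ∈ invariants G, ∀ e, (e = Nat.card G ∨ e = d - Nat.card G) → x.IsHomogeneous e → x ∈ A) :
    ∃ c, c ∉ m ∧ C c * u ∈ A := by
  let τ := Fin n × Fin n
  have hmp : m.IsPrime := hm.isPrime
  have hpp := primeC (τ := τ) m
  let eqv : G ≃* GG τ G := G.equivMapOfInjective _ (glMap_inj τ)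
  have hfin : Finite (GG τ G) := Finite.of_equiv _ eqv.toEquiv
  have := Fintype.ofFinite (GG τ G)
  have hcard : Fintype.card (GG τ G) = Nat.card G := by
    rw [← Nat.card_eq_fintype_card]; exact (Nat.card_congr eqv.toEquiv).symm
  have hM : (QQ G m).IsMaximal := by
    refine Ideal.comap_isMaximal_of_surjective (cc G) ?_
    intro r
    exact ⟨algebraMap R _ r, by
      change constantCoeff (algebraMap R (MvPolynomial (Fin n) R) r) = r
      simp [algebraMap_eq]⟩
  obtain ⟨rs, hrm, hreg, hlen⟩ := hCM (QQ G m) hM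
  rw [IsLocalization.AtPrime.ringKrullDim_eq_height (QQ G m)] at hlen
  have hlen' : (rs.length : ℕ∞) = (QQ G m).height := by exact_mod_cast hlen
  have hfh := Ideal.finiteHeight_of_isNoetherianRing m
  obtain ⟨k, hk⟩ := ENat.ne_top_iff_exists.1 (Ideal.height_ne_top_of_isPrime (I := m))
  have hle := ht_QQ G m
  rw [← hlen', ← hk] at hle
  have hle' : k + n ≤ rs.length := by exact_mod_cast hle
  have hDD := (DD_flat (io τ G) (io_flat τ G) (QQ G m) (QQ (GG τ G) (m.map C)) (QQ_comap τ G m)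
    rs hrm hreg.toIsWeaklyRegular).mono hle'
  obtain ⟨w, hw, h, hh, hsum⟩ := thmA (GG τ G) (m.map C) (fun i j => X (i, j))
    (gen_generic G m) k (by rw [ht_mapC, hk]) hDD (u := MvPolynomial.map C u) (io_val τ G ⟨u, hu⟩ ▸ (io τ G ⟨u, hu⟩).2)
    (hud.map C) (by rw [hcard]; exact hd)
  rw [mem_map_C_iff] at hw
  push Not at hw
  obtain ⟨α, hα⟩ := hw
  refine ⟨coeff α w, hα, ?_⟩
  have h1 := congrArg (coeff α) (congrArg (Phi τ) hsum)
  rw [map_mul, Phi_map, commAlgEquiv_C, mul_comm, coeff_C_mul, coeff_map, map_sum, coeff_sum, mul_comm] at h1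
  rw [h1]
  refine Subalgebra.sum_mem _ fun i _ => ?_
  rw [map_mul, coeff_mul]
  refine Subalgebra.sum_mem _ fun x _ => Subalgebra.mul_mem _ ?_ ?_
  · exact hA _ ((mem_inv' τ G).1 (hh i).1 _) _ (Or.inr rfl) (hcard ▸ Phi_hom τ (hh i).2 _)
  · exact hA _ ((mem_inv' τ G).1 (nf_mem _ _ i) _) _ (Or.inl rfl) (hcard ▸ Phi_hom τ (nf_hom _ _ i) _)

theorem final [IsDomain R] [IsNoetherianRing R] [Finite G]
    (hCM : IsCohenMacaulayRing (invariants G)) :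
    genByDeg R G (max (Nat.card G) (n * (Nat.card G - 1))) := by
  set D := max (Nat.card G) (n * (Nat.card G - 1)) with hD
  have hg : 1 ≤ Nat.card G := Nat.card_pos
  unfold genByDeg
  set A := Algebra.adjoin R {f : MvPolynomial (Fin n) R |
    f ∈ invariants G ∧ ∃ i ≤ D, MvPolynomial.IsHomogeneous f i} with hAdef
  have key : ∀ d : ℕ, ∀ u ∈ invariants G, u.IsHomogeneous d → u ∈ A := by
    intro d
    induction d using Nat.strong_induction_on with
    | _ d ih =>
      intro u hu hud
      by_cases hd : d ≤ D
      · exact Algebra.subset_adjoin ⟨hu, d, hd, hud⟩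
      · let J : Ideal R := (Subalgebra.toSubmodule A).comap (LinearMap.toSpanSingleton R _ u)
        have hJ : ∀ c, c ∈ J ↔ C c * u ∈ A := by
          intro c
          change c • u ∈ A ↔ _
          rw [smul_eq_C_mul]
        by_cases hJt : J = ⊤
        · have := (hJ 1).1 (hJt ▸ Submodule.mem_top)
          simpa using this
        · obtain ⟨m, hm, hJm⟩ := Ideal.exists_le_maximal J hJt
          obtain ⟨c, hc, hcu⟩ := thmB G hCM m hu hud (by omega) A (by
            rintro x hx e he hxe
            exact ih e (by omega) x hx hxe)
          exact absurd (hJm ((hJ c).2 hcu)) hc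
  apply le_antisymm
  · exact Algebra.adjoin_le fun f hf => hf.1
  · intro f hf
    rw [← sum_homogeneousComponent f]
    exact Subalgebra.sum_mem _ fun i _ => key i _ (comp_mem_inv hf i)
      (homogeneousComponent_isHomogeneous i f)

end bc
end CMInv

end

/-- main theorem. Let `R` be a Noetherian integral domain and
`G ⊆ GLₙ(R)` a finite subgroup. If the ring of invariants `R[x₁,…,xₙ]^G` is a
Cohen-Macaulay ring, then it is generated as an `R`-algebra by homogeneous elements of
degree at most `max(|G|, n(|G| - 1))`, i.e. `β_R(G) ≤ max(|G|, n(|G| - 1))`. -/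
theorem stmt_16 {n : ℕ} (R : Type*) [CommRing R] [IsDomain R] [IsNoetherianRing R]
    (G : Subgroup (Matrix.GeneralLinearGroup (Fin n) R)) [Finite G]
    (hCM : IsCohenMacaulayRing ↥(invariants G)) :
    genByDeg R G (max (Nat.card G) (n * (Nat.card G - 1))) := by
  exact CMInv.final G hCM
end
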